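/- The integral cohomology of Γ₀(3) is: Hⁱ(Γ₀(3), ℤ) ≅ ℤ for i = 0 and i = 1, Hⁱ(Γ₀(3), ℤ) ≅ ℤ/6 for all even i ≥ 2, and Hⁱ(Γ₀(3), ℤ) ≅ ℤ/2 for all odd i ≥ 3. Moreover, Hⁱ(SL₂(ℤ[1/3]), ℤ) ≅ 0 for all odd i ≥ 1, ℤ ⊕ ℤ/4 for i = 2, and ℤ/12 ⊕ ℤ/4 for all even i ≥ 4. -/

import Mathlib

section Part1
namespace SL2Coh
open CategoryTheory

noncomputable section
variable {k G : Type} [CommRing k] [Group G]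
variable {V V' V'' : Type} [AddCommGroup V] [Module k V] [AddCommGroup V'] [Module k V']
  [AddCommGroup V''] [Module k V'']
variable {ρ : Representation k G V} {ρ' : Representation k G V'} {ρ'' : Representation k G V''}

abbrev H (ρ : Representation k G V) (n : ℕ) : Type := groupCohomology (Rep.of ρ) n

/-- Functoriality of group cohomology in the coefficients. -/
def Hmap (f : ρ.IntertwiningMap ρ') (n : ℕ) : H ρ n →ₗ[k] H ρ' n :=
  (groupCohomology.map (MonoidHom.id G) (Rep.ofHom f) n).hom

theorem Hmap_id (n : ℕ) (x : H ρ n) : Hmap (.id ρ) n x = x := by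
  have := groupCohomology.map_id (B := Rep.of ρ) (n := n)
  exact congrArg (fun t => ModuleCat.Hom.hom t x) this

theorem Hmap_comp (g : ρ'.IntertwiningMap ρ'') (f : ρ.IntertwiningMap ρ') (n : ℕ) (x : H ρ n) :
    Hmap (g.comp f) n x = Hmap g n (Hmap f n x) := by
  have := groupCohomology.map_id_comp (Rep.ofHom f) (Rep.ofHom g) n
  exact congrArg (fun t => ModuleCat.Hom.hom t x) this

theorem Hmap_add (g f : ρ.IntertwiningMap ρ') (n : ℕ) (x : H ρ n) :
    Hmap (g + f) n x = Hmap g n x + Hmap f n x := by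
  have h1 : groupCohomology.cochainsMap (A := Rep.of ρ) (B := Rep.of ρ') (MonoidHom.id G)
      (Rep.ofHom (g + f)) =
    groupCohomology.cochainsMap (A := Rep.of ρ) (B := Rep.of ρ') (MonoidHom.id G) (Rep.ofHom g) +
    groupCohomology.cochainsMap (A := Rep.of ρ) (B := Rep.of ρ') (MonoidHom.id G) (Rep.ofHom f) := by
      ext i x
      rfl
  have : groupCohomology.map (A := Rep.of ρ) (B := Rep.of ρ') (MonoidHom.id G)
      (Rep.ofHom (g + f)) n =
    groupCohomology.map (A := Rep.of ρ) (B := Rep.of ρ') (MonoidHom.id G) (Rep.ofHom g) n +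
    groupCohomology.map (A := Rep.of ρ) (B := Rep.of ρ') (MonoidHom.id G) (Rep.ofHom f) n := by
      rw [groupCohomology.map, h1, HomologicalComplex.homologyMap_add]; rfl
  exact congrArg (fun t => ModuleCat.Hom.hom t x) this

theorem Hmap_zero (n : ℕ) (x : H ρ n) :
    Hmap (0 : ρ.IntertwiningMap ρ') n x = 0 := by
  have := Hmap_add (0 : ρ.IntertwiningMap ρ') 0 n x
  rw [add_zero] at this
  simpa using this

theorem Hmap_nsmul (f : ρ.IntertwiningMap ρ') (n m : ℕ) (x : H ρ n) :
    Hmap (m • f) n x = m • Hmap f n x := by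
  induction m with
  | zero => rw [zero_smul, zero_smul, Hmap_zero]
  | succ m ih => rw [succ_nsmul, succ_nsmul, Hmap_add, ih]

theorem les (f : ρ.IntertwiningMap ρ') (g : ρ'.IntertwiningMap ρ'')
    (hf : Function.Injective f) (hg : Function.Surjective g) (he : Function.Exact f g) :
    ∃ δ : ∀ n, H ρ'' n →ₗ[k] H ρ (n + 1), ∀ n, Function.Exact (Hmap f n) (Hmap g n) ∧
      Function.Exact (Hmap g n) (δ n) ∧ Function.Exact (δ n) (Hmap f (n + 1)) := by
  have w : Rep.ofHom f ≫ Rep.ofHom g = 0 := by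
    ext x
    exact (he (f x)).2 ⟨x, rfl⟩
  let X : ShortComplex (Rep k G) := ⟨Rep.ofHom f, Rep.ofHom g, w⟩
  have hX : X.ShortExact := by
    have hm : Mono X.f := (Rep.mono_iff_injective (Rep.ofHom f)).2 hf
    have hp : Epi X.g := (Rep.epi_iff_surjective (Rep.ofHom g)).2 hg
    refine ShortComplex.ShortExact.mk ?_
    have : (X.map (forget₂ (Rep k G) (ModuleCat k))).Exact := by
      rw [ShortComplex.moduleCat_exact_iff]
      intro x hx
      exact (he x).1 hx
    exact (ShortComplex.exact_map_iff_of_faithful X (forget₂ (Rep k G) (ModuleCat k))).1 this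
  refine ⟨fun n => (groupCohomology.δ hX n (n+1) rfl).hom, fun n => ⟨?_, ?_, ?_⟩⟩
  · have := groupCohomology.mapShortComplex₂_exact hX n
    rw [ShortComplex.ShortExact.moduleCat_exact_iff_function_exact] at this
    exact this
  · have := groupCohomology.mapShortComplex₃_exact hX (i := n) (j := n+1) rfl
    rw [ShortComplex.ShortExact.moduleCat_exact_iff_function_exact] at this
    exact this
  · have := groupCohomology.mapShortComplex₁_exact hX (i := n) (j := n+1) rfl
    rw [ShortComplex.ShortExact.moduleCat_exact_iff_function_exact] at this
    exact this

/-- degree zero -/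
def H0e (ρ : Representation k G V) : H ρ 0 ≃ₗ[k] ρ.invariants :=
  (groupCohomology.H0Iso (Rep.of ρ)).toLinearEquiv

theorem H0e_map (f : ρ.IntertwiningMap ρ') (x : H ρ 0) :
    (H0e ρ' (Hmap f 0 x) : V') = f (H0e ρ x : V) := by
  have := groupCohomology.map_id_comp_H0Iso_hom (Rep.ofHom f)
  have h2 := congrArg (fun t => ModuleCat.Hom.hom t x) this
  exact congrArg Subtype.val h2

theorem Hmap_zero_injective (f : ρ.IntertwiningMap ρ') (hf : Function.Injective f) :
    Function.Injective (Hmap f 0) := by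
  intro x y h
  apply (H0e ρ).injective
  apply Subtype.ext
  apply hf
  rw [← H0e_map, ← H0e_map, h]

/-- Isomorphic representations have isomorphic cohomology. -/
def HequivG {G' : Type} [Group G'] {σ : Representation k G' V'} (e : G ≃* G') (e' : V ≃ₗ[k] V')
    (h : ∀ g v, e' (ρ g v) = σ (e g) (e' v)) (n : ℕ) : H ρ n ≃ₗ[k] H σ n :=
  (groupCohomology.mapIso (A := Rep.of σ) (B := Rep.of ρ) e e' (fun g => by ext v; exact h g v)
    n).toLinearEquiv

def Hequiv (e' : V ≃ₗ[k] V') (h : ∀ g v, e' (ρ g v) = ρ' g (e' v)) (n : ℕ) :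
    H ρ n ≃ₗ[k] H ρ' n :=
  HequivG (MulEquiv.refl G) e' h n

def shapiro {S : Subgroup G} (σ : Representation k S V) (n : ℕ) :
    H (Representation.coind S.subtype σ) n ≃ₗ[k] H σ n :=
  (groupCohomology.coindIso (Rep.of σ) n).toLinearEquiv

/-- products -/
theorem Hprod_bij (n : ℕ) : Function.Bijective
    ((Hmap (Representation.IntertwiningMap.fst k ρ ρ') n).prod
      (Hmap (Representation.IntertwiningMap.snd k ρ ρ') n)) := by
  have h1 : ∀ x, Hmap (.fst k ρ ρ') n (Hmap (.inl k ρ ρ') n x) = x := fun x => by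
    rw [← Hmap_comp]; exact Hmap_id n x
  have h2 : ∀ x, Hmap (.snd k ρ ρ') n (Hmap (.inr k ρ ρ') n x) = x := fun x => by
    rw [← Hmap_comp]; exact Hmap_id n x
  have h3 : ∀ x, Hmap (.fst k ρ ρ') n (Hmap (.inr k ρ ρ') n x) = 0 := fun x => by
    rw [← Hmap_comp]; exact Hmap_zero n x
  have h4 : ∀ x, Hmap (.snd k ρ ρ') n (Hmap (.inl k ρ ρ') n x) = 0 := fun x => by
    rw [← Hmap_comp]; exact Hmap_zero n x
  have h5 : ∀ x, x = Hmap (.inl k ρ ρ') n (Hmap (.fst k ρ ρ') n x) +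
      Hmap (.inr k ρ ρ') n (Hmap (.snd k ρ ρ') n x) := fun x => by
    rw [← Hmap_comp, ← Hmap_comp, ← Hmap_add]
    conv_lhs => rw [← Hmap_id n x]
    congr 1
    congr 1
    apply Representation.IntertwiningMap.ext
    apply LinearMap.ext
    rintro ⟨a, b⟩
    change (a, b) = (a, 0) + (0, b)
    simp
  constructor
  · intro x y h
    have ha := congrArg Prod.fst h
    have hb := congrArg Prod.snd h
    simp only [LinearMap.prod_apply, Function.prod_apply] at ha hb
    rw [h5 x, h5 y, ha, hb]
  · rintro ⟨a, b⟩
    refine ⟨Hmap (.inl k ρ ρ') n a + Hmap (.inr k ρ ρ') n b, ?_⟩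
    simp only [LinearMap.prod_apply, Function.prod_apply, map_add]
    rw [h1, h2, h3, h4]; simp

def Hprod (ρ : Representation k G V) (ρ' : Representation k G V') (n : ℕ) :
    H (ρ.prod ρ') n ≃ₗ[k] H ρ n × H ρ' n :=
  LinearEquiv.ofBijective _ (Hprod_bij n)

theorem Hprod_inl (n : ℕ) (x : H ρ n) : Hprod ρ ρ' n (Hmap (.inl k ρ ρ') n x) = (x, 0) := by
  apply Prod.ext
  · change Hmap (.fst k ρ ρ') n (Hmap (.inl k ρ ρ') n x) = x
    rw [← Hmap_comp]; exact Hmap_id n x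
  · change Hmap (.snd k ρ ρ') n (Hmap (.inl k ρ ρ') n x) = 0
    rw [← Hmap_comp]; exact Hmap_zero n x

/-- acyclic -/
def Acyclic (ρ : Representation k G V) : Prop := ∀ n, Subsingleton (H ρ (n + 1))

theorem Acyclic.prod (h : Acyclic ρ) (h' : Acyclic ρ') : Acyclic (ρ.prod ρ') := fun n => by
  have := h n
  have := h' n
  exact (Hprod ρ ρ' (n+1)).injective.subsingleton

/-- Right translation on functions. -/
def funRep (k G V : Type) [CommRing k] [Group G] [AddCommGroup V] [Module k V] :
    Representation k G (G → V) where
  toFun h := LinearMap.funLeft _ _ (· * h)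
  map_one' := by ext; simp
  map_mul' _ _ := by ext; simp [mul_assoc]

theorem funRep_apply (g h : G) (f : G → V) : funRep k G V g f h = f (h * g) := rfl

theorem funRep_acyclic : Acyclic (funRep k G V) := fun n => by
  let σ : Representation k (⊥ : Subgroup G) V := Representation.trivial k _ V
  have h0 : Subsingleton (H σ (n+1)) :=
    ModuleCat.subsingleton_of_isZero
      (isZero_groupCohomology_succ_of_subsingleton (Rep.of σ) n)
  have h1 : Subsingleton (H (Representation.coind (⊥ : Subgroup G).subtype σ) (n+1)) :=
    (shapiro σ (n+1)).injective.subsingleton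
  let e : Representation.coindV (⊥ : Subgroup G).subtype σ ≃ₗ[k] (G → V) :=
    LinearEquiv.ofBijective (Submodule.subtype _) ⟨Subtype.val_injective, fun f => ⟨⟨f, by
      rintro ⟨g, hg⟩ h
      rw [Subgroup.mem_bot] at hg
      subst hg
      simp [σ]⟩, rfl⟩⟩
  exact (Hequiv (ρ := Representation.coind (⊥ : Subgroup G).subtype σ) (ρ' := funRep k G V) e
    (fun g v => rfl) (n+1)).symm.injective.subsingleton

end
end SL2Coh
end Part1

section Part2
namespace SL2Coh
open CategoryTheory

noncomputable section
section algebra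
variable {k : Type} [CommRing k]
variable {V : Type} [AddCommGroup V] [Module k V]

/-- `1 + S + S² + S³` -/
def N4 (S : Module.End k V) : Module.End k V := LinearMap.id + S + S ∘ₗ S + S ∘ₗ S ∘ₗ S
/-- `1 + U + U²` -/
def N3 (U : Module.End k V) : Module.End k V := LinearMap.id + U + U ∘ₗ U
/-- `1 + U + ... + U⁵` -/
def N6 (U : Module.End k V) : Module.End k V := N3 U + U ∘ₗ U ∘ₗ U ∘ₗ N3 U

theorem N4_apply (S : Module.End k V) (v : V) : N4 S v = v + S v + S (S v) + S (S (S v)) := rfl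
theorem N3_apply (S : Module.End k V) (v : V) : N3 S v = v + S v + S (S v) := rfl
theorem N6_apply (S : Module.End k V) (v : V) :
    N6 S v = v + S v + S (S v) + S (S (S v)) + S (S (S (S v))) + S (S (S (S (S v)))) := by
  simp only [N6, N3, LinearMap.add_apply, LinearMap.comp_apply, LinearMap.id_apply, map_add]; abel

def d0 (S U : Module.End k V) : V →ₗ[k] V × V := (S - LinearMap.id).prod (U - LinearMap.id)

def d1 (S U : Module.End k V) : V × V →ₗ[k] V × V × V :=
  (N4 S ∘ₗ LinearMap.fst k V V).prod ((N6 U ∘ₗ LinearMap.snd k V V).prod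
    ((LinearMap.id + S) ∘ₗ LinearMap.fst k V V - N3 U ∘ₗ LinearMap.snd k V V))

def de (S U : Module.End k V) : V × V × V →ₗ[k] V × V × V :=
  ((S - LinearMap.id) ∘ₗ LinearMap.fst k V _).prod
    (((U - LinearMap.id) ∘ₗ LinearMap.fst k V V ∘ₗ LinearMap.snd k V _).prod
      (LinearMap.fst k V _ - LinearMap.fst k V V ∘ₗ LinearMap.snd k V _ -
        (LinearMap.id + S ∘ₗ S) ∘ₗ LinearMap.snd k V V ∘ₗ LinearMap.snd k V _))

def dd (S U : Module.End k V) : V × V × V →ₗ[k] V × V × V :=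
  (N4 S ∘ₗ LinearMap.fst k V _).prod
    ((N6 U ∘ₗ LinearMap.fst k V V ∘ₗ LinearMap.snd k V _).prod
      ((LinearMap.id + S) ∘ₗ LinearMap.fst k V _ -
        N3 U ∘ₗ LinearMap.fst k V V ∘ₗ LinearMap.snd k V _ -
        (S ∘ₗ S - LinearMap.id) ∘ₗ LinearMap.snd k V V ∘ₗ LinearMap.snd k V _))

theorem d0_apply (S U : Module.End k V) (v : V) : d0 S U v = (S v - v, U v - v) := rfl
theorem d1_apply (S U : Module.End k V) (a b : V) :
    d1 S U (a, b) = (N4 S a, N6 U b, (a + S a) - N3 U b) := rfl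
theorem de_apply (S U : Module.End k V) (a b c : V) :
    de S U (a, b, c) = (S a - a, U b - b, a - b - (c + S (S c))) := rfl
theorem dd_apply (S U : Module.End k V) (a b c : V) :
    dd S U (a, b, c) = (N4 S a, N6 U b, (a + S a) - N3 U b - (S (S c) - c)) := rfl

/-- Free data for an operator -/
def FD (x : Module.End k V) (n t : ℕ) : Prop :=
  ∃ P : ℕ → Module.End k V, (∀ i v, x (P i v) = P (i + 1) (x v)) ∧ P n = P 0 ∧
    ∀ v, ∑ i ∈ Finset.range n, P i v = t • v

theorem FD.one {x : Module.End k V} {n t : ℕ} (h : FD x n t) (f : V) (hf : x f = f) :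
    ∃ g, ∑ i ∈ Finset.range n, (x ^ i) g = t • f := by
  obtain ⟨P, h1, h2, h3⟩ := h
  refine ⟨P 0 f, ?_⟩
  rw [← h3]
  apply Finset.sum_congr rfl
  intro i hi
  clear hi
  induction i with
  | zero => rfl
  | succ i ih => rw [pow_succ', Module.End.mul_apply, ih, h1, hf]

theorem FD.two {x : Module.End k V} {n t : ℕ} (h : FD x n t) (f : V)
    (hf : ∑ i ∈ Finset.range n, (x ^ i) f = 0) : ∃ g, x g - g = t • f := by
  obtain ⟨P, h1, h2, h3⟩ := h
  let S : ℕ → V := fun j => ∑ i ∈ Finset.range j, (x ^ i) f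
  have hS : ∀ j, x (S j) = S (j + 1) - f := by
    intro j
    simp only [S, map_sum]
    rw [Finset.sum_range_succ']
    simp [pow_succ']
  have e1 : ∑ j ∈ Finset.range n, P (j + 1) (S (j + 1)) = ∑ j ∈ Finset.range n, P j (S j) := by
    have a1 := Finset.sum_range_succ (fun j => P j (S j)) n
    have a2 := Finset.sum_range_succ' (fun j => P j (S j)) n
    have a3 : S n = 0 := hf
    have a4 : S 0 = 0 := by simp [S]
    rw [a3, map_zero, add_zero] at a1
    rw [a4, map_zero, add_zero] at a2
    rw [← a1, ← a2]
  have e2 : ∑ j ∈ Finset.range n, P (j + 1) f = t • f := by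
    rw [← h3]
    have a1 := Finset.sum_range_succ (fun j => P j f) n
    have a2 := Finset.sum_range_succ' (fun j => P j f) n
    rw [h2] at a1
    exact add_right_cancel (a2.symm.trans a1)
  refine ⟨-∑ j ∈ Finset.range n, P j (S j), ?_⟩
  rw [map_neg, map_sum]
  simp only [h1, hS, map_sub]
  rw [Finset.sum_sub_distrib, e1, e2]
  abel

variable {S U : Module.End k V}

theorem sum4 (S : Module.End k V) (a : V) : ∑ i ∈ Finset.range 4, (S ^ i) a = N4 S a := by
  simp [Finset.sum_range_succ, N4_apply, pow_succ]
theorem sum6 (S : Module.End k V) (a : V) : ∑ i ∈ Finset.range 6, (S ^ i) a = N6 S a := by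
  simp [Finset.sum_range_succ, N6_apply, pow_succ]

theorem N4_sub (h4 : ∀ v, S (S (S (S v))) = v) (v : V) : N4 S (S v - v) = 0 := by
  simp only [N4_apply, map_sub, h4]; abel

theorem dd_range (h4 : ∀ v, S (S (S (S v))) = v) (y : V × V × V) :
    y ∈ LinearMap.range (dd S U) ↔ y ∈ LinearMap.range (d1 S U) := by
  constructor
  · rintro ⟨⟨a, b, c⟩, rfl⟩
    refine ⟨(a - (S c - c), b), ?_⟩
    rw [d1_apply, dd_apply, map_sub, N4_sub h4]
    simp only [map_sub, sub_zero, Prod.mk.injEq, true_and]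
    abel
  · rintro ⟨⟨a, b⟩, rfl⟩
    refine ⟨(a, b, 0), ?_⟩
    rw [d1_apply, dd_apply]
    simp

theorem kill_even {t : ℕ} (h4 : ∀ v, S (S (S (S v))) = v) (hu : ∀ v, U (U (U v)) = S (S v))
    (hS : FD S 4 1) (hZ : FD (S ∘ₗ S) 2 1) (hU : FD U 6 t) (y : V × V × V)
    (hy : de S U y = 0) : t • y ∈ LinearMap.range (d1 S U) := by
  rw [← dd_range h4]
  obtain ⟨a, b, c⟩ := y
  rw [de_apply] at hy
  simp only [Prod.mk_eq_zero] at hy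
  obtain ⟨ha, hb, hc⟩ := hy
  obtain ⟨a', ha'⟩ := hS.one a (sub_eq_zero.1 ha)
  obtain ⟨b', hb'⟩ := hU.one b (sub_eq_zero.1 hb)
  rw [sum4, one_smul] at ha'
  rw [sum6] at hb'
  obtain ⟨w, hw⟩ := hZ.two (t • (a' + S a') - N3 U b' - t • c) (by
    have e1 : a - b = c + S (S c) := sub_eq_zero.1 hc
    have e2 : t • a - t • b = t • c + t • S (S c) := by rw [← smul_sub, e1, smul_add]
    rw [← ha', ← hb', N4_apply, N6_apply] at e2
    simp only [Finset.sum_range_succ, Finset.sum_range_zero, pow_zero, pow_one, zero_add,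
      Module.End.one_apply, LinearMap.comp_apply, map_sub, map_smul, map_add, map_nsmul, N3_apply]
    simp only [hu] at e2
    have e3 : ∀ v, S (S (U v)) = U (S (S v)) := fun v => by rw [← hu, ← hu]
    simp only [e3]
    rw [← sub_eq_zero] at e2
    rw [← e2]
    simp only [smul_add]
    abel)
  refine ⟨(t • a', b', w), ?_⟩
  rw [dd_apply, map_nsmul, ha', hb']
  rw [one_smul] at hw
  simp only [LinearMap.comp_apply] at hw
  rw [hw]
  simp only [map_nsmul, Prod.smul_mk, Prod.mk.injEq, true_and, smul_add]
  abel

theorem kill_odd {t : ℕ} (h4 : ∀ v, S (S (S (S v))) = v) (hu : ∀ v, U (U (U v)) = S (S v))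
    (hS : FD S 4 1) (hZ : FD (S ∘ₗ S) 2 1) (hU : FD U 6 t) (y : V × V × V)
    (hy : dd S U y = 0) : t • y ∈ LinearMap.range (de S U) := by
  obtain ⟨a, b, c⟩ := y
  rw [dd_apply] at hy
  simp only [Prod.mk_eq_zero] at hy
  obtain ⟨ha, hb, hc⟩ := hy
  obtain ⟨α, hα⟩ := hS.two a (by rw [sum4, ha])
  obtain ⟨β, hβ⟩ := hU.two b (by rw [sum6, hb])
  rw [one_smul] at hα
  obtain ⟨w, hw⟩ := hZ.one (t • α - β - t • c) (by
    have e2 : t • ((a + S a) - N3 U b - (S (S c) - c)) = 0 := by rw [hc, smul_zero]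
    rw [smul_sub, smul_sub, ← map_nsmul (N3 U), ← hα, ← hβ] at e2
    simp only [N3_apply, map_sub, hu] at e2
    simp only [LinearMap.comp_apply, map_sub, map_nsmul]
    rw [← sub_eq_zero]
    rw [← e2]
    simp only [smul_sub, smul_add]
    abel)
  simp only [Finset.sum_range_succ, Finset.sum_range_zero, pow_zero, pow_one, zero_add,
      Module.End.one_apply, LinearMap.comp_apply, one_smul] at hw
  refine ⟨(t • α, β, w), ?_⟩
  rw [de_apply, hw, map_nsmul, ← smul_sub, hα, hβ]
  simp only [Prod.smul_mk, Prod.mk.injEq, true_and]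
  abel

theorem de_d1 (h4 : ∀ v, S (S (S (S v))) = v) (hu : ∀ v, U (U (U v)) = S (S v)) (x : V × V) :
    de S U (d1 S U x) = 0 := by
  obtain ⟨a, b⟩ := x
  have e3 : ∀ v, S (S (U v)) = U (S (S v)) := fun v => by rw [← hu, ← hu]
  rw [d1_apply, de_apply]
  simp only [N4_apply, N6_apply, N3_apply, map_sub, map_add, h4, hu, e3, Prod.mk_eq_zero]
  refine ⟨?_, ?_, ?_⟩ <;> abel

theorem dd_de (h4 : ∀ v, S (S (S (S v))) = v) (hu : ∀ v, U (U (U v)) = S (S v)) (x : V × V × V) :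
    dd S U (de S U x) = 0 := by
  obtain ⟨a, b, c⟩ := x
  have e3 : ∀ v, S (S (U v)) = U (S (S v)) := fun v => by rw [← hu, ← hu]
  rw [de_apply, dd_apply]
  simp only [N4_apply, N6_apply, N3_apply, map_sub, map_add, h4, hu, e3, Prod.mk_eq_zero]
  refine ⟨?_, ?_, ?_⟩ <;> abel

theorem d1_d0 (h4 : ∀ v, S (S (S (S v))) = v) (hu : ∀ v, U (U (U v)) = S (S v)) (x : V) :
    d1 S U (d0 S U x) = 0 := by
  have e3 : ∀ v, S (S (U v)) = U (S (S v)) := fun v => by rw [← hu, ← hu]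
  rw [d0_apply, d1_apply]
  simp only [N4_apply, N6_apply, N3_apply, map_sub, map_add, h4, hu, e3, Prod.mk_eq_zero]
  refine ⟨?_, ?_, ?_⟩ <;> abel

end algebra
end
end SL2Coh
end Part2

section Part3
set_option linter.unusedSimpArgs false
set_option linter.unusedVariables false
namespace SL2Coh
open CategoryTheory

noncomputable section
variable {k G : Type} [CommRing k] [Group G]
variable {V V' V'' : Type} [AddCommGroup V] [Module k V] [AddCommGroup V'] [Module k V']
  [AddCommGroup V''] [Module k V'']
variable {ρ : Representation k G V} {ρ' : Representation k G V'} {ρ'' : Representation k G V''}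

def kerRep (d : ρ.IntertwiningMap ρ') : Representation k G (LinearMap.ker d.toLinearMap) where
  toFun g := (ρ g).restrict fun x hx => by
    rw [LinearMap.mem_ker] at hx ⊢
    change d x = 0 at hx
    change d (ρ g x) = 0
    rw [Representation.IntertwiningMap.isIntertwining, hx, map_zero]
  map_one' := by ext; simp
  map_mul' _ _ := by ext; simp

theorem kerRep_coe (d : ρ.IntertwiningMap ρ') (g : G) (x : LinearMap.ker d.toLinearMap) :
    (kerRep d g x : V) = ρ g x := rfl

/-- `Q` is the homology at the middle of `I → J → L`. -/
def IsHomology {I J L : Type} [AddCommGroup I] [Module k I] [AddCommGroup J] [Module k J]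
    [AddCommGroup L] [Module k L] (d : I →ₗ[k] J) (d' : J →ₗ[k] L) (Q : Type) [AddCommGroup Q]
    [Module k Q] : Prop :=
  ∃ π : LinearMap.ker d' →ₗ[k] Q, Function.Surjective π ∧
    ∀ x, π x = 0 ↔ (x : J) ∈ LinearMap.range d

theorem kstep (d : ρ.IntertwiningMap ρ') (d' : ρ'.IntertwiningMap ρ'') (hex : Function.Exact d d')
    (hac : Acyclic ρ) :
    (∃ π : H (kerRep d') 0 →ₗ[k] H (kerRep d) 1, Function.Surjective π ∧
      ∀ x, π x = 0 ↔ ∃ y : H ρ 0, ((H0e _ x).1 : V') = d (H0e _ y).1) ∧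
    ∀ n, Nonempty (H (kerRep d') (n + 1) ≃ₗ[k] H (kerRep d) (n + 2)) := by
  let f : (kerRep d).IntertwiningMap ρ := ⟨Submodule.subtype _, fun g => rfl⟩
  let g : ρ.IntertwiningMap (kerRep d') := ⟨d.toLinearMap.codRestrict _ (fun x => by
    rw [LinearMap.mem_ker]; exact (hex _).2 ⟨x, rfl⟩), fun g => by
      ext x
      exact Representation.IntertwiningMap.isIntertwining _ _ d g x⟩
  have hgd : ∀ x, (g x : V') = d x := fun _ => rfl
  obtain ⟨δ, hδ⟩ := les f g (by intro x y h; exact Subtype.ext h)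
    (by
      rintro ⟨y, hy⟩
      obtain ⟨x, hx⟩ := (hex y).1 hy
      exact ⟨x, Subtype.ext hx⟩)
    (by
      intro x
      constructor
      · intro h
        exact ⟨⟨x, congrArg Subtype.val h⟩, rfl⟩
      · rintro ⟨y, rfl⟩
        exact Subtype.ext y.2)
  constructor
  · refine ⟨δ 0, ?_, ?_⟩
    · intro y
      have := hac 0
      exact ((hδ 0).2.2 y).1 (Subsingleton.elim _ _)
    · intro x
      rw [(hδ 0).2.1 x]
      constructor
      · rintro ⟨y, rfl⟩
        exact ⟨y, by rw [H0e_map, hgd]⟩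
      · rintro ⟨y, hy⟩
        refine ⟨y, ?_⟩
        apply (H0e _).injective
        apply Subtype.ext
        apply Subtype.ext
        rw [hy, H0e_map, hgd]
  · intro n
    have h1 := hac n
    have h2 := hac (n + 1)
    refine ⟨LinearEquiv.ofBijective (δ (n + 1)) ⟨?_, ?_⟩⟩
    · rw [injective_iff_map_eq_zero]
      intro x hx
      obtain ⟨y, rfl⟩ := ((hδ (n + 1)).2.1 x).1 hx
      rw [Subsingleton.elim y 0, map_zero]
    · intro y
      exact ((hδ (n + 1)).2.2 y).1 (Subsingleton.elim _ _)

theorem kstep' {I J L : Type} [AddCommGroup I] [Module k I] [AddCommGroup J] [Module k J]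
    [AddCommGroup L] [Module k L] (a : I →ₗ[k] J) (a' : J →ₗ[k] L)
    (d : ρ.IntertwiningMap ρ') (d' : ρ'.IntertwiningMap ρ'') (hex : Function.Exact d d')
    (hac : Acyclic ρ) (cI : I →ₗ[k] V) (cJ : J →ₗ[k] V') (cL : L →ₗ[k] V'')
    (hI : ∀ x, (∀ g, ρ g x = x) ↔ ∃ v, cI v = x)
    (hJ : ∀ x, (∀ g, ρ' g x = x) ↔ ∃ v, cJ v = x) (hcJ : Function.Injective cJ)
    (hcL : Function.Injective cL)
    (h1 : ∀ x, d (cI x) = cJ (a x)) (h2 : ∀ x, d' (cJ x) = cL (a' x)) :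
    IsHomology a a' (H (kerRep d) 1) := by
  obtain ⟨⟨π, hs, hk⟩, -⟩ := kstep d d' hex hac
  have hmem : ∀ x : LinearMap.ker a', cJ x.1 ∈ LinearMap.ker d'.toLinearMap := by
    intro x
    rw [LinearMap.mem_ker]
    change d' (cJ x.1) = 0
    rw [h2, LinearMap.mem_ker.1 x.2, map_zero]
  let t : LinearMap.ker a' →ₗ[k] (kerRep d').invariants :=
    ((cJ ∘ₗ Submodule.subtype _).codRestrict (LinearMap.ker d'.toLinearMap) hmem).codRestrict _ (by
      intro x g
      apply Subtype.ext
      rw [kerRep_coe]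
      exact (hJ _).2 ⟨x.1, rfl⟩ g)
  have ht : ∀ x, ((t x).1 : V') = cJ x.1 := fun _ => rfl
  refine ⟨π ∘ₗ (H0e _).symm.toLinearMap ∘ₗ t, ?_, ?_⟩
  · apply hs.comp
    apply (H0e (kerRep d')).symm.surjective.comp
    intro y
    obtain ⟨v, hv⟩ := (hJ y.1.1).1 (fun g => by
      have := y.2 g
      exact congrArg Subtype.val this)
    refine ⟨⟨v, ?_⟩, Subtype.ext (Subtype.ext hv)⟩
    rw [LinearMap.mem_ker]
    apply hcL
    rw [← h2, hv, map_zero]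
    exact y.1.2
  · intro x
    simp only [LinearMap.comp_apply, LinearEquiv.coe_coe]
    rw [hk]
    simp only [LinearEquiv.apply_symm_apply, ht]
    constructor
    · rintro ⟨y, hy⟩
      obtain ⟨v, hv⟩ := (hI (H0e _ y).1).1 (H0e _ y).2
      refine ⟨v, hcJ ?_⟩
      rw [hy, ← h1, hv]
    · rintro ⟨v, hv⟩
      refine ⟨(H0e _).symm ⟨cI v, (hI _).2 ⟨v, rfl⟩⟩, ?_⟩
      rw [LinearEquiv.apply_symm_apply, h1, hv]

theorem IsHomology.congr {I J L : Type} [AddCommGroup I] [Module k I] [AddCommGroup J] [Module k J]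
    [AddCommGroup L] [Module k L] {d : I →ₗ[k] J} {d' : J →ₗ[k] L} {Q Q' : Type} [AddCommGroup Q]
    [Module k Q] [AddCommGroup Q'] [Module k Q'] (h : IsHomology d d' Q) (e : Q ≃ₗ[k] Q') :
    IsHomology d d' Q' := by
  obtain ⟨π, hs, hk⟩ := h
  exact ⟨e.toLinearMap ∘ₗ π, e.surjective.comp hs, fun x => by simp [hk]⟩

theorem IsHomology.congr_range {I I' J L : Type} [AddCommGroup I] [Module k I]
    [AddCommGroup I'] [Module k I'] [AddCommGroup J] [Module k J]
    [AddCommGroup L] [Module k L] {d : I →ₗ[k] J} {d₂ : I' →ₗ[k] J} {d' : J →ₗ[k] L}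
    {Q : Type} [AddCommGroup Q] [Module k Q] (h : IsHomology d d' Q)
    (e : ∀ y, y ∈ LinearMap.range d ↔ y ∈ LinearMap.range d₂) :
    IsHomology d₂ d' Q := by
  obtain ⟨π, hs, hk⟩ := h
  exact ⟨π, hs, fun x => by rw [hk, e]⟩

theorem IsHomology.unique {I J L : Type} [AddCommGroup I] [Module k I] [AddCommGroup J] [Module k J]
    [AddCommGroup L] [Module k L] {d : I →ₗ[k] J} {d' : J →ₗ[k] L} {Q Q' : Type} [AddCommGroup Q]
    [Module k Q] [AddCommGroup Q'] [Module k Q'] (h : IsHomology d d' Q) (h' : IsHomology d d' Q') :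
    Nonempty (Q ≃ₗ[k] Q') := by
  obtain ⟨π, hs, hk⟩ := h
  obtain ⟨π', hs', hk'⟩ := h'
  have e : LinearMap.ker π = LinearMap.ker π' := by
    ext x; rw [LinearMap.mem_ker, LinearMap.mem_ker, hk, hk']
  exact ⟨(π.quotKerEquivOfSurjective hs).symm.trans ((Submodule.quotEquivOfEq _ _ e).trans
    (π'.quotKerEquivOfSurjective hs'))⟩

structure ModData (G : Type) [Group G] (s u : G) : Prop where
  h4 : s * (s * (s * s)) = 1
  hu : u * (u * u) = s * s
  hz : s * s ≠ 1
  hu2 : u * u ≠ 1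
  gen : ∀ T : Subgroup G, s ∈ T → u ∈ T → T = ⊤
  tree : ∀ (M : Type) [AddCommGroup M] (F : G → M), (∀ g, F (s * s * g) = F g) →
    ∃ p q : G → M, (∀ g, p (s * g) = p g) ∧ (∀ g, q (u * g) = q g) ∧ ∀ g, F g = p g - q g

variable (ρ) in
/-- twisted left translation -/
def tw (x : G) : Module.End k (G → V) where
  toFun f g := ρ x (f (x⁻¹ * g))
  map_add' _ _ := by ext; simp
  map_smul' _ _ := by ext; simp

theorem tw_apply (x : G) (f : G → V) (g : G) : tw ρ x f g = ρ x (f (x⁻¹ * g)) := rfl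

theorem tw_mul (x y : G) (f : G → V) : tw ρ (x * y) f = tw ρ x (tw ρ y f) := by
  ext g; simp [tw_apply, mul_assoc]

theorem tw_one (f : G → V) : tw ρ 1 f = f := by
  ext g; simp [tw_apply]

theorem tw_comm (x h : G) (f : G → V) :
    tw ρ x (funRep k G V h f) = funRep k G V h (tw ρ x f) := by
  ext g; simp [tw_apply, funRep_apply, mul_assoc]

theorem tw_const (x : G) (v : V) : tw ρ x (Function.const G v) = Function.const G (ρ x v) := rfl

theorem exists_transversal (x : G) (n : ℕ) (hn : orderOf x = n) (h0 : 0 < n) :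
    ∃ e : G → k, ∀ g, ∑ i ∈ Finset.range n, e ((x ^ i)⁻¹ * g) = 1 := by
  classical
  let r : Setoid G := QuotientGroup.rightRel (Subgroup.zpowers x)
  let R : G → G := fun g => (Quotient.mk r g).out
  have hR : ∀ g, ∃ i < n, (x ^ i)⁻¹ * g = R g := by
    intro g
    have h1 : r (R g) g := Quotient.exact (Quotient.out_eq _)
    rw [QuotientGroup.rightRel_apply] at h1
    have hfo : IsOfFinOrder x := by rw [← orderOf_pos_iff, hn]; exact h0
    rw [hfo.mem_zpowers_iff_mem_range_orderOf] at h1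
    simp only [Finset.mem_image, Finset.mem_range, hn] at h1
    obtain ⟨i, hi, hx⟩ := h1
    refine ⟨i, hi, ?_⟩
    rw [hx]; group
  have hR2 : ∀ g i, R ((x ^ i)⁻¹ * g) = R g := by
    intro g i
    have : (Quotient.mk r ((x ^ i)⁻¹ * g)) = Quotient.mk r g := by
      apply Quotient.sound
      change r _ _
      rw [QuotientGroup.rightRel_apply]
      simp only [mul_inv_rev, inv_inv, mul_inv_cancel_left]
      exact Subgroup.pow_mem _ (Subgroup.mem_zpowers x) i
    simp only [R, this]
  refine ⟨fun g => if g = R g then 1 else 0, fun g => ?_⟩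
  obtain ⟨i, hi, hg⟩ := hR g
  rw [Finset.sum_eq_single i]
  · have : R (R g) = R g := by have := hR2 g i; rwa [hg] at this
    simp only [hg, this, if_true]
  · intro j hj hji
    refine if_neg ?_
    rw [hR2, ← hg]
    intro h
    apply hji
    have h1 := mul_right_cancel h
    have h2 := inv_injective h1
    exact pow_injOn_Iio_orderOf (by rw [hn]; simpa using hj) (by rw [hn]; simpa using hi) h2
  · intro h; simp at h; omega

theorem tw_FD (x : G) (n : ℕ) (hn : orderOf x = n) (h0 : 0 < n) : FD (tw ρ x) n 1 := by
  obtain ⟨e, he⟩ := exists_transversal (k := k) x n hn h0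
  refine ⟨fun i => { toFun := fun f g => e ((x ^ i)⁻¹ * g) • f g, map_add' := ?_, map_smul' := ?_ },
    ?_, ?_, ?_⟩
  · intro a b; ext; simp
  · intro a b; ext; exact smul_comm _ _ _
  · intro i f
    ext g
    have : (x ^ (i + 1))⁻¹ * g = (x ^ i)⁻¹ * (x⁻¹ * g) := by rw [pow_succ']; group
    simp only [tw_apply, LinearMap.coe_mk, AddHom.coe_mk, this, map_smul]
  · ext f g
    have : x ^ n = 1 := by rw [← hn]; exact pow_orderOf_eq_one x
    simp [this]
  · intro f
    ext g
    simp only [Finset.sum_apply, LinearMap.coe_mk, AddHom.coe_mk]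
    rw [← Finset.sum_smul, he, one_smul, one_smul]

section Dtheorem
variable {s u : G} (hM : ModData G s u)
include hM

theorem ModData.rs4 (ρ : Representation k G V) (v : V) : ρ s (ρ s (ρ s (ρ s v))) = v := by
  simp only [← Module.End.mul_apply, ← map_mul]
  rw [hM.h4]; simp

theorem ModData.ru3 (ρ : Representation k G V) (v : V) : ρ u (ρ u (ρ u v)) = ρ s (ρ s v) := by
  simp only [← Module.End.mul_apply, ← map_mul]
  rw [hM.hu]

theorem ModData.tw4 (ρ : Representation k G V) (f : G → V) :
    tw ρ s (tw ρ s (tw ρ s (tw ρ s f))) = f := by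
  simp only [← tw_mul]
  rw [hM.h4, tw_one]

theorem ModData.tw3 (ρ : Representation k G V) (f : G → V) :
    tw ρ u (tw ρ u (tw ρ u f)) = tw ρ s (tw ρ s f) := by
  simp only [← tw_mul]
  rw [hM.hu]

theorem ModData.os : orderOf s = 4 := by
  have h4 : s ^ 2 ^ (1 + 1) = 1 := by
    have := hM.h4
    rw [← this]; simp [pow_succ, mul_assoc]
  have h2 : ¬ s ^ 2 ^ 1 = 1 := by
    have := hM.hz
    simpa [pow_succ] using this
  rw [orderOf_eq_prime_pow h2 h4]; rfl

theorem ModData.oz : orderOf (s * s) = 2 := by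
  refine orderOf_eq_prime ?_ hM.hz
  rw [pow_two, mul_assoc, hM.h4]

theorem ModData.ou : orderOf u = 6 := by
  have h6 : u ^ 6 = 1 := by
    have := hM.oz
    have h : (s * s) ^ 2 = 1 := by rw [← this]; exact pow_orderOf_eq_one _
    rw [← hM.hu] at h
    rw [← h]; simp only [pow_succ, pow_zero, one_mul, mul_assoc]
  have hd := orderOf_dvd_of_pow_eq_one h6
  have h2 : ¬ orderOf u ∣ 2 := fun h => hM.hu2 (by
    have := orderOf_dvd_iff_pow_eq_one.1 h
    rwa [pow_two] at this)
  have h3 : ¬ orderOf u ∣ 3 := fun h => hM.hz (by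
    have := orderOf_dvd_iff_pow_eq_one.1 h
    rw [← hM.hu, ← this]; simp only [pow_succ, pow_zero, one_mul, mul_assoc])
  have hle := Nat.le_of_dvd (by norm_num) hd
  interval_cases (orderOf u) <;> simp_all

theorem ModData.fds (ρ : Representation k G V) : FD (tw ρ s) 4 1 :=
  tw_FD s 4 hM.os (by norm_num)
theorem ModData.fdu (ρ : Representation k G V) : FD (tw ρ u) 6 1 :=
  tw_FD u 6 hM.ou (by norm_num)
theorem ModData.fdz (ρ : Representation k G V) : FD (tw ρ s ∘ₗ tw ρ s) 2 1 := by
  have : tw ρ s ∘ₗ tw ρ s = tw ρ (s * s) := by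
    ext1 f; rw [LinearMap.comp_apply, tw_mul]
  rw [this]
  exact tw_FD (s * s) 2 hM.oz (by norm_num)

omit hM in
theorem tw_fix (x : G) (f : G → V) : tw ρ x f = f ↔ ∀ g, f (x * g) = ρ x (f g) := by
  constructor
  · intro h g
    conv_lhs => rw [← h]
    simp [tw_apply]
  · intro h
    ext g
    rw [tw_apply, ← h]; simp

theorem ModData.exact1 (ρ : Representation k G V) :
    Function.Exact (d0 (tw ρ s) (tw ρ u)) (d1 (tw ρ s) (tw ρ u)) := by
  rintro ⟨a, b⟩
  constructor
  · intro h
    rw [d1_apply] at h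
    simp only [Prod.mk_eq_zero] at h
    obtain ⟨ha, hb, hc⟩ := h
    obtain ⟨α, hα⟩ := (hM.fds ρ).two a (by rw [sum4, ha])
    obtain ⟨β, hβ⟩ := (hM.fdu ρ).two b (by rw [sum6, hb])
    rw [one_smul] at hα hβ
    have hz : tw ρ (s * s) (α - β) = α - β := by
      rw [tw_mul, ← sub_eq_zero]
      rw [← hα, ← hβ] at hc
      rw [← hc]
      simp only [N3_apply, map_sub, hM.tw3]
      abel
    rw [tw_fix] at hz
    obtain ⟨p, q, hp, hq, hpq⟩ := hM.tree V (fun g => ρ g⁻¹ ((α - β) g)) (by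
      intro g
      rw [hz]
      simp only [mul_inv_rev, ← Module.End.mul_apply, ← map_mul]
      congr 2
      group)
    have hp' : tw ρ s (fun g => ρ g (p g)) = (fun g => ρ g (p g)) := by
      rw [tw_fix]
      intro g
      simp only [hp, map_mul, Module.End.mul_apply]
    have hq' : tw ρ u (fun g => ρ g (q g)) = (fun g => ρ g (q g)) := by
      rw [tw_fix]
      intro g
      simp only [hq, map_mul, Module.End.mul_apply]
    have hpq' : α - (fun g => ρ g (p g)) = β - (fun g => ρ g (q g)) := by
      ext g
      have h1 := congrArg (ρ g) (hpq g)
      rw [map_sub, ← Module.End.mul_apply, ← map_mul, mul_inv_cancel, map_one] at h1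
      simp only [Module.End.one_apply, Pi.sub_apply] at h1 ⊢
      rw [sub_eq_sub_iff_add_eq_add] at h1 ⊢
      rw [h1]; abel
    refine ⟨α - (fun g => ρ g (p g)), ?_⟩
    rw [d0_apply]
    apply Prod.ext
    · simp only
      rw [map_sub, hp', ← hα]; abel
    · simp only
      rw [hpq', map_sub, hq', ← hβ]; abel
  · rintro ⟨f, hf⟩
    rw [← hf]
    exact d1_d0 (hM.tw4 ρ) (hM.tw3 ρ) f

theorem ModData.exact2 (ρ : Representation k G V) :
    Function.Exact (d1 (tw ρ s) (tw ρ u)) (de (tw ρ s) (tw ρ u)) := by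
  intro y
  constructor
  · intro h
    have := kill_even (hM.tw4 ρ) (hM.tw3 ρ) (hM.fds ρ) (hM.fdz ρ) (hM.fdu ρ) y h
    rwa [one_smul] at this
  · rintro ⟨f, hf⟩
    rw [← hf]
    exact de_d1 (hM.tw4 ρ) (hM.tw3 ρ) f

theorem ModData.exact3 (ρ : Representation k G V) :
    Function.Exact (de (tw ρ s) (tw ρ u)) (dd (tw ρ s) (tw ρ u)) := by
  intro y
  constructor
  · intro h
    have := kill_odd (hM.tw4 ρ) (hM.tw3 ρ) (hM.fds ρ) (hM.fdz ρ) (hM.fdu ρ) y h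
    rwa [one_smul] at this
  · rintro ⟨f, hf⟩
    rw [← hf]
    exact dd_de (hM.tw4 ρ) (hM.tw3 ρ) f

theorem ModData.exact4 (ρ : Representation k G V) :
    Function.Exact (dd (tw ρ s) (tw ρ u)) (de (tw ρ s) (tw ρ u)) := by
  intro y
  rw [hM.exact2 ρ y]
  exact (dd_range (hM.tw4 ρ) y).symm

end Dtheorem

abbrev E1 (k G V : Type) [CommRing k] [Group G] [AddCommGroup V] [Module k V] := funRep k G V
abbrev E2 (k G V : Type) [CommRing k] [Group G] [AddCommGroup V] [Module k V] :=
  (E1 k G V).prod (E1 k G V)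
abbrev E3 (k G V : Type) [CommRing k] [Group G] [AddCommGroup V] [Module k V] :=
  (E1 k G V).prod (E2 k G V)

theorem E3_ac : Acyclic (E3 k G V) := funRep_acyclic.prod (funRep_acyclic.prod funRep_acyclic)
theorem E2_ac : Acyclic (E2 k G V) := funRep_acyclic.prod funRep_acyclic

variable (ρ) in
def D0 (s u : G) : (E1 k G V).IntertwiningMap (E2 k G V) where
  __ := d0 (tw ρ s) (tw ρ u)
  isIntertwining' g := by
    apply LinearMap.ext
    intro f
    change d0 _ _ (funRep k G V g f) = ((funRep k G V g) (d0 (tw ρ s) (tw ρ u) f).1,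
      (funRep k G V g) (d0 (tw ρ s) (tw ρ u) f).2)
    simp only [d0_apply, tw_comm, map_sub]

variable (ρ) in
def D1 (s u : G) : (E2 k G V).IntertwiningMap (E3 k G V) where
  __ := d1 (tw ρ s) (tw ρ u)
  isIntertwining' g := by
    apply LinearMap.ext
    rintro ⟨a, b⟩
    change d1 _ _ (funRep k G V g a, funRep k G V g b) =
      ((funRep k G V g) (d1 (tw ρ s) (tw ρ u) (a, b)).1,
      (funRep k G V g) (d1 (tw ρ s) (tw ρ u) (a, b)).2.1,
      (funRep k G V g) (d1 (tw ρ s) (tw ρ u) (a, b)).2.2)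
    simp only [d1_apply, N4_apply, N6_apply, N3_apply, tw_comm, map_sub, map_add]

variable (ρ) in
def De (s u : G) : (E3 k G V).IntertwiningMap (E3 k G V) where
  __ := de (tw ρ s) (tw ρ u)
  isIntertwining' g := by
    apply LinearMap.ext
    rintro ⟨a, b, c⟩
    change de _ _ (funRep k G V g a, funRep k G V g b, funRep k G V g c) =
      ((funRep k G V g) (de (tw ρ s) (tw ρ u) (a, b, c)).1,
      (funRep k G V g) (de (tw ρ s) (tw ρ u) (a, b, c)).2.1,
      (funRep k G V g) (de (tw ρ s) (tw ρ u) (a, b, c)).2.2)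
    simp only [de_apply, N4_apply, N6_apply, N3_apply, tw_comm, map_sub, map_add]

variable (ρ) in
def Dd (s u : G) : (E3 k G V).IntertwiningMap (E3 k G V) where
  __ := dd (tw ρ s) (tw ρ u)
  isIntertwining' g := by
    apply LinearMap.ext
    rintro ⟨a, b, c⟩
    change dd _ _ (funRep k G V g a, funRep k G V g b, funRep k G V g c) =
      ((funRep k G V g) (dd (tw ρ s) (tw ρ u) (a, b, c)).1,
      (funRep k G V g) (dd (tw ρ s) (tw ρ u) (a, b, c)).2.1,
      (funRep k G V g) (dd (tw ρ s) (tw ρ u) (a, b, c)).2.2)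
    simp only [dd_apply, N4_apply, N6_apply, N3_apply, tw_comm, map_sub, map_add]

/-- constant functions -/
def c1 (k G V : Type) [CommRing k] [Group G] [AddCommGroup V] [Module k V] : V →ₗ[k] (G → V) where
  toFun v := Function.const G v
  map_add' _ _ := rfl
  map_smul' _ _ := rfl
def c2 (k G V : Type) [CommRing k] [Group G] [AddCommGroup V] [Module k V] :
    V × V →ₗ[k] (G → V) × (G → V) := (c1 k G V).prodMap (c1 k G V)
def c3 (k G V : Type) [CommRing k] [Group G] [AddCommGroup V] [Module k V] :
    V × V × V →ₗ[k] (G → V) × (G → V) × (G → V) := (c1 k G V).prodMap (c2 k G V)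

theorem c1_inj : Function.Injective (c1 k G V) := fun _ _ h => congrFun h 1
theorem c2_inj : Function.Injective (c2 k G V) := (c1_inj (k := k)).prodMap (c1_inj (k := k))
theorem c3_inj : Function.Injective (c3 k G V) := (c1_inj (k := k)).prodMap (c2_inj (k := k))

theorem c1_inv (x : G → V) : (∀ g, E1 k G V g x = x) ↔ ∃ v, c1 k G V v = x := by
  constructor
  · intro h
    refine ⟨x 1, ?_⟩
    ext g
    have := congrFun (h g) 1
    rw [funRep_apply, one_mul] at this
    exact this.symm
  · rintro ⟨v, rfl⟩ g
    rfl

theorem c2_inv (x : (G → V) × (G → V)) : (∀ g, E2 k G V g x = x) ↔ ∃ v, c2 k G V v = x := by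
  constructor
  · intro h
    obtain ⟨a, ha⟩ := (c1_inv (k := k) x.1).1 (fun g => congrArg Prod.fst (h g))
    obtain ⟨b, hb⟩ := (c1_inv (k := k) x.2).1 (fun g => congrArg Prod.snd (h g))
    exact ⟨(a, b), Prod.ext ha hb⟩
  · rintro ⟨v, rfl⟩ g
    rfl

theorem c3_inv (x : (G → V) × (G → V) × (G → V)) :
    (∀ g, E3 k G V g x = x) ↔ ∃ v, c3 k G V v = x := by
  constructor
  · intro h
    obtain ⟨a, ha⟩ := (c1_inv (k := k) x.1).1 (fun g => congrArg Prod.fst (h g))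
    obtain ⟨b, hb⟩ := (c2_inv (k := k) x.2).1 (fun g => congrArg Prod.snd (h g))
    exact ⟨(a, b), Prod.ext ha hb⟩
  · rintro ⟨v, rfl⟩ g
    rfl

section Dtheorem2
variable {s u : G} (hM : ModData G s u)
include hM

theorem ModData.ker0 (ρ : Representation k G V) (n : ℕ) :
    Nonempty (H (kerRep (D0 ρ s u)) n ≃ₗ[k] H ρ n) := by
  let f : V →ₗ[k] LinearMap.ker (D0 ρ s u).toLinearMap :=
    LinearMap.codRestrict _ ({ toFun := fun v g => ρ g v, map_add' := by intro a b; ext; simp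
                               map_smul' := by intro a b; ext; simp } : V →ₗ[k] (G → V)) (by
      intro v
      rw [LinearMap.mem_ker]
      apply Prod.ext
      · change tw ρ s (fun g => ρ g v) - (fun g => ρ g v) = 0
        rw [sub_eq_zero, tw_fix]
        intro g; simp
      · change tw ρ u (fun g => ρ g v) - (fun g => ρ g v) = 0
        rw [sub_eq_zero, tw_fix]
        intro g; simp)
  have hf : ∀ v g, (f v).1 g = ρ g v := fun _ _ => rfl
  let e : V ≃ₗ[k] LinearMap.ker (D0 ρ s u).toLinearMap := LinearEquiv.ofBijective f (by
    constructor
    · intro v w h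
      have := congrFun (congrArg Subtype.val h) 1
      rw [hf, hf] at this
      simpa using this
    · rintro ⟨x, hx⟩
      refine ⟨x 1, ?_⟩
      apply Subtype.ext
      ext g
      rw [hf]
      rw [LinearMap.mem_ker] at hx
      have h1 : tw ρ s x = x := sub_eq_zero.1 (congrArg Prod.fst hx)
      have h2 : tw ρ u x = x := sub_eq_zero.1 (congrArg Prod.snd hx)
      let T : Subgroup G :=
        { carrier := {y | tw ρ y x = x}
          mul_mem' := by
            intro a b ha hb
            simp only [Set.mem_ofPred_eq] at ha hb ⊢
            rw [tw_mul, hb, ha]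
          one_mem' := tw_one x
          inv_mem' := by
            intro a ha
            simp only [Set.mem_ofPred_eq] at ha ⊢
            conv_lhs => rw [← ha]
            rw [← tw_mul, inv_mul_cancel, tw_one] }
      have hT := hM.gen T h1 h2
      have hg : g ∈ T := by rw [hT]; trivial
      have := (tw_fix g x).1 hg 1
      rw [mul_one] at this
      exact this.symm)
  refine ⟨(Hequiv (ρ := ρ) (ρ' := kerRep (D0 ρ s u)) e ?_ n).symm⟩
  intro g v
  apply Subtype.ext
  ext h
  change ρ h (ρ g v) = ρ (h * g) v
  simp

theorem ModData.H1 (ρ : Representation k G V) :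
    IsHomology (d0 (ρ s) (ρ u)) (d1 (ρ s) (ρ u)) (H ρ 1) := by
  obtain ⟨e⟩ := hM.ker0 ρ 1
  refine IsHomology.congr ?_ e
  exact kstep' _ _ (D0 ρ s u) (D1 ρ s u) (hM.exact1 ρ) funRep_acyclic (c1 k G V) (c2 k G V)
    (c3 k G V) c1_inv c2_inv c2_inj c3_inj (fun x => rfl) (fun x => rfl)

theorem ModData.ker_1 (ρ : Representation k G V) :
    IsHomology (d1 (ρ s) (ρ u)) (de (ρ s) (ρ u)) (H (kerRep (D1 ρ s u)) 1) :=
  kstep' _ _ (D1 ρ s u) (De ρ s u) (hM.exact2 ρ) E2_ac (c2 k G V) (c3 k G V)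
    (c3 k G V) c2_inv c3_inv c3_inj c3_inj (fun x => rfl) (fun x => rfl)

theorem ModData.ker_e (ρ : Representation k G V) :
    IsHomology (de (ρ s) (ρ u)) (dd (ρ s) (ρ u)) (H (kerRep (De ρ s u)) 1) :=
  kstep' _ _ (De ρ s u) (Dd ρ s u) (hM.exact3 ρ) E3_ac (c3 k G V) (c3 k G V)
    (c3 k G V) c3_inv c3_inv c3_inj c3_inj (fun x => rfl) (fun x => rfl)

theorem ModData.ker_d (ρ : Representation k G V) :
    IsHomology (d1 (ρ s) (ρ u)) (de (ρ s) (ρ u)) (H (kerRep (Dd ρ s u)) 1) := by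
  refine IsHomology.congr_range ?_ (dd_range (hM.rs4 ρ))
  exact kstep' _ _ (Dd ρ s u) (De ρ s u) (hM.exact4 ρ) E3_ac (c3 k G V) (c3 k G V)
    (c3 k G V) c3_inv c3_inv c3_inj c3_inj (fun x => rfl) (fun x => rfl)

theorem ModData.per (ρ : Representation k G V) (m : ℕ) :
    IsHomology (d1 (ρ s) (ρ u)) (de (ρ s) (ρ u)) (H (kerRep (Dd ρ s u)) (2 * m + 1)) ∧
    IsHomology (de (ρ s) (ρ u)) (dd (ρ s) (ρ u)) (H (kerRep (De ρ s u)) (2 * m + 1)) := by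
  have a1 := (kstep (De ρ s u) (Dd ρ s u) (hM.exact3 ρ) E3_ac).2
  have a2 := (kstep (Dd ρ s u) (De ρ s u) (hM.exact4 ρ) E3_ac).2
  induction m with
  | zero => exact ⟨hM.ker_d ρ, hM.ker_e ρ⟩
  | succ m ih =>
    obtain ⟨e1⟩ := a1 (2 * m)
    obtain ⟨e2⟩ := a2 (2 * m + 1)
    obtain ⟨e3⟩ := a2 (2 * m)
    obtain ⟨e4⟩ := a1 (2 * m + 1)
    exact ⟨(ih.1.congr e1).congr e2, (ih.2.congr e3).congr e4⟩

theorem ModData.Heven (ρ : Representation k G V) (m : ℕ) :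
    IsHomology (d1 (ρ s) (ρ u)) (de (ρ s) (ρ u)) (H ρ (2 * m + 2)) := by
  obtain ⟨e⟩ := hM.ker0 ρ (2 * m + 2)
  refine IsHomology.congr ?_ e
  obtain ⟨e1⟩ := (kstep (D0 ρ s u) (D1 ρ s u) (hM.exact1 ρ) funRep_acyclic).2 (2 * m)
  refine IsHomology.congr ?_ e1
  cases m with
  | zero => exact hM.ker_1 ρ
  | succ m =>
    obtain ⟨e2⟩ := (kstep (D1 ρ s u) (De ρ s u) (hM.exact2 ρ) E2_ac).2 (2 * m + 1)
    refine IsHomology.congr ?_ e2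
    obtain ⟨e3⟩ := (kstep (De ρ s u) (Dd ρ s u) (hM.exact3 ρ) E3_ac).2 (2 * m)
    exact (hM.per ρ m).1.congr e3

theorem ModData.Hodd (ρ : Representation k G V) (m : ℕ) :
    IsHomology (de (ρ s) (ρ u)) (dd (ρ s) (ρ u)) (H ρ (2 * m + 3)) := by
  obtain ⟨e⟩ := hM.ker0 ρ (2 * m + 3)
  refine IsHomology.congr ?_ e
  obtain ⟨e1⟩ := (kstep (D0 ρ s u) (D1 ρ s u) (hM.exact1 ρ) funRep_acyclic).2 (2 * m + 1)
  refine IsHomology.congr ?_ e1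
  obtain ⟨e2⟩ := (kstep (D1 ρ s u) (De ρ s u) (hM.exact2 ρ) E2_ac).2 (2 * m)
  exact (hM.per ρ m).2.congr e2

/-- killing by `t` given free data -/
theorem ModData.kill (ρ : Representation k G V) (t : ℕ) (h1 : FD (ρ s) 4 1)
    (h2 : FD (ρ s ∘ₗ ρ s) 2 1) (h3 : FD (ρ u) 6 t) (n : ℕ) (x : H ρ (n + 2)) : t • x = 0 := by
  rcases Nat.even_or_odd' n with ⟨m, rfl | rfl⟩
  · obtain ⟨π, hs, hk⟩ := hM.Heven ρ m
    obtain ⟨y, rfl⟩ := hs x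
    rw [← map_nsmul, hk]
    exact kill_even (hM.rs4 ρ) (hM.ru3 ρ) h1 h2 h3 y.1 y.2
  · obtain ⟨π, hs, hk⟩ := hM.Hodd ρ m
    obtain ⟨y, hy⟩ := hs x
    rw [← hy, ← map_nsmul, hk]
    exact kill_odd (hM.rs4 ρ) (hM.ru3 ρ) h1 h2 h3 y.1 y.2

end Dtheorem2

end
end SL2Coh
end Part3

section Part4
set_option linter.unusedSimpArgs false
set_option linter.unusedVariables false
namespace SL2Coh

noncomputable section
section tree
variable {G : Type} [Group G] {M : Type} [AddCommGroup M]

open Classical in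
/-- the recursive function on vertices of a rooted tree -/
def tval (A B : Subgroup G) (μA μB : G → ℕ) (F : G → M) : Bool × G → M
  | (true, g) => if h : ∃ a ∈ A, μB (a * g) < μA g then
      F (h.choose * g) + tval A B μA μB F (false, h.choose * g) else 0
  | (false, g) => if h : ∃ b ∈ B, μA (b * g) < μB g then
      tval A B μA μB F (true, h.choose * g) - F (h.choose * g) else 0
termination_by x => cond x.1 (μA x.2) (μB x.2)
decreasing_by
  · exact h.choose_spec.2
  · exact h.choose_spec.2

theorem tree_abs (A B : Subgroup G) (μA μB : G → ℕ) (hA : ∀ a ∈ A, ∀ g, μA (a * g) = μA g)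
    (hB : ∀ b ∈ B, ∀ g, μB (b * g) = μB g) (hne : ∀ g, μA g ≠ μB g)
    (uA : ∀ a ∈ A, ∀ g, μB g < μA g → μB (a * g) < μA g → a ∈ B)
    (uB : ∀ b ∈ B, ∀ g, μA g < μB g → μA (b * g) < μB g → b ∈ A)
    (F : G → M) (hF : ∀ c ∈ A, c ∈ B → ∀ g, F (c * g) = F g) :
    ∃ p q : G → M, (∀ a ∈ A, ∀ g, p (a * g) = p g) ∧ (∀ b ∈ B, ∀ g, q (b * g) = q g) ∧
      ∀ g, F g = p g - q g := by
  let p : G → M := fun g => tval A B μA μB F (true, g)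
  let q : G → M := fun g => tval A B μA μB F (false, g)
  have key : ∀ n : ℕ,
      (∀ g, μA g = n → (∀ a ∈ A, μB (a * g) < μA g → p g = F (a * g) + q (a * g)) ∧
        ((¬ ∃ a ∈ A, μB (a * g) < μA g) → p g = 0)) ∧
      (∀ g, μB g = n → (∀ b ∈ B, μA (b * g) < μB g → q g = p (b * g) - F (b * g)) ∧
        ((¬ ∃ b ∈ B, μA (b * g) < μB g) → q g = 0)) ∧
      (∀ g, μA g = n → ∀ a ∈ A, p (a * g) = p g) ∧
      (∀ g, μB g = n → ∀ b ∈ B, q (b * g) = q g) := by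
    intro n
    induction n using Nat.strong_induction_on with
    | _ n ih =>
    have h1 : ∀ g, μA g = n → (∀ a ∈ A, μB (a * g) < μA g → p g = F (a * g) + q (a * g)) ∧
        ((¬ ∃ a ∈ A, μB (a * g) < μA g) → p g = 0) := by
      intro g hg
      constructor
      · intro a ha hlt
        have h : ∃ a ∈ A, μB (a * g) < μA g := ⟨a, ha, hlt⟩
        have hp : p g = F (h.choose * g) + q (h.choose * g) := by
          change tval A B μA μB F (true, g) = _
          rw [tval, dif_pos h]
        have hc := h.choose_spec
        generalize h.choose = c at hp hc
        have hca : c * a⁻¹ ∈ A := A.mul_mem hc.1 (A.inv_mem ha)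
        have hcg : c * g = c * a⁻¹ * (a * g) := by group
        have hcb : c * a⁻¹ ∈ B := by
          apply uA _ hca (a * g)
          · rwa [hA a ha]
          · rw [← hcg, hA a ha]; exact hc.2
        rw [hp, hcg, hF _ hca hcb, (ih _ (hg ▸ hlt)).2.2.2 (a * g) rfl _ hcb]
      · intro h
        change tval A B μA μB F (true, g) = _
        rw [tval, dif_neg h]
    have h2 : ∀ g, μB g = n → (∀ b ∈ B, μA (b * g) < μB g → q g = p (b * g) - F (b * g)) ∧
        ((¬ ∃ b ∈ B, μA (b * g) < μB g) → q g = 0) := by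
      intro g hg
      constructor
      · intro a ha hlt
        have h : ∃ a ∈ B, μA (a * g) < μB g := ⟨a, ha, hlt⟩
        have hp : q g = p (h.choose * g) - F (h.choose * g) := by
          change tval A B μA μB F (false, g) = _
          rw [tval, dif_pos h]
        have hc := h.choose_spec
        generalize h.choose = c at hp hc
        have hca : c * a⁻¹ ∈ B := B.mul_mem hc.1 (B.inv_mem ha)
        have hcg : c * g = c * a⁻¹ * (a * g) := by group
        have hcb : c * a⁻¹ ∈ A := by
          apply uB _ hca (a * g)
          · rwa [hB a ha]
          · rw [← hcg, hB a ha]; exact hc.2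
        rw [hp, hcg, hF _ hcb hca, (ih _ (hg ▸ hlt)).2.2.1 (a * g) rfl _ hcb]
      · intro h
        change tval A B μA μB F (false, g) = _
        rw [tval, dif_neg h]
    refine ⟨h1, h2, ?_, ?_⟩
    · intro g hg a ha
      by_cases h : ∃ a ∈ A, μB (a * g) < μA g
      · obtain ⟨c, hc, hlt⟩ := h
        have e1 := (h1 g hg).1 c hc hlt
        have e2 := (h1 (a * g) (by rw [hA a ha, hg])).1 (c * a⁻¹) (A.mul_mem hc (A.inv_mem ha))
          (by rw [hA a ha]; simpa [mul_assoc] using hlt)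
        rw [e1, e2]; simp [mul_assoc]
      · rw [(h1 g hg).2 h, (h1 (a * g) (by rw [hA a ha, hg])).2]
        rintro ⟨c, hc, hlt⟩
        exact h ⟨c * a, A.mul_mem hc ha, by rw [mul_assoc]; rwa [hA a ha] at hlt⟩
    · intro g hg a ha
      by_cases h : ∃ a ∈ B, μA (a * g) < μB g
      · obtain ⟨c, hc, hlt⟩ := h
        have e1 := (h2 g hg).1 c hc hlt
        have e2 := (h2 (a * g) (by rw [hB a ha, hg])).1 (c * a⁻¹) (B.mul_mem hc (B.inv_mem ha))
          (by rw [hB a ha]; simpa [mul_assoc] using hlt)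
        rw [e1, e2]; simp [mul_assoc]
      · rw [(h2 g hg).2 h, (h2 (a * g) (by rw [hB a ha, hg])).2]
        rintro ⟨c, hc, hlt⟩
        exact h ⟨c * a, B.mul_mem hc ha, by rw [mul_assoc]; rwa [hB a ha] at hlt⟩
  refine ⟨p, q, fun a ha g => (key _).2.2.1 g rfl a ha, fun b hb g => (key _).2.2.2 g rfl b hb, ?_⟩
  intro g
  rcases lt_or_gt_of_ne (hne g) with h | h
  · have := ((key _).2.1 g rfl).1 1 B.one_mem (by rwa [one_mul])
    rw [one_mul] at this
    rw [this]; abel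
  · have := ((key _).1 g rfl).1 1 A.one_mem (by rwa [one_mul])
    rw [one_mul] at this
    rw [this]; abel

end tree

open Matrix

abbrev SLZ := SpecialLinearGroup (Fin 2) ℤ

def sZ : SLZ := ⟨!![0, -1; 1, 0], by simp [Matrix.det_fin_two]⟩
def uZ : SLZ := ⟨!![0, -1; 1, 1], by simp [Matrix.det_fin_two]⟩

theorem sZ_mul (g : SLZ) : (sZ * g) 0 0 = - g 1 0 ∧ (sZ * g) 0 1 = - g 1 1 ∧
    (sZ * g) 1 0 = g 0 0 ∧ (sZ * g) 1 1 = g 0 1 := by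
  have h : ∀ i j, (sZ * g) i j = sZ.1 i 0 * g 0 j + sZ.1 i 1 * g 1 j := fun i j =>
    (Matrix.mul_apply (M := sZ.1) (N := g.1) (i := i) (k := j)).trans (Fin.sum_univ_two _)
  refine ⟨?_, ?_, ?_, ?_⟩ <;> rw [h] <;> simp [sZ]

theorem uZ_mul (g : SLZ) : (uZ * g) 0 0 = - g 1 0 ∧ (uZ * g) 0 1 = - g 1 1 ∧
    (uZ * g) 1 0 = g 0 0 + g 1 0 ∧ (uZ * g) 1 1 = g 0 1 + g 1 1 := by
  have h : ∀ i j, (uZ * g) i j = uZ.1 i 0 * g 0 j + uZ.1 i 1 * g 1 j := fun i j =>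
    (Matrix.mul_apply (M := uZ.1) (N := g.1) (i := i) (k := j)).trans (Fin.sum_univ_two _)
  refine ⟨?_, ?_, ?_, ?_⟩ <;> rw [h] <;> simp [uZ]

def qZ (g : SLZ) : ℤ := g 0 0 ^ 2 + g 0 1 ^ 2 + g 1 0 ^ 2 + g 1 1 ^ 2
def bZ (g : SLZ) : ℤ := g 0 0 * g 1 0 + g 0 1 * g 1 1

theorem detZ (g : SLZ) : g 0 0 * g 1 1 - g 0 1 * g 1 0 = 1 := by
  rw [← Matrix.det_fin_two]; exact g.2

theorem qZ_pos (g : SLZ) : 0 < qZ g := by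
  have := detZ g
  unfold qZ
  nlinarith [sq_nonneg (g 0 0 - g 1 1), sq_nonneg (g 0 1 + g 1 0)]

theorem qbZ_pos (g : SLZ) : 0 < qZ g + bZ g := by
  have := qZ_pos g
  unfold qZ bZ at *
  nlinarith [sq_nonneg (g 0 0 + g 1 0), sq_nonneg (g 0 1 + g 1 1)]

theorem qZ_s (g : SLZ) : qZ (sZ * g) = qZ g := by
  obtain ⟨h1, h2, h3, h4⟩ := sZ_mul g
  unfold qZ; rw [h1, h2, h3, h4]; ring
theorem bZ_s (g : SLZ) : bZ (sZ * g) = - bZ g := by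
  obtain ⟨h1, h2, h3, h4⟩ := sZ_mul g
  unfold bZ; rw [h1, h2, h3, h4]; ring
theorem qbZ_u (g : SLZ) : qZ (uZ * g) + bZ (uZ * g) = qZ g + bZ g := by
  obtain ⟨h1, h2, h3, h4⟩ := uZ_mul g
  unfold qZ bZ; rw [h1, h2, h3, h4]; ring
theorem row_pos (g : SLZ) (i : Fin 2) : 0 < g i 0 ^ 2 + g i 1 ^ 2 := by
  have := detZ g
  by_contra h
  have h0 : g i 0 ^ 2 = 0 := by nlinarith [sq_nonneg (g i 0), sq_nonneg (g i 1)]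
  have h1 : g i 1 ^ 2 = 0 := by nlinarith [sq_nonneg (g i 0), sq_nonneg (g i 1)]
  rw [pow_eq_zero_iff (by norm_num)] at h0 h1
  fin_cases i <;> simp_all
theorem bZ_u (g : SLZ) (h : 0 ≤ bZ g) : bZ (uZ * g) < 0 := by
  obtain ⟨h1, h2, h3, h4⟩ := uZ_mul g
  have := row_pos g 1
  unfold bZ at *; rw [h1, h2, h3, h4]; nlinarith
theorem bZ_uu (g : SLZ) (h : 0 ≤ bZ g) : bZ (uZ * (uZ * g)) < 0 := by
  obtain ⟨h1, h2, h3, h4⟩ := uZ_mul g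
  obtain ⟨k1, k2, k3, k4⟩ := uZ_mul (uZ * g)
  have := row_pos g 0
  unfold bZ at *; rw [k1, k2, k3, k4, h1, h2, h3, h4]; nlinarith
theorem sZ4 : sZ * (sZ * (sZ * sZ)) = 1 := by decide +kernel
theorem uZ3 : uZ * (uZ * uZ) = sZ * sZ := by decide +kernel

theorem zpowers_inv {G M : Type} [Group G] {x : G} (f : G → M) (h : ∀ g, f (x * g) = f g) :
    ∀ a ∈ Subgroup.zpowers x, ∀ g, f (a * g) = f g := by
  let T : Subgroup G :=
    { carrier := {a | ∀ g, f (a * g) = f g}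
      one_mem' := fun g => by rw [one_mul]
      mul_mem' := fun {a b} ha hb g => by rw [mul_assoc, ha, hb]
      inv_mem' := fun {a} ha g => by rw [← ha (a⁻¹ * g), mul_inv_cancel_left] }
  have : Subgroup.zpowers x ≤ T := by
    rw [Subgroup.zpowers_le]; exact h
  exact fun a ha => this ha

theorem mem_sZ {a : SLZ} (ha : a ∈ Subgroup.zpowers sZ) :
    a = 1 ∨ a = sZ ∨ a = sZ * sZ ∨ a = sZ * (sZ * sZ) := by
  obtain ⟨k, rfl⟩ := Subgroup.mem_zpowers_iff.1 ha
  have h4 : sZ ^ 4 = 1 := by decide +kernel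
  rw [zpow_eq_zpow_emod' k h4]
  have h1 := Int.emod_nonneg k (b := 4) (by norm_num)
  have h2 := Int.emod_lt_of_pos k (b := 4) (by norm_num)
  push_cast
  generalize k % 4 = m at h1 h2
  interval_cases m <;> decide +kernel

theorem mem_uZ {a : SLZ} (ha : a ∈ Subgroup.zpowers uZ) :
    a = 1 ∨ a = uZ ∨ a = uZ * uZ ∨ a = sZ * sZ ∨ a = uZ * (sZ * sZ) ∨ a = uZ * (uZ * (sZ * sZ)) := by
  obtain ⟨k, rfl⟩ := Subgroup.mem_zpowers_iff.1 ha
  have h4 : uZ ^ 6 = 1 := by decide +kernel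
  rw [zpow_eq_zpow_emod' k h4]
  have h1 := Int.emod_nonneg k (b := 6) (by norm_num)
  have h2 := Int.emod_lt_of_pos k (b := 6) (by norm_num)
  push_cast
  generalize k % 6 = m at h1 h2
  interval_cases m <;> decide +kernel

theorem bZ_z (g : SLZ) : bZ (sZ * (sZ * g)) = bZ g := by rw [bZ_s, bZ_s, neg_neg]

theorem modDataZ : ModData SLZ sZ uZ where
  h4 := sZ4
  hu := uZ3
  hz := by decide +kernel
  hu2 := by decide +kernel
  gen T hs hu := by
    have hT : ModularGroup.T = sZ⁻¹ * uZ := by decide +kernel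
    have hS : ModularGroup.S = sZ := by decide +kernel
    rw [eq_top_iff, ← SpecialLinearGroup.SL2Z_generators, Subgroup.closure_le]
    rintro x (rfl | rfl)
    · rw [hS]; exact hs
    · rw [hT]; exact T.mul_mem (T.inv_mem hs) hu
  tree M _ F hF := by
    have hsA : sZ ∈ Subgroup.zpowers sZ := Subgroup.mem_zpowers sZ
    have huB : uZ ∈ Subgroup.zpowers uZ := Subgroup.mem_zpowers uZ
    have hzA : sZ * sZ ∈ Subgroup.zpowers sZ := mul_mem hsA hsA
    have hzB : sZ * sZ ∈ Subgroup.zpowers uZ := by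
      rw [← uZ3]; exact mul_mem huB (mul_mem huB huB)
    have hA := zpowers_inv (fun g => (2 * qZ g - 1).toNat) (x := sZ) (fun g => by simp only [qZ_s])
    have hB := zpowers_inv (fun g => (2 * (qZ g + bZ g)).toNat) (x := uZ)
      (fun g => by simp only [qbZ_u])
    have lt1 : ∀ g, (2 * (qZ g + bZ g)).toNat < (2 * qZ g - 1).toNat ↔ bZ g < 0 := by
      intro g
      have := qZ_pos g
      have := qbZ_pos g
      omega
    have lt2 : ∀ g, (2 * qZ g - 1).toNat < (2 * (qZ g + bZ g)).toNat ↔ 0 ≤ bZ g := by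
      intro g
      have := qZ_pos g
      have := qbZ_pos g
      omega
    obtain ⟨p, q, hp, hq, h⟩ := tree_abs (Subgroup.zpowers sZ) (Subgroup.zpowers uZ)
      (fun g => (2 * qZ g - 1).toNat) (fun g => (2 * (qZ g + bZ g)).toNat) hA hB
      (fun g => by
        have := lt1 g
        have := lt2 g
        intro h
        rcases lt_or_ge (bZ g) 0 with h' | h' <;> omega)
      (by
        intro a ha g h1 h2
        rw [← hA a ha g] at h2
        rw [lt1] at h1 h2
        rcases mem_sZ ha with rfl | rfl | rfl | rfl
        · exact one_mem _
        · rw [bZ_s] at h2; omega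
        · exact hzB
        · rw [mul_assoc, mul_assoc, bZ_s, bZ_z] at h2; omega)
      (by
        intro a ha g h1 h2
        rw [← hB a ha g] at h2
        rw [lt2] at h1 h2
        have hz : 0 ≤ bZ (sZ * (sZ * g)) := by rwa [bZ_z]
        rcases mem_uZ ha with rfl | rfl | rfl | rfl | rfl | rfl
        · exact one_mem _
        · have := bZ_u g h1; omega
        · have := bZ_uu g h1; rw [mul_assoc] at h2; omega
        · exact hzA
        · have := bZ_u _ hz; rw [mul_assoc, mul_assoc] at h2; omega
        · have := bZ_uu _ hz; rw [mul_assoc, mul_assoc, mul_assoc] at h2; omega)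
      F
      (by
        intro c hc hc' g
        rcases mem_sZ hc with rfl | rfl | rfl | rfl
        · rw [one_mul]
        · exfalso
          have := mem_uZ hc'
          revert this; decide +kernel
        · exact hF g
        · exfalso
          have := mem_uZ hc'
          revert this; decide +kernel)
    exact ⟨p, q, hp _ hsA, hq _ huB, h⟩

theorem ModData.transport {G G' : Type} [Group G] [Group G'] {s u : G} (h : ModData G s u)
    (e : G ≃* G') : ModData G' (e s) (e u) where
  h4 := by simp only [← map_mul, h.h4, map_one]
  hu := by simp only [← map_mul, h.hu]
  hz := by
    rw [← map_mul, ← e.map_one]; exact fun hh => h.hz (e.injective hh)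
  hu2 := by
    rw [← map_mul, ← e.map_one]; exact fun hh => h.hu2 (e.injective hh)
  gen T hs hu := by
    have := h.gen (T.comap e.toMonoidHom) hs hu
    rw [eq_top_iff]
    intro x _
    have hx : e.symm x ∈ T.comap e.toMonoidHom := by rw [this]; trivial
    simpa using hx
  tree M _ F hF := by
    obtain ⟨p, q, hp, hq, hpq⟩ := h.tree M (fun g => F (e g)) (fun g => by
      simp only [map_mul]; exact hF _)
    refine ⟨fun g => p (e.symm g), fun g => q (e.symm g), fun g => ?_, fun g => ?_, fun g => ?_⟩
    · simp [hp]
    · simp [hq]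
    · rw [← hpq]; simp

end
end SL2Coh
end Part4

section Part5
set_option linter.unusedSimpArgs false
set_option linter.unusedVariables false
namespace SL2Coh
open Matrix

noncomputable section

abbrev R3 := Localization.Away (3 : ℤ)
abbrev GG := Matrix.SpecialLinearGroup (Fin 2) R3

/-- one third -/
def th : R3 := IsLocalization.Away.invSelf (3 : ℤ)

theorem th3 : th * 3 = 1 := by
  have := IsLocalization.Away.mul_invSelf (S := R3) (3 : ℤ)
  rw [mul_comm, th, ← this]; simp

theorem cast_inj {m n : ℤ} (h : (m : R3) = n) : m = n := by
  have : Function.Injective (algebraMap ℤ R3) :=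
    IsLocalization.injective R3 (M := Submonoid.powers (3 : ℤ))
      (powers_le_nonZeroDivisors_of_noZeroDivisors (by norm_num))
  apply this
  simpa using h

/-- the integral elements -/
def I (x : R3) : Prop := ∃ n : ℤ, (n : R3) = x

theorem I.add {x y : R3} : I x → I y → I (x + y) := by
  rintro ⟨a, rfl⟩ ⟨b, rfl⟩; exact ⟨a + b, by push_cast; rfl⟩
theorem I.sub {x y : R3} : I x → I y → I (x - y) := by
  rintro ⟨a, rfl⟩ ⟨b, rfl⟩; exact ⟨a - b, by push_cast; rfl⟩
theorem I.mul {x y : R3} : I x → I y → I (x * y) := by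
  rintro ⟨a, rfl⟩ ⟨b, rfl⟩; exact ⟨a * b, by push_cast; rfl⟩
theorem I.neg {x : R3} : I x → I (- x) := by
  rintro ⟨a, rfl⟩; exact ⟨- a, by push_cast; rfl⟩
theorem I_int (n : ℤ) : I (n : R3) := ⟨n, rfl⟩
theorem I_zero : I 0 := ⟨0, by simp⟩
theorem I_one : I 1 := ⟨1, by simp⟩
theorem I_three : I 3 := ⟨3, by simp⟩
theorem I_pow (k : ℕ) : I (3 ^ k) := ⟨3 ^ k, by simp⟩

theorem I_th (n : ℤ) : I (th * n) ↔ 3 ∣ n := by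
  constructor
  · rintro ⟨m, hm⟩
    refine ⟨m, cast_inj ?_⟩
    push_cast
    rw [hm]
    linear_combination (-(n : R3)) * th3
  · rintro ⟨m, rfl⟩
    refine ⟨m, ?_⟩
    push_cast
    linear_combination (-(m : R3)) * th3

theorem not_I_th : ¬ I th := by
  have := I_th 1
  rw [Int.cast_one, mul_one] at this
  rw [this]; norm_num

theorem I_prime {x y : R3} (hx : I x) (hy : I y) (h : I (th * (x * y))) :
    I (th * x) ∨ I (th * y) := by
  obtain ⟨a, rfl⟩ := hx
  obtain ⟨b, rfl⟩ := hy
  rw [← Int.cast_mul, I_th] at h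
  rw [I_th, I_th]
  exact (Int.prime_three.dvd_mul).1 h

theorem I_exists (x : R3) : ∃ k : ℕ, I (3 ^ k * x) := by
  obtain ⟨n, a, h⟩ := IsLocalization.Away.surj (3 : ℤ) x
  refine ⟨n, a, ?_⟩
  simp at h
  rw [← h]; ring

theorem I_mono {x : R3} {k l : ℕ} (h : k ≤ l) (hx : I (3 ^ k * x)) : I (3 ^ l * x) := by
  obtain ⟨m, rfl⟩ := Nat.exists_eq_add_of_le h
  have := (I_pow m).mul hx
  convert this using 1; ring

theorem mulG (g h : GG) (i j : Fin 2) : (g * h) i j = g i 0 * h 0 j + g i 1 * h 1 j :=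
  (Matrix.mul_apply (M := g.1) (N := h.1) (i := i) (k := j)).trans (Fin.sum_univ_two _)

theorem detG (g : GG) : g 0 0 * g 1 1 - g 0 1 * g 1 0 = 1 := by
  rw [← Matrix.det_fin_two]; exact g.2

theorem invG (g : GG) : g⁻¹ 0 0 = g 1 1 ∧ g⁻¹ 0 1 = - g 0 1 ∧ g⁻¹ 1 0 = - g 1 0 ∧ g⁻¹ 1 1 = g 0 0 := by
  have h : (g⁻¹ : GG).1 = Matrix.adjugate g.1 := Matrix.SpecialLinearGroup.coe_inv g
  refine ⟨?_, ?_, ?_, ?_⟩ <;>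
  · rw [h, Matrix.adjugate_fin_two]; rfl

theorem oneG : (1 : GG) 0 0 = 1 ∧ (1 : GG) 0 1 = 0 ∧ (1 : GG) 1 0 = 0 ∧ (1 : GG) 1 1 = 1 := by
  refine ⟨?_, ?_, ?_, ?_⟩ <;> rfl

def AA : Subgroup GG where
  carrier := {g | (I (g 0 0) ∧ I (g 0 1)) ∧ I (g 1 0) ∧ I (g 1 1)}
  one_mem' := by
    obtain ⟨h1, h2, h3, h4⟩ := oneG
    refine ⟨⟨?_, ?_⟩, ?_, ?_⟩
    · rw [h1]; exact I_one
    · rw [h2]; exact I_zero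
    · rw [h3]; exact I_zero
    · rw [h4]; exact I_one
  mul_mem' := by
    rintro a b ⟨⟨a1, a2⟩, a3, a4⟩ ⟨⟨b1, b2⟩, b3, b4⟩
    refine ⟨⟨?_, ?_⟩, ?_, ?_⟩ <;> rw [mulG]
    · exact (a1.mul b1).add (a2.mul b3)
    · exact (a1.mul b2).add (a2.mul b4)
    · exact (a3.mul b1).add (a4.mul b3)
    · exact (a3.mul b2).add (a4.mul b4)
  inv_mem' := by
    rintro a ⟨⟨a1, a2⟩, a3, a4⟩
    obtain ⟨h1, h2, h3, h4⟩ := invG a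
    refine ⟨⟨?_, ?_⟩, ?_, ?_⟩
    · rw [h1]; exact a4
    · rw [h2]; exact a2.neg
    · rw [h3]; exact a3.neg
    · rw [h4]; exact a1

def BB : Subgroup GG where
  carrier := {g | (I (g 0 0) ∧ I (3 * g 0 1)) ∧ I (th * g 1 0) ∧ I (g 1 1)}
  one_mem' := by
    obtain ⟨h1, h2, h3, h4⟩ := oneG
    refine ⟨⟨?_, ?_⟩, ?_, ?_⟩
    · rw [h1]; exact I_one
    · rw [h2, mul_zero]; exact I_zero
    · rw [h3, mul_zero]; exact I_zero
    · rw [h4]; exact I_one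
  mul_mem' := by
    rintro a b ⟨⟨a1, a2⟩, a3, a4⟩ ⟨⟨b1, b2⟩, b3, b4⟩
    refine ⟨⟨?_, ?_⟩, ?_, ?_⟩ <;> rw [mulG]
    · convert (a1.mul b1).add (a2.mul b3) using 1
      linear_combination (- a 0 1 * b 1 0) * th3
    · convert (a1.mul b2).add (a2.mul b4) using 1; ring
    · convert (a3.mul b1).add (a4.mul b3) using 1; ring
    · convert (a3.mul b2).add (a4.mul b4) using 1
      linear_combination (- a 1 0 * b 0 1) * th3
  inv_mem' := by
    rintro a ⟨⟨a1, a2⟩, a3, a4⟩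
    obtain ⟨h1, h2, h3, h4⟩ := invG a
    refine ⟨⟨?_, ?_⟩, ?_, ?_⟩
    · rw [h1]; exact a4
    · rw [h2]; convert a2.neg using 1; ring
    · rw [h3]; convert a3.neg using 1; ring
    · rw [h4]; exact a1

def PA (g : GG) (k : ℕ) : Prop :=
  ∀ j, I (3 ^ k * g 0 j) ∧ I (3 ^ k * g 1 j)
def PB (g : GG) (k : ℕ) : Prop :=
  ∀ j, I (3 ^ k * g 0 j) ∧ I (3 ^ k * (th * g 1 j))

theorem PA_mono {g : GG} {k l : ℕ} (h : k ≤ l) (hp : PA g k) : PA g l :=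
  fun j => ⟨I_mono h (hp j).1, I_mono h (hp j).2⟩
theorem PB_mono {g : GG} {k l : ℕ} (h : k ≤ l) (hp : PB g k) : PB g l :=
  fun j => ⟨I_mono h (hp j).1, I_mono h (hp j).2⟩

theorem PA_exists (g : GG) : ∃ k, PA g k := by
  obtain ⟨a, ha⟩ := I_exists (g 0 0)
  obtain ⟨b, hb⟩ := I_exists (g 0 1)
  obtain ⟨c, hc⟩ := I_exists (g 1 0)
  obtain ⟨d, hd⟩ := I_exists (g 1 1)
  refine ⟨a + b + c + d, fun j => ?_⟩
  fin_cases j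
  · exact ⟨I_mono (by omega) ha, I_mono (by omega) hc⟩
  · exact ⟨I_mono (by omega) hb, I_mono (by omega) hd⟩

theorem PB_exists (g : GG) : ∃ k, PB g k := by
  obtain ⟨k, hk⟩ := PA_exists g
  refine ⟨k + 1, fun j => ⟨I_mono (by omega) (hk j).1, ?_⟩⟩
  convert (hk j).2 using 1
  linear_combination (3 ^ k * g 1 j) * th3

theorem PA_mul {a g : GG} (ha : a ∈ AA) {k : ℕ} (h : PA g k) : PA (a * g) k := by
  obtain ⟨⟨a1, a2⟩, a3, a4⟩ := ha
  intro j
  rw [mulG, mulG]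
  constructor
  · convert (a1.mul (h j).1).add (a2.mul (h j).2) using 1; ring
  · convert (a3.mul (h j).1).add (a4.mul (h j).2) using 1; ring

theorem PB_mul {a g : GG} (ha : a ∈ BB) {k : ℕ} (h : PB g k) : PB (a * g) k := by
  obtain ⟨⟨a1, a2⟩, a3, a4⟩ := ha
  intro j
  rw [mulG, mulG]
  constructor
  · convert (a1.mul (h j).1).add (a2.mul (h j).2) using 1
    linear_combination (- 3 ^ k * a 0 1 * g 1 j) * th3
  · convert (a3.mul (h j).1).add (a4.mul (h j).2) using 1; ring

theorem PA_mul_iff {a g : GG} (ha : a ∈ AA) (k : ℕ) : PA (a * g) k ↔ PA g k :=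
  ⟨fun h => by simpa using PA_mul (AA.inv_mem ha) h, PA_mul ha⟩
theorem PB_mul_iff {a g : GG} (ha : a ∈ BB) (k : ℕ) : PB (a * g) k ↔ PB g k :=
  ⟨fun h => by simpa using PB_mul (BB.inv_mem ha) h, PB_mul ha⟩

theorem not_PB_zero (g : GG) : ¬ PB g 0 := by
  intro h
  apply not_I_th
  have h0 := h 0
  have h1 := h 1
  simp only [pow_zero, one_mul] at h0 h1
  convert (h0.1.mul h1.2).sub (h1.1.mul h0.2) using 1
  linear_combination (-th) * detG g

open Classical in
def kA (g : GG) : ℕ := Nat.find (PA_exists g)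
open Classical in
def kB (g : GG) : ℕ := Nat.find (PB_exists g)

theorem kA_le {g : GG} {k : ℕ} : kA g ≤ k ↔ PA g k := by
  classical
  constructor
  · intro h
    exact PA_mono h (Nat.find_spec (PA_exists g))
  · intro h; exact Nat.find_min' _ h
theorem kB_le {g : GG} {k : ℕ} : kB g ≤ k ↔ PB g k := by
  classical
  constructor
  · intro h
    exact PB_mono h (Nat.find_spec (PB_exists g))
  · intro h; exact Nat.find_min' _ h
theorem kA_mul {a g : GG} (ha : a ∈ AA) : kA (a * g) = kA g :=
  eq_of_forall_ge_iff fun k => by rw [kA_le, kA_le, PA_mul_iff ha]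
theorem kB_mul {a g : GG} (ha : a ∈ BB) : kB (a * g) = kB g :=
  eq_of_forall_ge_iff fun k => by rw [kB_le, kB_le, PB_mul_iff ha]
theorem kB_pos (g : GG) : 0 < kB g := by
  by_contra h
  exact not_PB_zero g (kB_le.1 (by omega))

theorem treeG {M : Type} [AddCommGroup M] (F : GG → M)
    (hF : ∀ c ∈ AA, c ∈ BB → ∀ g, F (c * g) = F g) :
    ∃ p q : GG → M, (∀ a ∈ AA, ∀ g, p (a * g) = p g) ∧ (∀ b ∈ BB, ∀ g, q (b * g) = q g) ∧
      ∀ g, F g = p g - q g := by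
  refine tree_abs AA BB (fun g => 2 * kA g) (fun g => 2 * kB g - 1)
    (fun a ha g => by rw [kA_mul ha]) (fun b hb g => by rw [kB_mul hb]) ?_ ?_ ?_ F hF
  · intro g
    have := kB_pos g
    omega
  · intro a ha g h1 h2
    have h3 : PB g (kA g) := by rw [← kB_le]; omega
    have h4 : PB (a * g) (kA g) := by rw [← kB_le]; omega
    have hk : kA g ≠ 0 := by have := kB_pos g; omega
    obtain ⟨m, hm⟩ := Nat.exists_eq_succ_of_ne_zero hk
    have h5 : PA g (m + 1) := by rw [← kA_le]; omega
    have h6 : ¬ PA g m := by rw [← kA_le]; omega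
    rw [hm, Nat.succ_eq_add_one] at h3 h4
    obtain ⟨⟨a1, a2⟩, a3, a4⟩ := ha
    refine ⟨⟨a1, I_three.mul a2⟩, ?_, a4⟩
    by_contra hc
    apply h6
    intro j
    have h7 := (h4 j).2
    rw [mulG] at h7
    have h8 : I (th * (a 1 0 * (3 ^ (m + 1) * g 0 j))) := by
      convert h7.sub (a4.mul (h3 j).2) using 1; ring
    have h9 := (I_prime a3 (h5 j).1 h8).resolve_left hc
    constructor
    · convert h9 using 1
      linear_combination (-3 ^ m * g 0 j) * th3
    · convert (h3 j).2 using 1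
      linear_combination (-3 ^ m * g 1 j) * th3
  · intro a ha g h1 h2
    have hk := kB_pos g
    obtain ⟨m, hm⟩ := Nat.exists_eq_succ_of_ne_zero hk.ne'
    have h3 : PA g m := by rw [← kA_le]; omega
    have h4 : PA (a * g) m := by rw [← kA_le]; omega
    have h6 : ¬ PB g m := by rw [← kB_le]; omega
    obtain ⟨⟨a1, a2⟩, a3, a4⟩ := ha
    refine ⟨⟨a1, ?_⟩, ?_, a4⟩
    · by_contra hc
      apply h6
      intro j
      refine ⟨(h3 j).1, ?_⟩
      have h7 := (h4 j).1
      rw [mulG] at h7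
      have h8 : I (th * ((3 * a 0 1) * (3 ^ m * g 1 j))) := by
        convert h7.sub (a1.mul (h3 j).1) using 1
        linear_combination (3 ^ m * a 0 1 * g 1 j) * th3
      have h9 := (I_prime a2 (h3 j).2 h8).resolve_left ?_
      · convert h9 using 1; ring
      · intro h; apply hc; convert h using 1
        linear_combination (- a 0 1) * th3
    · convert I_three.mul a3 using 1
      linear_combination (- a 1 0) * th3

theorem dep {w x y z : R3} (hw : I w) (hx : I x) (hy : I y) (hz : I z)
    (h : I (th * (w * z - x * y))) :
    (I (th * w) ∧ I (th * x)) ∨ (I (th * y) ∧ I (th * z)) ∨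
      (I (th * (w + y)) ∧ I (th * (x + z))) ∨ (I (th * (w - y)) ∧ I (th * (x - z))) := by
  obtain ⟨w, rfl⟩ := hw
  obtain ⟨x, rfl⟩ := hx
  obtain ⟨y, rfl⟩ := hy
  obtain ⟨z, rfl⟩ := hz
  simp only [← Int.cast_mul, ← Int.cast_sub, ← Int.cast_add, I_th] at h ⊢
  have hd : ∀ n : ℤ, (3 : ℤ) ∣ n ↔ (n : ZMod 3) = 0 := fun n =>
    (ZMod.intCast_zmod_eq_zero_iff_dvd n 3).symm
  simp only [hd] at h ⊢
  push_cast at h ⊢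
  generalize (w : ZMod 3) = w at *
  generalize (x : ZMod 3) = x at *
  generalize (y : ZMod 3) = y at *
  generalize (z : ZMod 3) = z at *
  revert w x y z
  decide

def mk (a b c d : R3) (h : a * d - b * c = 1) : GG :=
  ⟨!![a, b; c, d], by rw [Matrix.det_fin_two]; exact h⟩

theorem mk_mul (a b c d : R3) (h : a * d - b * c = 1) (g : GG) (j : Fin 2) :
    (mk a b c d h * g) 0 j = a * g 0 j + b * g 1 j ∧
    (mk a b c d h * g) 1 j = c * g 0 j + d * g 1 j :=
  ⟨mulG _ _ _ _, mulG _ _ _ _⟩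

theorem stepA (g : GG) (k : ℕ) (h : PA g (k + 1)) :
    ∃ a : GG, a ∈ AA ∧ PB (a * g) (k + 1) := by
  have hd := dep (h 0).1 (h 1).1 (h 0).2 (h 1).2 (by
    convert I_pow (2 * k + 1) using 1
    linear_combination (th * 3 ^ (2 * k + 2)) * detG g + 3 ^ (2 * k + 1) * th3)
  rcases hd with ⟨h0, h1⟩ | ⟨h0, h1⟩ | ⟨h0, h1⟩ | ⟨h0, h1⟩
  · refine ⟨mk 0 (-1) 1 0 (by ring), ⟨⟨I_zero, I_one.neg⟩, I_one, I_zero⟩, fun j => ?_⟩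
    obtain ⟨e1, e2⟩ := mk_mul 0 (-1) 1 0 (by ring) g j
    rw [e1, e2]
    constructor
    · convert (h j).2.neg using 1; ring
    · fin_cases j
      · convert h0 using 1; simp only [Fin.zero_eta]; ring
      · convert h1 using 1; simp only [Fin.mk_one]; ring
  · refine ⟨1, AA.one_mem, fun j => ?_⟩
    rw [one_mul]
    refine ⟨(h j).1, ?_⟩
    fin_cases j
    · convert h0 using 1; simp only [Fin.zero_eta]; ring
    · convert h1 using 1; simp only [Fin.mk_one]; ring
  · refine ⟨mk 1 0 1 1 (by ring), ⟨⟨I_one, I_zero⟩, I_one, I_one⟩, fun j => ?_⟩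
    obtain ⟨e1, e2⟩ := mk_mul 1 0 1 1 (by ring) g j
    rw [e1, e2]
    constructor
    · convert (h j).1 using 1; ring
    · fin_cases j
      · convert h0 using 1; simp only [Fin.zero_eta]; ring
      · convert h1 using 1; simp only [Fin.mk_one]; ring
  · refine ⟨mk 1 0 (-1) 1 (by ring), ⟨⟨I_one, I_zero⟩, I_one.neg, I_one⟩, fun j => ?_⟩
    obtain ⟨e1, e2⟩ := mk_mul 1 0 (-1) 1 (by ring) g j
    rw [e1, e2]
    constructor
    · convert (h j).1 using 1; ring
    · fin_cases j
      · convert h0.neg using 1; simp only [Fin.zero_eta]; ring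
      · convert h1.neg using 1; simp only [Fin.mk_one]; ring

theorem stepB (g : GG) (k : ℕ) (h : PB g (k + 1)) :
    ∃ a : GG, a ∈ BB ∧ PA (a * g) k := by
  have hd := dep (h 0).1 (h 1).1 (h 0).2 (h 1).2 (by
    convert I_pow (2 * k) using 1
    linear_combination (th ^ 2 * 3 ^ (2 * k + 2)) * detG g + 3 ^ (2 * k) * (th * 3 + 1) * th3)
  have h2 : ∀ j, I (3 ^ k * g 1 j) := fun j => by
    convert (h j).2 using 1
    linear_combination (- 3 ^ k * g 1 j) * th3
  have e3 : I (3 * th) := by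
    convert I_one using 1
    linear_combination th3
  have e4 : I (th * 3) := by
    convert I_one using 1
    linear_combination th3
  have e0 : I (th * 0) := by
    convert I_zero using 1
    ring
  rcases hd with ⟨h0, h1⟩ | ⟨h0, h1⟩ | ⟨h0, h1⟩ | ⟨h0, h1⟩
  · refine ⟨1, BB.one_mem, fun j => ?_⟩
    rw [one_mul]
    refine ⟨?_, h2 j⟩
    fin_cases j
    · convert h0 using 1; simp only [Fin.zero_eta]
      linear_combination (- 3 ^ k * g 0 0) * th3
    · convert h1 using 1; simp only [Fin.mk_one]
      linear_combination (- 3 ^ k * g 0 1) * th3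
  · have hh : (0 : R3) * 0 - (-th) * 3 = 1 := by linear_combination th3
    refine ⟨mk 0 (-th) 3 0 hh, ⟨⟨I_zero, ?_⟩, e4, I_zero⟩, fun j => ?_⟩
    · convert e3.neg using 1; change 3 * (- th) = _; ring
    obtain ⟨e1, e2⟩ := mk_mul 0 (-th) 3 0 hh g j
    rw [e1, e2]
    constructor
    · fin_cases j
      · convert h0.neg using 1; simp only [Fin.zero_eta]
        linear_combination (3 ^ k * th * g 1 0) * th3
      · convert h1.neg using 1; simp only [Fin.mk_one]
        linear_combination (3 ^ k * th * g 1 1) * th3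
    · convert (h j).1 using 1; ring
  · have hh : (1 : R3) * 1 - th * 0 = 1 := by ring
    refine ⟨mk 1 th 0 1 hh, ⟨⟨I_one, e3⟩, e0, I_one⟩, fun j => ?_⟩
    obtain ⟨e1, e2⟩ := mk_mul 1 th 0 1 hh g j
    rw [e1, e2]
    constructor
    · fin_cases j
      · convert h0 using 1; simp only [Fin.zero_eta]
        linear_combination (- 3 ^ k * (th * g 1 0 + g 0 0)) * th3
      · convert h1 using 1; simp only [Fin.mk_one]
        linear_combination (- 3 ^ k * (th * g 1 1 + g 0 1)) * th3
    · convert h2 j using 1; ring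
  · have hh : (1 : R3) * 1 - (- th) * 0 = 1 := by ring
    refine ⟨mk 1 (-th) 0 1 hh, ⟨⟨I_one, ?_⟩, e0, I_one⟩, fun j => ?_⟩
    · convert e3.neg using 1; change 3 * (- th) = _; ring
    obtain ⟨e1, e2⟩ := mk_mul 1 (-th) 0 1 hh g j
    rw [e1, e2]
    constructor
    · fin_cases j
      · convert h0 using 1; simp only [Fin.zero_eta]
        linear_combination (- 3 ^ k * (- th * g 1 0 + g 0 0)) * th3
      · convert h1 using 1; simp only [Fin.mk_one]
        linear_combination (- 3 ^ k * (- th * g 1 1 + g 0 1)) * th3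
    · convert h2 j using 1; ring

theorem genG (T : Subgroup GG) (hA : AA ≤ T) (hB : BB ≤ T) : T = ⊤ := by
  have key : ∀ k g, PA g k → g ∈ T := by
    intro k
    induction k with
    | zero =>
      intro g h
      have h0 := h 0
      have h1 := h 1
      simp only [pow_zero, one_mul] at h0 h1
      exact hA ⟨⟨h0.1, h1.1⟩, h0.2, h1.2⟩
    | succ k ih =>
      intro g h
      obtain ⟨a, ha, h⟩ := stepA g k h
      obtain ⟨b, hb, h⟩ := stepB _ k h
      have := ih _ h
      rwa [T.mul_mem_cancel_left (hB hb), T.mul_mem_cancel_left (hA ha)] at this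
  rw [eq_top_iff]
  intro g _
  obtain ⟨k, hk⟩ := PA_exists g
  exact key k g hk

def emb (x y : R3) (hxy : x * y = 1) : SLZ →* GG where
  toFun g := mk (g 0 0) (x * g 0 1) (y * g 1 0) (g 1 1) (by
    have := congrArg (Int.cast (R := R3)) (detZ g)
    push_cast at this
    linear_combination this - (g 0 1 * g 1 0 : R3) * hxy)
  map_one' := by
    apply Subtype.ext
    change !![_, _; _, _] = (1 : Matrix (Fin 2) (Fin 2) R3)
    simp [Matrix.one_fin_two]
  map_mul' g h := by
    have hZ : ∀ i j, (g * h) i j = g i 0 * h 0 j + g i 1 * h 1 j := fun i j =>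
      (Matrix.mul_apply (M := g.1) (N := h.1) (i := i) (k := j)).trans (Fin.sum_univ_two _)
    apply Subtype.ext
    change !![_, _; _, _] = !![_, _; _, _] * !![_, _; _, _]
    rw [Matrix.mul_fin_two, hZ, hZ, hZ, hZ]
    push_cast
    congr 1
    ext i j
    fin_cases i <;> fin_cases j <;> simp
    · linear_combination (- g 0 1 * h 1 0 : R3) * hxy
    · ring
    · ring
    · linear_combination (- g 1 0 * h 0 1 : R3) * hxy

theorem emb_inj (x y : R3) (hxy : x * y = 1) : Function.Injective (emb x y hxy) := by
  intro g h e
  have e00 : (emb x y hxy g) 0 0 = (emb x y hxy h) 0 0 := by rw [e]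
  have e01 : (emb x y hxy g) 0 1 = (emb x y hxy h) 0 1 := by rw [e]
  have e10 : (emb x y hxy g) 1 0 = (emb x y hxy h) 1 0 := by rw [e]
  have e11 : (emb x y hxy g) 1 1 = (emb x y hxy h) 1 1 := by rw [e]
  change x * (g 0 1 : R3) = x * (h 0 1 : R3) at e01
  change y * (g 1 0 : R3) = y * (h 1 0 : R3) at e10
  apply Matrix.SpecialLinearGroup.ext
  intro i j
  fin_cases i <;> fin_cases j
  · exact cast_inj e00
  · apply cast_inj
    change (g 0 1 : R3) = h 0 1
    linear_combination y * e01 - ((g 0 1 : R3) - h 0 1) * hxy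
  · apply cast_inj
    change (g 1 0 : R3) = h 1 0
    linear_combination x * e10 - ((g 1 0 : R3) - h 1 0) * hxy
  · exact cast_inj e11

theorem emb_mem (x y : R3) (hxy : x * y = 1) (g : GG) : g ∈ (emb x y hxy).range ↔
    (I (g 0 0) ∧ I (y * g 0 1)) ∧ I (x * g 1 0) ∧ I (g 1 1) := by
  constructor
  · rintro ⟨g, rfl⟩
    refine ⟨⟨I_int _, ?_⟩, ?_, I_int _⟩
    · change I (y * (x * g 0 1))
      convert I_int (g 0 1) using 1
      linear_combination (g 0 1 : R3) * hxy
    · change I (x * (y * g 1 0))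
      convert I_int (g 1 0) using 1
      linear_combination (g 1 0 : R3) * hxy
  · rintro ⟨⟨⟨a, ha⟩, ⟨b, hb⟩⟩, ⟨c, hc⟩, ⟨d, hd⟩⟩
    have hdet : a * d - b * c = 1 := by
      apply cast_inj
      push_cast
      rw [ha, hb, hc, hd]
      linear_combination detG g - (g 0 1 * g 1 0) * hxy
    refine ⟨⟨!![a, b; c, d], by rw [Matrix.det_fin_two]; exact hdet⟩, ?_⟩
    apply Matrix.SpecialLinearGroup.ext
    intro i j
    fin_cases i <;> fin_cases j
    · exact ha
    · change x * (b : R3) = g 0 1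
      rw [hb]; linear_combination (g 0 1) * hxy
    · change y * (c : R3) = g 1 0
      rw [hc]; linear_combination (g 1 0) * hxy
    · exact hd

def eA : SLZ ≃* AA := (MonoidHom.ofInjective (emb_inj 1 1 (mul_one 1))).trans
  (MulEquiv.subgroupCongr (by
    ext g; rw [emb_mem, one_mul, one_mul]; rfl))
def eB : SLZ ≃* BB := (MonoidHom.ofInjective (emb_inj th 3 th3)).trans
  (MulEquiv.subgroupCongr (by
    ext g; rw [emb_mem]; rfl))

theorem eA_val (g : SLZ) : (eA g : GG) = emb 1 1 (mul_one 1) g := rfl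
theorem eB_val (g : SLZ) : (eB g : GG) = emb th 3 th3 g := rfl

theorem eA_mem (g : SLZ) : eA g ∈ BB.subgroupOf AA ↔ g ∈ CongruenceSubgroup.Gamma0 3 := by
  rw [CongruenceSubgroup.Gamma0_mem, Subgroup.mem_subgroupOf, eA_val,
    ZMod.intCast_zmod_eq_zero_iff_dvd]
  change ((I (g 0 0 : R3) ∧ I (3 * (1 * g 0 1 : R3))) ∧ I (th * (1 * g 1 0 : R3)) ∧ I (g 1 1 : R3)) ↔ _
  rw [one_mul, one_mul, I_th]
  constructor
  · intro h; exact h.2.1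
  · intro h; exact ⟨⟨I_int _, I_three.mul (I_int _)⟩, h, I_int _⟩

theorem modDataA : ModData AA (eA sZ) (eA uZ) := modDataZ.transport eA
theorem modDataB : ModData BB (eB sZ) (eB uZ) := modDataZ.transport eB

end
end SL2Coh
end Part5

section Part6
set_option linter.unusedSimpArgs false
set_option linter.unusedVariables false
namespace SL2Coh

noncomputable section
variable {k G : Type} [CommRing k] [Group G]
variable {V V' V'' : Type} [AddCommGroup V] [Module k V] [AddCommGroup V'] [Module k V']
  [AddCommGroup V''] [Module k V'']

def res (S : Subgroup G) (ρ : Representation k G V) : Representation k S V := ρ.comp S.subtype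

theorem res_apply (S : Subgroup G) (ρ : Representation k G V) (s : S) (v : V) :
    res S ρ s v = ρ s v := rfl

/-- functions on `A`, equivariant under `A ∩ B` -/
def XV (A B : Subgroup G) (ρ : Representation k G V) : Type :=
  Representation.coindV (B.subgroupOf A).subtype (res (B.subgroupOf A) (res A ρ))

instance (A B : Subgroup G) (ρ : Representation k G V) : AddCommGroup (XV A B ρ) :=
  inferInstanceAs (AddCommGroup
    (Representation.coindV (B.subgroupOf A).subtype (res (B.subgroupOf A) (res A ρ))))

instance (A B : Subgroup G) (ρ : Representation k G V) : Module k (XV A B ρ) :=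
  inferInstanceAs (Module k
    (Representation.coindV (B.subgroupOf A).subtype (res (B.subgroupOf A) (res A ρ))))

def XR (A B : Subgroup G) (ρ : Representation k G V) : Representation k A (XV A B ρ) :=
  Representation.coind (B.subgroupOf A).subtype (res (B.subgroupOf A) (res A ρ))

theorem XR_apply (A B : Subgroup G) (ρ : Representation k G V) (a a' : A) (f : XV A B ρ) :
    (XR A B ρ a f).1 a' = f.1 (a' * a) := rfl

def etaR (A B : Subgroup G) (ρ : Representation k G V) :
    (res A ρ).IntertwiningMap (XR A B ρ) where
  toFun v := ⟨fun a => ρ a v, fun c a => by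
    change ρ ((c : A) * a : A) v = ρ (c : A) (ρ a v)
    rw [Subgroup.coe_mul, map_mul]; rfl⟩
  map_add' x y := by apply Subtype.ext; funext a; exact map_add _ _ _
  map_smul' c x := by apply Subtype.ext; funext a; exact map_smul _ _ _
  isIntertwining' a := by
    apply LinearMap.ext; intro v; apply Subtype.ext; funext a'
    change ρ a' (ρ a v) = ρ (a' * a : A) v
    rw [Subgroup.coe_mul, map_mul]; rfl

theorem etaR_apply (A B : Subgroup G) (ρ : Representation k G V) (v : V) (a : A) :
    (etaR A B ρ v).1 a = ρ a v := rfl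

theorem coindMap_surjective (A : Subgroup G) {σ : Representation k A V} {τ : Representation k A V'}
    (f : σ.IntertwiningMap τ) (hf : Function.Surjective f) :
    Function.Surjective (Representation.coindMap A.subtype f) := by
  intro y
  let r : G → G := fun g => (Quotient.mk (QuotientGroup.rightRel A) g).out
  have hr : ∀ g, g * (r g)⁻¹ ∈ A := fun g => by
    have : QuotientGroup.rightRel A (r g) g := Quotient.mk_out g
    rwa [QuotientGroup.rightRel_apply] at this
  have hr2 : ∀ (a : A) g, r (a * g) = r g := fun a g => by
    have : Quotient.mk (QuotientGroup.rightRel A) (a * g) = Quotient.mk (QuotientGroup.rightRel A) g := by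
      apply Quotient.sound
      change QuotientGroup.rightRel A _ _
      rw [QuotientGroup.rightRel_apply]
      simp
    simp only [r, this]
  choose l hl using hf
  refine ⟨⟨fun g => σ ⟨g * (r g)⁻¹, hr g⟩ (l (y.1 (r g))), ?_⟩, ?_⟩
  · intro a g
    change σ ⟨a * g * (r (a * g))⁻¹, hr _⟩ (l (y.1 (r (a * g)))) = σ a (σ _ _)
    simp only [hr2]
    rw [← Module.End.mul_apply, ← map_mul]
    congr 2
    apply Subtype.ext
    change a * g * _ = a * (g * _)
    rw [mul_assoc]
  · apply Subtype.ext; funext g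
    change f (σ _ (l (y.1 (r g)))) = y.1 g
    rw [Representation.IntertwiningMap.isIntertwining, hl]
    have := y.2 ⟨g * (r g)⁻¹, hr g⟩ (r g)
    rw [← this]
    simp

theorem coindMap_exact (A : Subgroup G) {σ : Representation k A V} {τ : Representation k A V'}
    {υ : Representation k A V''}
    (f : σ.IntertwiningMap τ) (g : τ.IntertwiningMap υ) (hf : Function.Injective f)
    (he : Function.Exact f g) :
    Function.Injective (Representation.coindMap A.subtype f) ∧
    Function.Exact (Representation.coindMap A.subtype f) (Representation.coindMap A.subtype g) := by
  constructor
  · intro x y h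
    apply Subtype.ext; funext a
    apply hf
    exact congrFun (congrArg Subtype.val h) a
  · intro y
    constructor
    · intro h
      have h1 : ∀ a, ∃ x, f x = y.1 a := fun a =>
        (he (y.1 a)).1 (congrFun (congrArg Subtype.val h) a)
      choose x hx using h1
      refine ⟨⟨x, fun s a => hf ?_⟩, ?_⟩
      · rw [hx, Representation.IntertwiningMap.isIntertwining, hx]
        exact y.2 s a
      · apply Subtype.ext; funext a; exact hx a
    · rintro ⟨x, rfl⟩
      apply Subtype.ext; funext a
      exact (he _).2 ⟨x.1 a, rfl⟩

/-- Mayer-Vietoris for a group acting on a tree -/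
theorem MV (A B : Subgroup G) (hgen : ∀ T : Subgroup G, A ≤ T → B ≤ T → T = ⊤)
    (htree : ∀ F : G → V, (∀ c ∈ A, c ∈ B → ∀ g, F (c * g) = F g) →
      ∃ p q : G → V, (∀ a ∈ A, ∀ g, p (a * g) = p g) ∧ (∀ b ∈ B, ∀ g, q (b * g) = q g) ∧
      ∀ g, F g = p g - q g)
    (ρ : Representation k G V) :
    ∃ (i : ∀ n, H ρ n →ₗ[k] H (res A ρ) n × H (res B ρ) n)
      (j : ∀ n, H (res A ρ) n × H (res B ρ) n →ₗ[k] H (XR A B ρ) n)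
      (δ : ∀ n, H (XR A B ρ) n →ₗ[k] H ρ (n + 1)),
      (∀ n, Function.Exact (i n) (j n)) ∧ (∀ n, Function.Exact (j n) (δ n)) ∧
      (∀ n, Function.Exact (δ n) (i (n + 1))) ∧
      (∀ {W : Type} [AddCommGroup W] [Module k W] (υ : Representation k A W)
        (π : (XR A B ρ).IntertwiningMap υ), Function.Surjective π →
        Function.Exact (etaR A B ρ) π → ∀ n, Subsingleton (H υ n) → Function.Surjective (j n)) := by
  let CA := Representation.coind A.subtype (res A ρ)
  let CB := Representation.coind B.subtype (res B ρ)
  let CX := Representation.coind A.subtype (XR A B ρ)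
  let α : ρ.IntertwiningMap (CA.prod CB) :=
    { toFun := fun v => (⟨fun g => ρ g v, fun a g => by
          change ρ (a * g) v = ρ a (ρ g v); rw [map_mul]; rfl⟩,
        ⟨fun g => ρ g v, fun a g => by
          change ρ (a * g) v = ρ a (ρ g v); rw [map_mul]; rfl⟩)
      map_add' := fun x y => by
        apply Prod.ext <;> (apply Subtype.ext; funext a; exact map_add _ _ _)
      map_smul' := fun c x => by
        apply Prod.ext <;> (apply Subtype.ext; funext a; exact map_smul _ _ _)
      isIntertwining' := fun g => by
        apply LinearMap.ext; intro v
        apply Prod.ext <;>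
        · apply Subtype.ext; funext a
          change ρ a (ρ g v) = ρ (a * g) v
          rw [map_mul]; rfl }
  let βA : CA.IntertwiningMap CX := Representation.coindMap A.subtype (etaR A B ρ)
  let βB : CB.IntertwiningMap CX :=
    { toFun := fun f => ⟨fun g => ⟨fun a => f.1 (a * g), fun c a => by
            have := f.2 ⟨(c : A), c.2⟩ (a * g)
            change f.1 (((c : A) * a : A) * g) = ρ (c : A) (f.1 (a * g))
            rw [Subgroup.coe_mul, mul_assoc]
            exact this⟩, fun a g => by
          apply Subtype.ext; funext a'
          change f.1 (a' * (a * g)) = f.1 ((a' * a : A) * g)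
          rw [Subgroup.coe_mul, mul_assoc]⟩
      map_add' := fun x y => rfl
      map_smul' := fun x y => rfl
      isIntertwining' := fun g => by
        apply LinearMap.ext; intro v
        apply Subtype.ext; funext a
        apply Subtype.ext; funext a'
        change v.1 (a' * a * g) = v.1 (a' * (a * g))
        rw [mul_assoc] }
  let β : (CA.prod CB).IntertwiningMap CX :=
    { toFun := fun f => βA f.1 - βB f.2
      map_add' := fun x y => by
        simp only [Prod.fst_add, Prod.snd_add, map_add]; abel
      map_smul' := fun c x => by
        simp only [Prod.smul_fst, Prod.smul_snd, map_smul, RingHom.id_apply]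
        exact (smul_sub c (βA x.1) (βB x.2)).symm
      isIntertwining' := fun g => by
        apply LinearMap.ext; intro v
        change βA (CA g v.1) - βB (CB g v.2) = CX g (βA v.1 - βB v.2)
        rw [Representation.IntertwiningMap.isIntertwining,
          Representation.IntertwiningMap.isIntertwining]
        exact (map_sub (CX g) _ _).symm }
  have hβ : ∀ f g a, ((β f).1 g).1 a = ρ a (f.1.1 g) - f.2.1 (a * g) := fun f g a => rfl
  have hfA : ∀ (f : Representation.coindV A.subtype (res A ρ)) (a : A) g,
    f.1 (a * g) = ρ a (f.1 g) := fun f a g => f.2 a g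
  have hfB : ∀ (f : Representation.coindV B.subtype (res B ρ)) (a : B) g,
    f.1 (a * g) = ρ a (f.1 g) := fun f a g => f.2 a g
  have hinv : ∀ (g : G) v, ρ g⁻¹ (ρ g v) = v := fun g v => by
    rw [← Module.End.mul_apply, ← map_mul, inv_mul_cancel, map_one]; rfl
  have hinv' : ∀ (g : G) v, ρ g (ρ g⁻¹ v) = v := fun g v => by
    rw [← Module.End.mul_apply, ← map_mul, mul_inv_cancel, map_one]; rfl
  have hαi : Function.Injective α := by
    intro x y h
    have h1 : ρ 1 x = ρ 1 y := congrFun (congrArg Subtype.val (congrArg Prod.fst h)) 1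
    rwa [map_one] at h1
  have hex : Function.Exact α β := by
    intro f
    constructor
    · intro h
      have hz : ∀ g a, ρ (a : A) (f.1.1 g) = f.2.1 (a * g) := fun g a => by
        rw [← sub_eq_zero, ← hβ, h]; rfl
      have h12 : ∀ g, f.1.1 g = f.2.1 g := fun g => by
        have := hz g 1
        simpa using this
      let φ : G → V := fun g => ρ g⁻¹ (f.1.1 g)
      let T : Subgroup G :=
        { carrier := {x | ∀ g, φ (x * g) = φ g}
          one_mem' := fun g => by rw [one_mul]
          mul_mem' := fun {a b} ha hb g => by rw [mul_assoc, ha, hb]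
          inv_mem' := fun {a} ha g => by rw [← ha (a⁻¹ * g), mul_inv_cancel_left] }
      have hT : T = ⊤ := by
        apply hgen
        · intro a ha g
          change ρ (a * g)⁻¹ (f.1.1 (a * g)) = ρ g⁻¹ (f.1.1 g)
          rw [hfA _ ⟨a, ha⟩, mul_inv_rev, map_mul, Module.End.mul_apply, hinv]
        · intro a ha g
          change ρ (a * g)⁻¹ (f.1.1 (a * g)) = ρ g⁻¹ (f.1.1 g)
          rw [h12, h12, hfB _ ⟨a, ha⟩, mul_inv_rev, map_mul, Module.End.mul_apply, hinv]
      have hc : ∀ g, f.1.1 g = ρ g (φ 1) := fun g => by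
        have hg : g ∈ T := by rw [hT]; trivial
        have := hg 1
        rw [← this, mul_one, hinv']
      refine ⟨φ 1, ?_⟩
      apply Prod.ext
      · apply Subtype.ext; funext g; exact (hc g).symm
      · apply Subtype.ext; funext g; rw [← h12]; exact (hc g).symm
    · rintro ⟨v, rfl⟩
      apply Subtype.ext; funext g
      apply Subtype.ext; funext a
      rw [hβ]
      change ρ a (ρ g v) - ρ (a * g) v = 0
      rw [map_mul]; exact sub_self _
  have hsurj : Function.Surjective β := by
    intro h
    have h1 : ∀ (a : A) (g : G) a', (h.1 (a * g)).1 a' = (h.1 g).1 (a' * a) := fun a g a' =>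
      congrFun (congrArg Subtype.val (h.2 a g)) a'
    have h2 : ∀ g (c : G) (hc : c ∈ A) (hc' : c ∈ B) a, (h.1 g).1 (⟨c, hc⟩ * a) = ρ c ((h.1 g).1 a) :=
      fun g c hc hc' a => (h.1 g).2 ⟨⟨c, hc⟩, hc'⟩ a
    obtain ⟨p, q, hp, hq, hpq⟩ := htree (fun g => ρ g⁻¹ ((h.1 g).1 1)) (by
      intro c hc hc' g
      have e1 := h1 ⟨c, hc⟩ g 1
      rw [one_mul] at e1
      have e2 := h2 g c hc hc' 1
      rw [mul_one] at e2
      rw [e1, e2, mul_inv_rev, map_mul, Module.End.mul_apply, hinv])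
    refine ⟨(⟨fun g => ρ g (p g), fun a g => ?_⟩, ⟨fun g => ρ g (q g), fun a g => ?_⟩), ?_⟩
    · change ρ (a * g) (p (a * g)) = ρ a (ρ g (p g))
      rw [hp _ a.2, map_mul]; rfl
    · change ρ (a * g) (q (a * g)) = ρ a (ρ g (q g))
      rw [hq _ a.2, map_mul]; rfl
    · apply Subtype.ext; funext g
      apply Subtype.ext; funext a
      rw [hβ]
      change ρ a (ρ g (p g)) - ρ (a * g) (q (a * g)) = _
      rw [← hp _ a.2, ← Module.End.mul_apply, ← map_mul, ← map_sub, ← hpq, hinv', h1, one_mul]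
  obtain ⟨δ, hδ⟩ := les (ρ'' := CX) α β hαi hsurj hex
  let sA := fun n => shapiro (res A ρ) n
  let sB := fun n => shapiro (res B ρ) n
  let sX := fun n => shapiro (XR A B ρ) n
  let E : ∀ n, H (CA.prod CB) n ≃ₗ[k] H (res A ρ) n × H (res B ρ) n := fun n =>
    (Hprod CA CB n).trans ((sA n).prodCongr (sB n))
  refine ⟨fun n => (E n).toLinearMap ∘ₗ Hmap α n,
    fun n => (sX n).toLinearMap ∘ₗ Hmap β n ∘ₗ (E n).symm.toLinearMap,
    fun n => δ n ∘ₗ (sX n).symm.toLinearMap, ?_, ?_, ?_, ?_⟩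
  · intro n y
    have := (hδ n).1 ((E n).symm y)
    simp only [LinearMap.comp_apply, LinearEquiv.coe_coe, LinearEquiv.map_eq_zero_iff]
    rw [this]
    constructor
    · rintro ⟨x, hx⟩; exact ⟨x, by simp only [LinearMap.comp_apply, LinearEquiv.coe_coe]; rw [hx]; simp⟩
    · rintro ⟨x, rfl⟩; exact ⟨x, by simp⟩
  · intro n y
    have := (hδ n).2.1 ((sX n).symm y)
    simp only [LinearMap.comp_apply, LinearEquiv.coe_coe]
    rw [this]
    constructor
    · rintro ⟨x, hx⟩
      exact ⟨E n x, by simp only [LinearMap.comp_apply, LinearEquiv.coe_coe]; rw [LinearEquiv.symm_apply_apply, hx]; simp⟩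
    · rintro ⟨x, rfl⟩; exact ⟨(E n).symm x, by simp⟩
  · intro n y
    have := (hδ n).2.2 y
    simp only [LinearMap.comp_apply, LinearEquiv.coe_coe, LinearEquiv.map_eq_zero_iff]
    rw [this]
    constructor
    · rintro ⟨x, hx⟩
      exact ⟨sX n x, by simp only [LinearMap.comp_apply, LinearEquiv.coe_coe]; rw [LinearEquiv.symm_apply_apply, hx]⟩
    · rintro ⟨x, rfl⟩; exact ⟨(sX n).symm x, by simp⟩
  · intro W _ _ υ π hπ hηπ n hW y
    have hηi : Function.Injective (etaR A B ρ) := by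
      intro x y h
      have h1 : ρ (1 : A) x = ρ (1 : A) y := congrFun (congrArg Subtype.val h) 1
      rwa [Subgroup.coe_one, map_one] at h1
    obtain ⟨i1, i2⟩ := coindMap_exact A (etaR A B ρ) π hηi hηπ
    obtain ⟨δ', hδ'⟩ := les _ _ i1 (coindMap_surjective A π hπ) i2
    have : Subsingleton (H (Representation.coind A.subtype υ) n) :=
      (shapiro υ n).injective.subsingleton
    obtain ⟨x, hx⟩ := ((hδ' n).1 ((sX n).symm y)).1 (Subsingleton.elim _ _)
    refine ⟨E n (Hmap (.inl k CA CB) n x), ?_⟩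
    simp only [LinearMap.comp_apply, LinearEquiv.coe_coe, LinearEquiv.symm_apply_apply]
    rw [← Hmap_comp]
    have he : β.comp (.inl k CA CB) = βA := by
      apply Representation.IntertwiningMap.ext
      apply LinearMap.ext
      intro f
      change βA f - βB 0 = βA f
      rw [map_zero, sub_zero]
    rw [he, hx]; simp

end
end SL2Coh
end Part6

section Part7
set_option linter.unusedSimpArgs false
set_option linter.unusedVariables false
namespace SL2Coh

noncomputable section

section hom
variable {k : Type} [CommRing k]
variable {I J L : Type} [AddCommGroup I] [Module k I] [AddCommGroup J] [Module k J]
    [AddCommGroup L] [Module k L] {d : I →ₗ[k] J} {d' : J →ₗ[k] L} {Q Q' : Type}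
    [AddCommGroup Q] [Module k Q] [AddCommGroup Q'] [Module k Q']

theorem IsHomology.subs (h : IsHomology d d' Q) (h0 : ∀ x, d' x = 0 → ∃ y, d y = x) :
    Subsingleton Q := by
  obtain ⟨π, hs, hk⟩ := h
  refine ⟨fun a b => ?_⟩
  have : ∀ q : Q, q = 0 := by
    intro q
    obtain ⟨x, rfl⟩ := hs q
    exact (hk x).2 (h0 x.1 (LinearMap.mem_ker.1 x.2))
  rw [this a, this b]

theorem IsHomology.equiv (h : IsHomology d d' Q) (π0 : J →ₗ[k] Q')
    (hs : ∀ q, ∃ x, d' x = 0 ∧ π0 x = q)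
    (h1 : ∀ y, π0 (d y) = 0)
    (h2 : ∀ x, d' x = 0 → π0 x = 0 → ∃ y, d y = x) : Nonempty (Q ≃ₗ[k] Q') := by
  refine h.unique ⟨π0 ∘ₗ Submodule.subtype _, ?_, ?_⟩
  · intro q
    obtain ⟨x, hx, rfl⟩ := hs q
    exact ⟨⟨x, LinearMap.mem_ker.2 hx⟩, rfl⟩
  · intro x
    refine ⟨fun hx => h2 x.1 (LinearMap.mem_ker.1 x.2) hx, ?_⟩
    rintro ⟨y, hy⟩
    change π0 x.1 = 0
    rw [← hy, h1]

end hom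

/-- cast `ℤ → ZMod n` as a linear map -/
def zc (n : ℕ) : ℤ →ₗ[ℤ] ZMod n := (Int.castAddHom (ZMod n)).toIntLinearMap

theorem zc_apply (n : ℕ) (x : ℤ) : zc n x = (x : ZMod n) := rfl

theorem zc_surj (n : ℕ) (q : ZMod n) : ∃ x, zc n x = q := ZMod.intCast_surjective q

theorem zc_zero (n : ℕ) (x : ℤ) : zc n x = 0 ↔ (n : ℤ) ∣ x :=
  ZMod.intCast_zmod_eq_zero_iff_dvd x n

section triv
variable {G : Type} [Group G] {s u : G} (hM : ModData G s u) (ρ : Representation ℤ G ℤ)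
  (hρ : ∀ g v, ρ g v = v)
include hM hρ

theorem triv_H1 : Subsingleton (H ρ 1) := by
  refine (hM.H1 ρ).subs ?_
  rintro ⟨a, b⟩ h
  simp only [d1_apply, N4_apply, N6_apply, N3_apply, hρ, Prod.mk_eq_zero] at h
  refine ⟨0, ?_⟩
  simp only [d0_apply, hρ, Prod.mk.injEq]
  omega

theorem triv_Hodd (m : ℕ) : Subsingleton (H ρ (2 * m + 3)) := by
  refine (hM.Hodd ρ m).subs ?_
  rintro ⟨a, b, c⟩ h
  simp only [dd_apply, N4_apply, N6_apply, N3_apply, hρ, Prod.mk_eq_zero] at h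
  refine ⟨(c, 0, 0), ?_⟩
  simp only [de_apply, hρ, Prod.mk.injEq]
  omega

theorem triv_Heven (m : ℕ) : Nonempty (H ρ (2 * m + 2) ≃ₗ[ℤ] ZMod 12) := by
  refine (hM.Heven ρ m).equiv (zc 12 ∘ₗ ((3:ℤ) • LinearMap.fst ℤ ℤ (ℤ × ℤ) -
    (2:ℤ) • (LinearMap.fst ℤ ℤ ℤ ∘ₗ LinearMap.snd ℤ ℤ (ℤ × ℤ)))) ?_ ?_ ?_
  · intro q
    obtain ⟨x, rfl⟩ := zc_surj 12 q
    refine ⟨(x, x, 0), ?_, ?_⟩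
    · simp only [de_apply, hρ, Prod.mk_eq_zero]; omega
    · change zc 12 (3 * x - 2 * x) = _
      congr 1; ring
  · rintro ⟨a, b⟩
    simp only [d1_apply, N4_apply, N6_apply, N3_apply, hρ]
    refine (zc_zero 12 _).2 ?_
    simp only [LinearMap.sub_apply, LinearMap.smul_apply, LinearMap.comp_apply,
      LinearMap.fst_apply, LinearMap.snd_apply, smul_eq_mul]
    omega
  · rintro ⟨a, b, c⟩ h h2
    replace h2 := (zc_zero 12 _).1 h2
    simp only [LinearMap.sub_apply, LinearMap.smul_apply, LinearMap.comp_apply,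
      LinearMap.fst_apply, LinearMap.snd_apply, smul_eq_mul] at h2
    obtain ⟨m, hm⟩ := h2
    simp only [de_apply, hρ, Prod.mk_eq_zero] at h
    refine ⟨(3 * m - c, 2 * m - c), ?_⟩
    simp only [d1_apply, N4_apply, N6_apply, N3_apply, hρ, Prod.mk.injEq]
    omega

end triv

abbrev Z4 := ℤ × ℤ × ℤ × ℤ
abbrev Z3 := ℤ × ℤ × ℤ

section coset
variable {G : Type} [Group G] {s u : G} (hM : ModData G s u)

section four
variable (ρ : Representation ℤ G Z4)
  (hs : ∀ v, ρ s v = (v.2.1, v.1, v.2.2.2, v.2.2.1))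
  (hu : ∀ v, ρ u v = (v.2.2.1, v.1, v.2.1, v.2.2.2))
include hM hs hu

theorem four_H1 : Nonempty (H ρ 1 ≃ₗ[ℤ] ℤ) := by
  refine (hM.H1 ρ).equiv (LinearMap.fst ℤ ℤ _ ∘ₗ LinearMap.fst ℤ Z4 Z4 +
    LinearMap.fst ℤ ℤ _ ∘ₗ LinearMap.snd ℤ ℤ _ ∘ₗ LinearMap.snd ℤ Z4 Z4) ?_ ?_ ?_
  · intro q
    refine ⟨((q, -q, 0, 0), (0, 0, 0, 0)), ?_, ?_⟩
    · simp only [d1_apply, N4_apply, N6_apply, N3_apply, hs, hu, Prod.mk_eq_zero, Prod.mk_add_mk,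
        Prod.mk_sub_mk, Prod.ext_iff, Prod.fst_zero, Prod.snd_zero]
      omega
    · simp
  · rintro ⟨a, b, c, d⟩
    simp only [d0_apply, hs, hu, LinearMap.add_apply, LinearMap.comp_apply, LinearMap.fst_apply,
      LinearMap.snd_apply, Prod.mk_sub_mk]
    omega
  · rintro ⟨⟨a0, a1, a2, a3⟩, ⟨b0, b1, b2, b3⟩⟩ h h2
    simp only [d1_apply, N4_apply, N6_apply, N3_apply, hs, hu, Prod.mk_eq_zero, Prod.mk_add_mk,
      Prod.mk_sub_mk] at h
    simp only [LinearMap.add_apply, LinearMap.comp_apply, LinearMap.fst_apply,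
      LinearMap.snd_apply] at h2
    refine ⟨(0, a0, b0, b0 + a2), ?_⟩
    simp only [d0_apply, hs, hu, Prod.mk_sub_mk, Prod.mk.injEq]
    omega

theorem four_Heven (m : ℕ) : Nonempty (H ρ (2 * m + 2) ≃ₗ[ℤ] ZMod 6) := by
  refine (hM.Heven ρ m).equiv (zc 6 ∘ₗ LinearMap.snd ℤ ℤ _ ∘ₗ LinearMap.snd ℤ ℤ _ ∘ₗ
    LinearMap.snd ℤ ℤ _ ∘ₗ LinearMap.fst ℤ Z4 Z4 ∘ₗ LinearMap.snd ℤ Z4 _) ?_ ?_ ?_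
  · intro q
    obtain ⟨x, rfl⟩ := zc_surj 6 q
    refine ⟨((x,x,x,x), (x,x,x,x), 0), ?_, ?_⟩
    · simp [de_apply, hs, hu]
    · rfl
  · rintro ⟨⟨a0, a1, a2, a3⟩, ⟨b0, b1, b2, b3⟩⟩
    simp only [d1_apply, N4_apply, N6_apply, N3_apply, hs, hu, Prod.mk_add_mk,
      Prod.mk_sub_mk]
    refine (zc_zero 6 _).2 ?_
    simp only [LinearMap.comp_apply,
      LinearMap.fst_apply, LinearMap.snd_apply]
    omega
  · rintro ⟨⟨a0, a1, a2, a3⟩, ⟨b0, b1, b2, b3⟩, ⟨c0, c1, c2, c3⟩⟩ h h2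
    replace h2 := (zc_zero 6 _).1 h2
    simp only [LinearMap.comp_apply,
      LinearMap.fst_apply, LinearMap.snd_apply] at h2
    obtain ⟨m, hm⟩ := h2
    simp only [de_apply, hs, hu, Prod.mk_eq_zero, Prod.mk_add_mk, Prod.mk_sub_mk] at h
    push_cast at hm
    -- solve
    refine ⟨((c0 + b0 / 2, 0, c3 + 3 * m, 0), (b0 / 2, 0, 0, m)), ?_⟩
    simp only [d1_apply, N4_apply, N6_apply, N3_apply, hs, hu, Prod.mk_add_mk,
      Prod.mk_sub_mk, Prod.mk.injEq]
    omega

theorem four_Hodd (m : ℕ) : Nonempty (H ρ (2 * m + 3) ≃ₗ[ℤ] ZMod 2) := by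
  refine (hM.Hodd ρ m).equiv (zc 2 ∘ₗ (
    LinearMap.fst ℤ ℤ _ ∘ₗ LinearMap.fst ℤ Z4 _ +
    LinearMap.fst ℤ ℤ _ ∘ₗ LinearMap.snd ℤ ℤ _ ∘ₗ LinearMap.fst ℤ Z4 Z4 ∘ₗ LinearMap.snd ℤ Z4 _ +
    LinearMap.fst ℤ ℤ _ ∘ₗ LinearMap.snd ℤ Z4 Z4 ∘ₗ LinearMap.snd ℤ Z4 _ +
    LinearMap.fst ℤ ℤ _ ∘ₗ LinearMap.snd ℤ ℤ _ ∘ₗ LinearMap.snd ℤ Z4 Z4 ∘ₗ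
      LinearMap.snd ℤ Z4 _)) ?_ ?_ ?_
  · intro q
    obtain ⟨x, rfl⟩ := zc_surj 2 q
    refine ⟨(0, 0, (x,0,0,0)), ?_, ?_⟩
    · simp only [dd_apply, N4_apply, N6_apply, N3_apply, hs, hu, Prod.mk_eq_zero, Prod.mk_add_mk,
        Prod.mk_sub_mk, Prod.ext_iff, Prod.fst_zero, Prod.snd_zero, Prod.fst_add, Prod.fst_sub,
        Prod.snd_add, Prod.snd_sub]
      omega
    · simp
  · rintro ⟨⟨a0, a1, a2, a3⟩, ⟨b0, b1, b2, b3⟩, ⟨c0, c1, c2, c3⟩⟩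
    simp only [de_apply, N4_apply, N6_apply, N3_apply, hs, hu, Prod.mk_add_mk,
      Prod.mk_sub_mk]
    refine (zc_zero 2 _).2 ?_
    simp only [LinearMap.comp_apply, LinearMap.add_apply,
      LinearMap.fst_apply, LinearMap.snd_apply]
    omega
  · rintro ⟨⟨a0, a1, a2, a3⟩, ⟨b0, b1, b2, b3⟩, ⟨c0, c1, c2, c3⟩⟩ h h2
    replace h2 := (zc_zero 2 _).1 h2
    simp only [LinearMap.comp_apply, LinearMap.add_apply,
      LinearMap.fst_apply, LinearMap.snd_apply] at h2
    simp only [dd_apply, N4_apply, N6_apply, N3_apply, hs, hu, Prod.mk_eq_zero, Prod.mk_add_mk,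
      Prod.mk_sub_mk] at h
    refine ⟨((c0, c0 + a0, c2 + b0, c2 + b0 + a2), (0, -b1, b0, c2 + b0 + a2 - c3),
      (0, (c0 + a0 + b1 - c1) / 2, 0, 0)), ?_⟩
    simp only [de_apply, N4_apply, N6_apply, N3_apply, hs, hu, Prod.mk_add_mk,
      Prod.mk_sub_mk, Prod.mk.injEq]
    omega

end four

theorem three_Heven (ρ : Representation ℤ G Z3)
    (hs : ∀ v, ρ s v = (v.2.1 - v.2.2, v.1 - v.2.2, - v.2.2))
    (hu : ∀ v, ρ u v = (v.2.2, v.1, v.2.1)) (hM : ModData G s u)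
    (m : ℕ) : Subsingleton (H ρ (2 * m + 2)) := by
  refine (hM.Heven ρ m).subs ?_
  rintro ⟨⟨a0, a1, a2⟩, ⟨b0, b1, b2⟩, ⟨c0, c1, c2⟩⟩ h
  simp only [de_apply, hs, hu, Prod.mk_eq_zero, Prod.mk_add_mk, Prod.mk_sub_mk] at h
  obtain ⟨a, ha⟩ : ∃ a, a0 = 2 * a := ⟨a0 / 2, by omega⟩
  obtain ⟨b, hb⟩ : ∃ b, b0 = 2 * b := ⟨b0 / 2, by omega⟩
  refine ⟨((a, 0, 0), (b, 0, 0)), ?_⟩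
  simp only [d1_apply, N4_apply, N6_apply, N3_apply, hs, hu, Prod.mk_add_mk,
      Prod.mk_sub_mk, Prod.mk.injEq]
  omega

end coset
end
end SL2Coh
end Part7

section Part8
set_option linter.unusedSimpArgs false
set_option linter.unusedVariables false
namespace SL2Coh

noncomputable section

structure CosetData {G : Type} [Group G] (C : Subgroup G) (s u : G) where
  c : G → Fin 4
  r : Fin 4 → G
  hc : ∀ g h, c g = c h ↔ g * h⁻¹ ∈ C
  hr : ∀ i, c (r i) = i
  hs : ∀ i, c (r i * s) = ![1, 0, 3, 2] i
  hu : ∀ i, c (r i * u) = ![2, 0, 1, 3] i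

section
variable {k G : Type} [CommRing k] [Group G]
variable {V V' : Type} [AddCommGroup V] [Module k V] [AddCommGroup V'] [Module k V']

def conjRep (ρ : Representation k G V) (e : V ≃ₗ[k] V') : Representation k G V' where
  toFun g := e.toLinearMap ∘ₗ ρ g ∘ₗ e.symm.toLinearMap
  map_one' := by ext; simp
  map_mul' g h := by ext; simp

theorem conjRep_apply (ρ : Representation k G V) (e : V ≃ₗ[k] V') (g : G) (v : V') :
    conjRep ρ e g v = e (ρ g (e.symm v)) := rfl

theorem conjRep_equiv (ρ : Representation k G V) (e : V ≃ₗ[k] V') (g : G) (v : V) :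
    e (ρ g v) = conjRep ρ e g (e v) := by simp [conjRep_apply]

end

section
variable {G : Type} [Group G] {C : Subgroup G} {s u : G} (D : CosetData C s u)
  (σ : Representation ℤ C ℤ) (hσ : ∀ g v, σ g v = v)

theorem CosetData.val (hσ : ∀ g v, σ g v = v) (f : Representation.coindV C.subtype σ) (g : G) :
    f.1 (D.r (D.c g)) = f.1 g := by
  have h1 : D.r (D.c g) * g⁻¹ ∈ C := by rw [← D.hc, D.hr]
  have h2 := f.2 ⟨_, h1⟩ g
  rw [hσ] at h2
  rw [← h2]
  simp

def CosetData.equiv : Representation.coindV C.subtype σ ≃ₗ[ℤ] Z4 where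
  toFun f := (f.1 (D.r 0), f.1 (D.r 1), f.1 (D.r 2), f.1 (D.r 3))
  map_add' _ _ := rfl
  map_smul' _ _ := rfl
  invFun v := ⟨fun g => ![v.1, v.2.1, v.2.2.1, v.2.2.2] (D.c g), by
    intro g h
    rw [hσ]
    have : D.c (C.subtype g * h) = D.c h := by rw [D.hc]; simp
    simp only [this]⟩
  left_inv f := by
    refine Subtype.ext (funext fun g => ?_)
    rw [← D.val σ hσ f g]
    change ![f.1 (D.r 0), f.1 (D.r 1), f.1 (D.r 2), f.1 (D.r 3)] (D.c g) = _
    generalize D.c g = i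
    fin_cases i <;> rfl
  right_inv v := by
    simp only [D.hr]
    rfl

theorem CosetData.equiv_apply (f : Representation.coindV C.subtype σ) :
   D.equiv σ hσ f = (f.1 (D.r 0), f.1 (D.r 1), f.1 (D.r 2), f.1 (D.r 3)) := rfl

def CosetData.rep : Representation ℤ G Z4 :=
  conjRep (Representation.coind C.subtype σ) (D.equiv σ hσ)

theorem CosetData.rep_equiv (g : G) (f : Representation.coindV C.subtype σ) :
    D.equiv σ hσ (Representation.coind C.subtype σ g f) = D.rep σ hσ g (D.equiv σ hσ f) :=
  conjRep_equiv _ _ _ _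

theorem CosetData.rep_s (v : Z4) : D.rep σ hσ s v = (v.2.1, v.1, v.2.2.2, v.2.2.1) := by
  obtain ⟨f, rfl⟩ := (D.equiv σ hσ).surjective v
  rw [← D.rep_equiv]
  simp only [D.equiv_apply]
  have h : ∀ i, (Representation.coind C.subtype σ s f).1 (D.r i) = f.1 (D.r (![1, 0, 3, 2] i)) := by
    intro i
    rw [← D.hs i, D.val σ hσ]
    rfl
  rw [h, h, h, h]
  rfl

theorem CosetData.rep_u (v : Z4) : D.rep σ hσ u v = (v.2.2.1, v.1, v.2.1, v.2.2.2) := by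
  obtain ⟨f, rfl⟩ := (D.equiv σ hσ).surjective v
  rw [← D.rep_equiv]
  simp only [D.equiv_apply]
  have h : ∀ i, (Representation.coind C.subtype σ u f).1 (D.r i) = f.1 (D.r (![2, 0, 1, 3] i)) := by
    intro i
    rw [← D.hu i, D.val σ hσ]
    rfl
  rw [h, h, h, h]
  rfl

theorem CosetData.rep_const (g : G) (n : ℤ) : D.rep σ hσ g (n, n, n, n) = (n, n, n, n) := by
  have h : (D.equiv σ hσ).symm (n, n, n, n) = ⟨fun _ => n, fun g h => (hσ _ _).symm⟩ := by
    rw [LinearEquiv.symm_apply_eq]; rfl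
  change D.equiv σ hσ (Representation.coind C.subtype σ g ((D.equiv σ hσ).symm _)) = _
  rw [h]; rfl

/-- quotient of `ℤ⁴` by constants -/
def P43 : Z4 →ₗ[ℤ] Z3 where
  toFun v := (v.1 - v.2.2.2, v.2.1 - v.2.2.2, v.2.2.1 - v.2.2.2)
  map_add' x y := by ext <;> simp <;> ring
  map_smul' x y := by ext <;> simp <;> ring

def J34 : Z3 →ₗ[ℤ] Z4 where
  toFun v := (v.1, v.2.1, v.2.2, 0)
  map_add' x y := by ext <;> simp
  map_smul' x y := by ext <;> simp

theorem J34_P43 (v : Z4) : J34 (P43 v) = v - (v.2.2.2, v.2.2.2, v.2.2.2, v.2.2.2) := by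
  ext <;> simp [J34, P43]

theorem P43_J34 (v : Z3) : P43 (J34 v) = v := by
  ext <;> simp [J34, P43]

theorem P43_const (n : ℤ) : P43 (n, n, n, n) = 0 := by
  ext <;> simp [P43]

theorem CosetData.P43_rep (g : G) (v : Z4) :
    P43 (D.rep σ hσ g (J34 (P43 v))) = P43 (D.rep σ hσ g v) := by
  rw [J34_P43, map_sub, D.rep_const, map_sub, P43_const, sub_zero]

def CosetData.rep3 : Representation ℤ G Z3 where
  toFun g := P43 ∘ₗ D.rep σ hσ g ∘ₗ J34
  map_one' := by
    refine LinearMap.ext fun v => ?_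
    simp [P43_J34]
  map_mul' g h := by
    refine LinearMap.ext fun v => ?_
    simp [D.P43_rep]

theorem CosetData.rep3_apply (g : G) (v) : D.rep3 σ hσ g v = P43 (D.rep σ hσ g (J34 v)) := rfl

theorem CosetData.rep3_s (v : Z3) :
    D.rep3 σ hσ s v = (v.2.1 - v.2.2, v.1 - v.2.2, - v.2.2) := by
  rw [D.rep3_apply, D.rep_s]; simp [P43, J34]

theorem CosetData.rep3_u (v : Z3) : D.rep3 σ hσ u v = (v.2.2, v.1, v.2.1) := by
  rw [D.rep3_apply, D.rep_u]; simp [P43, J34]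

end

/-- coset data for `Γ₀(3)` -/
def cc (x y : ZMod 3) : Fin 4 := if x = 0 then 0 else if y = 0 then 1 else if x = y then 2 else 3

theorem cc_iff : ∀ x y x' y' : ZMod 3, (x ≠ 0 ∨ y ≠ 0) → (x' ≠ 0 ∨ y' ≠ 0) →
    (cc x y = cc x' y' ↔ x * y' - y * x' = 0) := by decide +kernel

def cZ (g : SLZ) : Fin 4 := cc ((g 1 0 : ℤ) : ZMod 3) ((g 1 1 : ℤ) : ZMod 3)

theorem nzZ (g : SLZ) : (((g 1 0 : ℤ) : ZMod 3) ≠ 0 ∨ ((g 1 1 : ℤ) : ZMod 3) ≠ 0) := by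
  by_contra! h
  have := congrArg (Int.cast : ℤ → ZMod 3) (detZ g)
  push_cast at this
  rw [h.1, h.2] at this
  simp at this

def rZ : Fin 4 → SLZ := ![1, sZ, uZ, uZ * sZ]

def cosetZ : CosetData (CongruenceSubgroup.Gamma0 3) sZ uZ where
  c := cZ
  r := rZ
  hc g h := by
    rw [cZ, cZ, cc_iff _ _ _ _ (nzZ g) (nzZ h), CongruenceSubgroup.Gamma0_mem]
    have : (g * h⁻¹) 1 0 = g 1 0 * h 1 1 - g 1 1 * h 1 0 := by
      have h2 : (g * h⁻¹) 1 0 = g.1 1 0 * h⁻¹.1 0 0 + g.1 1 1 * h⁻¹.1 1 0 :=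
        (Matrix.mul_apply (M := g.1) (N := (h⁻¹).1)).trans (Fin.sum_univ_two _)
      rw [h2, Matrix.SpecialLinearGroup.SL2_inv_expl]
      simp
      ring
    rw [this]
    push_cast
    rfl
  hr := by decide +kernel
  hs := by decide +kernel
  hu := by decide +kernel

def cosetA : CosetData (BB.subgroupOf AA) (eA sZ) (eA uZ) where
  c g := cZ (eA.symm g)
  r i := eA (rZ i)
  hc g h := by
    rw [show cZ (eA.symm g) = cZ (eA.symm h) ↔ _ from cosetZ.hc _ _, ← eA_mem]
    simp
  hr i := by rw [MulEquiv.symm_apply_apply]; exact cosetZ.hr i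
  hs i := by rw [← map_mul, MulEquiv.symm_apply_apply]; exact cosetZ.hs i
  hu i := by rw [← map_mul, MulEquiv.symm_apply_apply]; exact cosetZ.hu i

theorem Gamma_H1 (σ : Representation ℤ (CongruenceSubgroup.Gamma0 3) ℤ) (hσ : ∀ g v, σ g v = v) :
    Nonempty (H σ 1 ≃ₗ[ℤ] ℤ) := by
  obtain ⟨e⟩ := four_H1 modDataZ (cosetZ.rep σ hσ) (cosetZ.rep_s σ hσ) (cosetZ.rep_u σ hσ)
  exact ⟨(shapiro σ 1).symm.trans ((Hequiv (cosetZ.equiv σ hσ) (cosetZ.rep_equiv σ hσ) 1).trans e)⟩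

theorem Gamma_Heven (σ : Representation ℤ (CongruenceSubgroup.Gamma0 3) ℤ) (hσ : ∀ g v, σ g v = v)
    (m : ℕ) : Nonempty (H σ (2 * m + 2) ≃ₗ[ℤ] ZMod 6) := by
  obtain ⟨e⟩ := four_Heven modDataZ (cosetZ.rep σ hσ) (cosetZ.rep_s σ hσ) (cosetZ.rep_u σ hσ) m
  exact ⟨(shapiro σ _).symm.trans ((Hequiv (cosetZ.equiv σ hσ) (cosetZ.rep_equiv σ hσ) _).trans e)⟩

theorem Gamma_Hodd (σ : Representation ℤ (CongruenceSubgroup.Gamma0 3) ℤ) (hσ : ∀ g v, σ g v = v)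
    (m : ℕ) : Nonempty (H σ (2 * m + 3) ≃ₗ[ℤ] ZMod 2) := by
  obtain ⟨e⟩ := four_Hodd modDataZ (cosetZ.rep σ hσ) (cosetZ.rep_s σ hσ) (cosetZ.rep_u σ hσ) m
  exact ⟨(shapiro σ _).symm.trans ((Hequiv (cosetZ.equiv σ hσ) (cosetZ.rep_equiv σ hσ) _).trans e)⟩

section X
variable (ρ : Representation ℤ GG ℤ) (hρ : ∀ g v, ρ g v = v)

def XE : XV AA BB ρ ≃ₗ[ℤ] Z4 :=
  cosetA.equiv (res (BB.subgroupOf AA) (res AA ρ)) (fun g v => hρ _ v)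

abbrev X4 : Representation ℤ AA Z4 :=
  cosetA.rep (res (BB.subgroupOf AA) (res AA ρ)) (fun g v => hρ _ v)

theorem XE_equiv (g : AA) (f : XV AA BB ρ) :
    XE ρ hρ (XR AA BB ρ g f) = X4 ρ hρ g (XE ρ hρ f) := conjRep_equiv _ _ _ _

include hρ in
theorem X_H1 : Nonempty (H (XR AA BB ρ) 1 ≃ₗ[ℤ] ℤ) := by
  obtain ⟨e⟩ := four_H1 modDataA (X4 ρ hρ) (cosetA.rep_s _ _) (cosetA.rep_u _ _)
  exact ⟨(Hequiv (XE ρ hρ) (XE_equiv ρ hρ) 1).trans e⟩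

include hρ in
theorem X_Heven (m : ℕ) : Nonempty (H (XR AA BB ρ) (2 * m + 2) ≃ₗ[ℤ] ZMod 6) := by
  obtain ⟨e⟩ := four_Heven modDataA (X4 ρ hρ) (cosetA.rep_s _ _) (cosetA.rep_u _ _) m
  exact ⟨(Hequiv (XE ρ hρ) (XE_equiv ρ hρ) _).trans e⟩

include hρ in
theorem X_Hodd (m : ℕ) : Nonempty (H (XR AA BB ρ) (2 * m + 3) ≃ₗ[ℤ] ZMod 2) := by
  obtain ⟨e⟩ := four_Hodd modDataA (X4 ρ hρ) (cosetA.rep_s _ _) (cosetA.rep_u _ _) m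
  exact ⟨(Hequiv (XE ρ hρ) (XE_equiv ρ hρ) _).trans e⟩

abbrev X3 : Representation ℤ AA Z3 :=
  cosetA.rep3 (res (BB.subgroupOf AA) (res AA ρ)) (fun g v => hρ _ v)

def Xpi : (XR AA BB ρ).IntertwiningMap (X3 ρ hρ) where
  toLinearMap := P43 ∘ₗ (XE ρ hρ).toLinearMap
  isIntertwining' g := by
    refine LinearMap.ext fun f => ?_
    change P43 (XE ρ hρ (XR AA BB ρ g f)) = P43 (X4 ρ hρ g (J34 (P43 (XE ρ hρ f))))
    rw [XE_equiv]
    exact (cosetA.P43_rep _ _ _ _).symm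

theorem Xpi_apply (f : XV AA BB ρ) : Xpi ρ hρ f = P43 (XE ρ hρ f) := rfl

theorem Xpi_surj : Function.Surjective (Xpi ρ hρ) := by
  intro v
  refine ⟨(XE ρ hρ).symm (J34 v), ?_⟩
  rw [Xpi_apply, LinearEquiv.apply_symm_apply, P43_J34]

theorem Xpi_exact : Function.Exact (etaR AA BB ρ) (Xpi ρ hρ) := by
  have key : ∀ n : ℤ, XE ρ hρ (etaR AA BB ρ n) = (n, n, n, n) := by
    intro n
    change ((etaR AA BB ρ n).1 _, (etaR AA BB ρ n).1 _, (etaR AA BB ρ n).1 _,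
      (etaR AA BB ρ n).1 _) = _
    simp only [etaR_apply, hρ]
  intro f
  rw [Xpi_apply]
  constructor
  · intro h
    refine ⟨(XE ρ hρ f).2.2.2, (XE ρ hρ).injective ?_⟩
    rw [key]
    have := J34_P43 (XE ρ hρ f)
    rw [h, map_zero] at this
    exact (sub_eq_zero.1 this.symm).symm
  · rintro ⟨n, rfl⟩
    rw [key, P43_const]

theorem X3_Heven (m : ℕ) : Subsingleton (H (X3 ρ hρ) (2 * m + 2)) :=
  three_Heven (X3 ρ hρ) (cosetA.rep3_s _ _) (cosetA.rep3_u _ _) modDataA m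

end X
end
end SL2Coh
end Part8

section Part9
set_option linter.unusedSimpArgs false
set_option linter.unusedVariables false
namespace SL2Coh

noncomputable section

theorem card_ker_range {M N : Type} [AddCommGroup M] [AddCommGroup N] (f : M →+ N) :
    Nat.card M = Nat.card f.ker * Nat.card f.range := by
  rw [AddSubgroup.card_eq_card_quotient_mul_card_addSubgroup f.ker,
    Nat.card_congr (QuotientAddGroup.quotientKerEquivRange f).toEquiv, mul_comm]

theorem toLin {M N : Type} [AddCommGroup M] [AddCommGroup N] [Module ℤ M] [Module ℤ N]
    (e : M ≃+ N) : Nonempty (M ≃ₗ[ℤ] N) :=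
  ⟨{ e with map_smul' := fun c x => map_intCast_smul e ℤ ℤ c x }⟩

theorem ex_ker {M N P : Type} [AddCommGroup M] [AddCommGroup N] [AddCommGroup P] {f : M →+ N}
    {g : N →+ P} (h : Function.Exact f g) : g.ker = f.range := by
  ext x; exact h x

section X
variable (ρ : Representation ℤ GG ℤ) (hρ : ∀ g v, ρ g v = v)
include hρ

theorem MVadd : ∃ (i : ∀ n, H ρ n →+ H (res AA ρ) n × H (res BB ρ) n)
    (j : ∀ n, H (res AA ρ) n × H (res BB ρ) n →+ H (XR AA BB ρ) n)
    (δ : ∀ n, H (XR AA BB ρ) n →+ H ρ (n + 1)),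
    (∀ n, Function.Exact (i n) (j n)) ∧ (∀ n, Function.Exact (j n) (δ n)) ∧
    (∀ n, Function.Exact (δ n) (i (n + 1))) ∧ ∀ m, Function.Surjective (j (2 * m + 2)) := by
  obtain ⟨i, j, δ, h1, h2, h3, h4⟩ := MV AA BB genG treeG ρ
  exact ⟨fun n => (i n).toAddMonoidHom, fun n => (j n).toAddMonoidHom,
    fun n => (δ n).toAddMonoidHom, h1, h2, h3,
    fun m => h4 (X3 ρ hρ) (Xpi ρ hρ) (Xpi_surj ρ hρ) (Xpi_exact ρ hρ) (2*m+2) (X3_Heven ρ hρ m)⟩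

theorem A_odd (m : ℕ) : Subsingleton (H (res AA ρ) (2*m+3)) :=
  triv_Hodd modDataA _ (fun g v => hρ _ v) m
theorem B_odd (m : ℕ) : Subsingleton (H (res BB ρ) (2*m+3)) :=
  triv_Hodd modDataB _ (fun g v => hρ _ v) m
theorem A_one : Subsingleton (H (res AA ρ) 1) :=
  triv_H1 modDataA _ (fun g v => hρ _ v)
theorem B_one : Subsingleton (H (res BB ρ) 1) :=
  triv_H1 modDataB _ (fun g v => hρ _ v)
theorem A_even (m : ℕ) : Nonempty (H (res AA ρ) (2*m+2) ≃+ ZMod 12) :=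
  (triv_Heven modDataA _ (fun g v => hρ _ v) m).map (·.toAddEquiv)
theorem B_even (m : ℕ) : Nonempty (H (res BB ρ) (2*m+2) ≃+ ZMod 12) :=
  (triv_Heven modDataB _ (fun g v => hρ _ v) m).map (·.toAddEquiv)

theorem G_odd (m : ℕ) : Subsingleton (H ρ (2*m+3)) := by
  obtain ⟨i, j, δ, h1, h2, h3, h4⟩ := MVadd ρ hρ
  have hj := h4 m
  have := A_odd ρ hρ m
  have := B_odd ρ hρ m
  refine ⟨fun a b => ?_⟩
  have : ∀ x : H ρ (2*m+3), x = 0 := by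
    intro x
    obtain ⟨y, rfl⟩ := (h3 (2*m+2) x).1 (Subsingleton.elim _ _)
    obtain ⟨z, rfl⟩ := hj y
    exact (h2 (2*m+2) _).2 ⟨z, rfl⟩
  rw [this a, this b]

theorem G_two : ∃ i : ℤ →+ H ρ 2, Function.Injective i ∧ ∀ h, ∃ n, i n = 12 • h := by
  obtain ⟨i, j, δ, h1, h2, h3, h4⟩ := MVadd ρ hρ
  obtain ⟨e⟩ := X_H1 ρ hρ
  have := A_one ρ hρ
  have := B_one ρ hρ
  obtain ⟨eA⟩ := A_even ρ hρ 0
  obtain ⟨eB⟩ := B_even ρ hρ 0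
  refine ⟨(δ 1).comp e.symm.toAddEquiv.toAddMonoidHom, ?_, ?_⟩
  · refine Function.Injective.comp (g := δ 1) ?_ e.symm.injective
    rw [injective_iff_map_eq_zero]
    intro a ha
    obtain ⟨y, rfl⟩ := (h2 1 a).1 ha
    rw [Subsingleton.elim y 0, map_zero]
  · intro h
    have h12 : ∀ z : ZMod 12, 12 • z = 0 := by decide
    obtain ⟨y, hy⟩ := (h3 1 (12 • h)).1 (by
      rw [map_nsmul]
      refine Prod.ext ?_ ?_
      · apply eA.injective
        change eA (12 • (i 2 h).1) = eA 0
        rw [map_nsmul, h12, map_zero]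
      · apply eB.injective
        change eB (12 • (i 2 h).2) = eB 0
        rw [map_nsmul, h12, map_zero])
    refine ⟨e y, ?_⟩
    change δ 1 (e.symm (e y)) = _
    rw [e.symm_apply_apply, hy]

theorem G_card (m : ℕ) : Nat.card (H ρ (2*m+4)) = 48 := by
  obtain ⟨i, j, δ, h1, h2, h3, h4⟩ := MVadd ρ hρ
  have hj : Function.Surjective (j (2*m+4)) := h4 (m+1)
  have := A_odd ρ hρ m
  have := B_odd ρ hρ m
  obtain ⟨eA⟩ := A_even ρ hρ (m+1)
  obtain ⟨eB⟩ := B_even ρ hρ (m+1)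
  obtain ⟨e⟩ := X_Hodd ρ hρ m
  obtain ⟨e'⟩ := X_Heven ρ hρ (m+1)
  have hinj : Function.Injective (δ (2*m+3)) := by
    rw [injective_iff_map_eq_zero]
    intro a ha
    obtain ⟨y, rfl⟩ := (h2 _ a).1 ha
    rw [Subsingleton.elim y 0, map_zero]
  have c1 : Nat.card (δ (2*m+3)).range = 2 := by
    rw [← Nat.card_congr (AddMonoidHom.ofInjective hinj).toEquiv, Nat.card_congr e.toEquiv,
      Nat.card_zmod]
  have c2 : (i (2*m+4)).ker = (δ (2*m+3)).range := ex_ker (h3 (2*m+3))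
  have c3 := ex_ker (h1 (2*m+4))
  have c4 := card_ker_range (j (2*m+4))
  have c5 := card_ker_range (i (2*m+4))
  have c6 : Nat.card (j (2*m+4)).range = 6 := by
    rw [AddMonoidHom.range_eq_top.2 hj, AddSubgroup.card_top]
    exact (Nat.card_congr e'.toEquiv).trans (Nat.card_zmod 6)
  have c7 : Nat.card (H (res AA ρ) (2*m+4) × H (res BB ρ) (2*m+4)) = 144 := by
    rw [Nat.card_prod, show Nat.card (H (res AA ρ) (2*m+4)) = _ from Nat.card_congr eA.toEquiv,
      show Nat.card (H (res BB ρ) (2*m+4)) = _ from Nat.card_congr eB.toEquiv, Nat.card_zmod]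
  rw [c7, c6, c3] at c4
  rw [c2, c1] at c5
  omega

end X
end
end SL2Coh
end Part9

section Part10
set_option linter.unusedSimpArgs false
set_option linter.unusedVariables false
namespace SL2Coh

noncomputable section

/-- reduction mod 4 -/
def red4 : R3 →+* ZMod 4 :=
  IsLocalization.Away.lift (3:ℤ) (g := Int.castRingHom (ZMod 4)) (by
    change IsUnit (((3:ℤ)) : ZMod 4)
    exact isUnit_iff_exists_inv.2 ⟨3, by decide⟩)

theorem red4_th : red4 th = 3 := by
  have := congrArg red4 th3
  rw [map_mul, map_one, map_ofNat] at this
  revert this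
  generalize red4 th = x
  revert x
  decide

def psi (a b c d : ZMod 4) : ZMod 4 :=
  (1 - c * c) * (b * d - (c - 1) * d + c - 1) + c * (a + d + 1)

theorem psi_mul : ∀ a b c d : ZMod 4, a * d - b * c = 1 → ∀ e f g h : ZMod 4, e * h - f * g = 1 →
    psi (a * e + b * g) (a * f + b * h) (c * e + d * g) (c * f + d * h) =
      psi a b c d + psi e f g h := by decide +kernel

def chi (g : GG) : ZMod 4 := psi (red4 (g 0 0)) (red4 (g 0 1)) (red4 (g 1 0)) (red4 (g 1 1))

theorem red4_det (g : GG) :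
    red4 (g 0 0) * red4 (g 1 1) - red4 (g 0 1) * red4 (g 1 0) = 1 := by
  rw [← map_mul, ← map_mul, ← map_sub, detG, map_one]

theorem chi_mul (g h : GG) : chi (g * h) = chi g + chi h := by
  have := psi_mul _ _ _ _ (red4_det g) _ _ _ _ (red4_det h)
  unfold chi
  rw [← this]
  simp only [mulG, map_add, map_mul]

theorem chi_emb (x y : R3) (hxy : x * y = 1) (g : SLZ) :
    chi (emb x y hxy g) = psi (g 0 0 : ℤ) (red4 x * (g 0 1 : ℤ)) (red4 y * (g 1 0 : ℤ)) (g 1 1 : ℤ)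
     := by
  change psi (red4 (g 0 0 : ℤ)) (red4 (x * (g 0 1 : ℤ))) (red4 (y * (g 1 0 : ℤ)))
    (red4 (g 1 1 : ℤ)) = _
  simp only [map_mul, map_intCast]

theorem chi_sA : chi (eA sZ) = 1 := by
  rw [eA_val, chi_emb, map_one]; decide +kernel
theorem chi_uA : chi (eA uZ) = 2 := by
  rw [eA_val, chi_emb, map_one]; decide +kernel
theorem chi_sB : chi (eB sZ) = 3 := by
  rw [eB_val, chi_emb, red4_th, map_ofNat]; decide +kernel
theorem chi_uB : chi (eB uZ) = 2 := by
  rw [eB_val, chi_emb, red4_th, map_ofNat]; decide +kernel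

def LZ : SLZ := sZ * uZ⁻¹
def TZ : SLZ := sZ * (sZ * (sZ * uZ))

theorem LZ_eq : LZ = ⟨!![1, 0; 1, 1], by simp [Matrix.det_fin_two]⟩ := Subtype.ext (by decide +kernel)
theorem TZ_eq : TZ = ⟨!![1, 1; 0, 1], by simp [Matrix.det_fin_two]⟩ := Subtype.ext (by decide +kernel)

theorem emb_ent (x y : R3) (hxy : x * y = 1) (g : SLZ) : (emb x y hxy g) 0 0 = (g 0 0 : ℤ) ∧
    (emb x y hxy g) 0 1 = x * (g 0 1 : ℤ) ∧ (emb x y hxy g) 1 0 = y * (g 1 0 : ℤ) ∧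
    (emb x y hxy g) 1 1 = (g 1 1 : ℤ) := ⟨rfl, rfl, rfl, rfl⟩

theorem extG {g h : GG} (h1 : g 0 0 = h 0 0) (h2 : g 0 1 = h 0 1) (h3 : g 1 0 = h 1 0)
    (h4 : g 1 1 = h 1 1) : g = h := by
  refine Matrix.SpecialLinearGroup.ext _ _ fun i j => ?_
  fin_cases i <;> fin_cases j <;> assumption

theorem TZ3 : (eB TZ : GG) * (eB TZ * eB TZ) = eA TZ := by
  rw [eA_val, eB_val]
  obtain ⟨h1, h2, h3, h4⟩ := emb_ent th 3 th3 TZ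
  obtain ⟨k1, k2, k3, k4⟩ := emb_ent 1 1 (mul_one 1) TZ
  have e1 : TZ 0 0 = 1 := by rw [TZ_eq]; rfl
  have e2 : TZ 0 1 = 1 := by rw [TZ_eq]; rfl
  have e3 : TZ 1 0 = 0 := by rw [TZ_eq]; rfl
  have e4 : TZ 1 1 = 1 := by rw [TZ_eq]; rfl
  apply extG <;> simp only [mulG, h1, h2, h3, h4, k1, k2, k3, k4, e1, e2, e3, e4] <;> push_cast
  · ring
  · linear_combination th3
  · ring
  · ring
theorem LZ3 : (eA LZ : GG) * (eA LZ * eA LZ) = eB LZ := by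
  rw [eA_val, eB_val]
  obtain ⟨h1, h2, h3, h4⟩ := emb_ent th 3 th3 LZ
  obtain ⟨k1, k2, k3, k4⟩ := emb_ent 1 1 (mul_one 1) LZ
  have e1 : LZ 0 0 = 1 := by rw [LZ_eq]; rfl
  have e2 : LZ 0 1 = 0 := by rw [LZ_eq]; rfl
  have e3 : LZ 1 0 = 1 := by rw [LZ_eq]; rfl
  have e4 : LZ 1 1 = 1 := by rw [LZ_eq]; rfl
  apply extG <;> simp only [mulG, h1, h2, h3, h4, k1, k2, k3, k4, e1, e2, e3, e4] <;> push_cast <;>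
    ring

section homs
variable {M : Type} [AddCommGroup M] (f : GG → M) (hf : ∀ g h, f (g * h) = f g + f h)
include hf

theorem hom_one : f 1 = 0 := by
  have := hf 1 1
  rw [mul_one] at this
  exact left_eq_add.1 this

theorem hom_inv (g : GG) : f g⁻¹ = - f g := by
  have := hf g⁻¹ g
  rw [inv_mul_cancel, hom_one f hf] at this
  exact eq_neg_of_add_eq_zero_left this.symm

theorem hom_val : 4 • f (eA sZ) = 0 ∧ f (eA uZ) = 2 • f (eA sZ) ∧ f (eB sZ) = 3 • f (eA sZ) ∧
    f (eB uZ) = 2 • f (eA sZ) := by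
  have a1 := congrArg (fun x : AA => f x) modDataA.h4
  have a2 := congrArg (fun x : AA => f x) modDataA.hu
  have b1 := congrArg (fun x : BB => f x) modDataB.h4
  have b2 := congrArg (fun x : BB => f x) modDataB.hu
  have c1 := congrArg f (TZ3)
  have c2 := congrArg f (LZ3)
  simp only [TZ, LZ, map_mul, map_inv, Subgroup.coe_mul, Subgroup.coe_inv, hf, hom_inv f hf,
    Subgroup.coe_one, hom_one f hf] at a1 a2 b1 b2 c1 c2
  generalize f (eA sZ) = p at *
  generalize f (eA uZ) = q at *
  generalize f (eB sZ) = p' at *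
  generalize f (eB uZ) = q' at *
  have E1 : - p' + p - q = 0 := by
    linear_combination (norm := module) c1 - b2 - (3:ℤ) • b1 + a1
  have E2 : q' + q = 0 := by
    linear_combination (norm := module) c2 + a2 - E1
  have E3 : - q - (2:ℤ) • p = 0 := by
    linear_combination (norm := module) b2 - (3:ℤ) • E2 - (2:ℤ) • E1
  refine ⟨?_, ?_, ?_, ?_⟩
  · linear_combination (norm := module) a1
  · linear_combination (norm := module) - E3 - a1
  · linear_combination (norm := module) - E1 + E3
  · linear_combination (norm := module) E2 + E3

theorem hom_ext (h0 : f (eA sZ) = 0) (g : GG) : f g = 0 := by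
  obtain ⟨h1, h2, h3, h4⟩ := hom_val f hf
  rw [h0, smul_zero] at h2 h3 h4
  let T : Subgroup GG := { 
    carrier := {g | f g = 0}
    mul_mem' := fun {a b} (ha : f a = 0) (hb : f b = 0) => by
      change f (a * b) = 0
      rw [hf, ha, hb, add_zero]
    one_mem' := hom_one f hf
    inv_mem' := fun {a} (ha : f a = 0) => by
      change f (a⁻¹) = 0
      rw [hom_inv f hf, ha, neg_zero] }
  have hA := modDataA.gen (T.subgroupOf AA) h0 h2
  have hB := modDataB.gen (T.subgroupOf BB) h3 h4
  have hT := genG T (Subgroup.subgroupOf_eq_top.1 hA) (Subgroup.subgroupOf_eq_top.1 hB)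
  have : g ∈ T := by rw [hT]; trivial
  exact this

end homs

theorem alg1 {M : Type} [AddCommGroup M] (i : ℤ →+ M) (hi : Function.Injective i)
    (h12 : ∀ h, ∃ n, i n = 12 • h) (c : M) (hc : ∀ k : ℤ, k • c = 0 ↔ 4 ∣ k)
    (ht : ∀ h : M, 12 • h = 0 → ∃ k : ℤ, h = k • c) : Nonempty (M ≃+ ℤ × ZMod 4) := by
  choose ψ hψ using h12
  let Ψ : M →+ ℤ := AddMonoidHom.mk' ψ (fun a b => hi (by rw [map_add, hψ, hψ, hψ, smul_add]))
  have hΨ : ∀ h, i (Ψ h) = 12 • h := hψ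
  obtain ⟨d, hd⟩ := Int.subgroup_cyclic Ψ.range
  rw [← AddSubgroup.zmultiples_eq_closure] at hd
  have hdm : d ∈ Ψ.range := by rw [hd]; exact AddSubgroup.mem_zmultiples d
  obtain ⟨h0, hh0⟩ := hdm
  have hd0 : d ≠ 0 := by
    rintro rfl
    have h1 : Ψ (i 1) ∈ Ψ.range := ⟨_, rfl⟩
    rw [hd, AddSubgroup.zmultiples_zero_eq_bot, AddSubgroup.mem_bot] at h1
    have := hΨ (i 1)
    rw [h1, ← map_nsmul] at this
    have := hi this
    simp at this
  have hΨc : Ψ c = 0 := hi (by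
    rw [hΨ, map_zero, ← natCast_zsmul, hc]; norm_num)
  have hz : (4:ℤ) • c = 0 := (hc 4).2 (dvd_refl _)
  let z : ZMod 4 →+ M := ZMod.lift 4 ⟨zmultiplesHom M c, by simpa using hz⟩
  have hzk : ∀ k : ℤ, z (k : ZMod 4) = k • c := by
    intro k; simp [z]
  let F : ℤ × ZMod 4 →+ M := AddMonoidHom.coprod (zmultiplesHom M h0) z
  have hF : ∀ n (k : ℤ), F (n, (k : ZMod 4)) = n • h0 + k • c := by
    intro n k
    simp [F, hzk]
  refine ⟨(AddEquiv.ofBijective F ⟨?_, ?_⟩).symm⟩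
  · rw [injective_iff_map_eq_zero]
    rintro ⟨n, k⟩ h
    obtain ⟨k, rfl⟩ := ZMod.intCast_surjective k
    rw [hF] at h
    have h2 := congrArg Ψ h
    rw [map_add, map_zsmul, map_zsmul, hΨc, hh0, map_zero, smul_zero, add_zero, smul_eq_mul,
      mul_eq_zero, or_iff_left hd0] at h2
    subst h2
    rw [zero_smul, zero_add, hc] at h
    have : ((k:ℤ) : ZMod 4) = 0 := (ZMod.intCast_zmod_eq_zero_iff_dvd k 4).2 h
    rw [this]; rfl
  · intro h
    have h1 : Ψ h ∈ Ψ.range := ⟨_, rfl⟩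
    rw [hd, AddSubgroup.mem_zmultiples_iff] at h1
    obtain ⟨n, hn⟩ := h1
    obtain ⟨k, hk⟩ := ht (h - n • h0) (by
      rw [← hΨ, map_sub, map_zsmul, hh0, hn, sub_self, map_zero])
    refine ⟨(n, (k : ZMod 4)), ?_⟩
    rw [hF, ← hk]; abel

end
end SL2Coh
end Part10

section Part11
set_option linter.unusedSimpArgs false
set_option linter.unusedVariables false
namespace SL2Coh

noncomputable section

theorem H1hom' {k G M : Type} [CommRing k] [Group G] [AddCommGroup M] [Module k M]
    (ρ : Representation k G M)
    (hρ : ∀ g v, ρ g v = v) : Nonempty (H ρ 1 ≃+ (Additive G →+ M)) := by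
  have h : (Rep.of ρ).IsTrivial := ⟨fun g => LinearMap.ext (hρ g)⟩
  exact ⟨(groupCohomology.H1IsoOfIsTrivial (Rep.of ρ)).toLinearEquiv.toAddEquiv⟩

theorem H1hom {M : Type} [AddCommGroup M] [Module ℤ M] (ρ : Representation ℤ GG M)
    (hρ : ∀ g v, ρ g v = v) : Nonempty (H ρ 1 ≃+ (Additive GG →+ M)) := H1hom' ρ hρ

theorem G_one (ρ : Representation ℤ GG ℤ) (hρ : ∀ g v, ρ g v = v) : Subsingleton (H ρ 1) := by
  obtain ⟨e⟩ := H1hom ρ hρ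
  have : ∀ f : Additive GG →+ ℤ, f = 0 := by
    intro f
    have hf : ∀ g h : GG, f (.ofMul (g * h)) = f (.ofMul g) + f (.ofMul h) :=
      fun g h => f.map_add (.ofMul g) (.ofMul h)
    obtain ⟨h1, -⟩ := hom_val (fun g => f (.ofMul g)) hf
    refine AddMonoidHom.ext fun g => hom_ext (fun g => f (.ofMul g)) hf ?_ g.toMul
    rw [nsmul_eq_mul, mul_eq_zero] at h1
    exact h1.resolve_left (by norm_num)
  refine ⟨fun a b => e.injective ?_⟩
  rw [this (e a), this (e b)]

def chi12 : Additive GG →+ ZMod 12 where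
  toFun g := (ZMod.lift 4 ⟨zmultiplesHom (ZMod 12) 3, by decide⟩ : ZMod 4 →+ ZMod 12) (chi g.toMul)
  map_zero' := by
    have : chi (Additive.toMul 0) = 0 := hom_one chi chi_mul
    rw [this, map_zero]
  map_add' g h := by
    have : chi (Additive.toMul (g + h)) = chi g.toMul + chi h.toMul := chi_mul _ _
    rw [this, map_add]

theorem chi12_s : chi12 (.ofMul (eA sZ : GG)) = 3 := by
  change (ZMod.lift 4 ⟨zmultiplesHom (ZMod 12) 3, by decide⟩ : ZMod 4 →+ ZMod 12) (chi (eA sZ)) = _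
  rw [chi_sA]
  decide +kernel

theorem chi12_order (k : ℤ) : k • chi12 = 0 ↔ 4 ∣ k := by
  have key : (k • (3 : ZMod 12) = 0) ↔ 4 ∣ k := by
    rw [show k • (3 : ZMod 12) = ((k * 3 : ℤ) : ZMod 12) by push_cast; simp]
    rw [ZMod.intCast_zmod_eq_zero_iff_dvd]
    constructor <;> intro h <;> push_cast at * <;> omega
  rw [← key]
  constructor
  · intro h
    have := DFunLike.congr_fun h (.ofMul (eA sZ : GG))
    rw [AddMonoidHom.smul_apply, chi12_s] at this
    exact this
  · intro h
    refine AddMonoidHom.ext fun g => hom_ext (fun g => (k • chi12) (.ofMul g)) ?_ ?_ g.toMul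
    · exact fun g h => (k • chi12).map_add (.ofMul g) (.ofMul h)
    · change k • chi12 (.ofMul (eA sZ : GG)) = 0
      rw [chi12_s, h]

theorem chi12_gen (f : Additive GG →+ ZMod 12) : ∃ k : ℤ, f = k • chi12 := by
  have hf : ∀ g h : GG, f (.ofMul (g * h)) = f (.ofMul g) + f (.ofMul h) :=
      fun g h => f.map_add (.ofMul g) (.ofMul h)
  obtain ⟨h1, -⟩ := hom_val (fun g => f (.ofMul g)) hf
  have h3 : ∀ p : ZMod 12, 4 • p = 0 → ∃ k : Fin 4, p = (k : ℤ) • 3 := by decide +kernel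
  obtain ⟨k, hk⟩ := h3 _ h1
  refine ⟨(k : ℤ), ?_⟩
  have := hom_ext (fun g => (f - (k : ℤ) • chi12) (.ofMul g))
    (fun g h => (f - (k : ℤ) • chi12).map_add (.ofMul g) (.ofMul h)) (by
      change f (.ofMul (eA sZ : GG)) - (k : ℤ) • chi12 (.ofMul (eA sZ : GG)) = 0
      rw [chi12_s, hk, sub_self])
  exact sub_eq_zero.1 (AddMonoidHom.ext fun g => this g.toMul)

theorem G_two_class (ρ : Representation ℤ GG ℤ) (hρ : ∀ g v, ρ g v = v) :
    ∃ c : H ρ 2, (∀ k : ℤ, k • c = 0 ↔ 4 ∣ k) ∧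
      ∀ h : H ρ 2, 12 • h = 0 → ∃ k : ℤ, h = k • c := by
  obtain ⟨e⟩ := H1hom (Representation.trivial ℤ GG (ZMod 12)) (fun g v => rfl)
  let g : ρ.IntertwiningMap (Representation.trivial ℤ GG (ZMod 12)) :=
    ⟨zc 12, fun g => LinearMap.ext fun v => congrArg (zc 12) (hρ g v)⟩
  have hf12 : ∀ n : ℤ, (12 • Representation.IntertwiningMap.id ρ) n = 12 * n := fun n => by
    change (12:ℕ) • n = _
    rw [nsmul_eq_mul]; norm_num
  obtain ⟨δ, hδ⟩ := les (12 • Representation.IntertwiningMap.id ρ) g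
    (by
      intro a b h
      rw [hf12, hf12] at h
      omega)
    (fun q => zc_surj 12 q)
    (by
      intro n
      change zc 12 n = 0 ↔ _
      rw [zc_zero]
      constructor
      · rintro ⟨m, rfl⟩; exact ⟨m, hf12 m⟩
      · rintro ⟨m, rfl⟩; rw [hf12]; exact ⟨m, rfl⟩)
  have hs := G_one ρ hρ
  let D : (Additive GG →+ ZMod 12) →+ H ρ 2 := (δ 1).toAddMonoidHom.comp e.symm.toAddMonoidHom
  have hD : Function.Injective D := by
    refine Function.Injective.comp (g := δ 1) ?_ e.symm.injective
    rw [injective_iff_map_eq_zero]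
    intro a ha
    obtain ⟨y, rfl⟩ := ((hδ 1).2.1 a).1 ha
    rw [Subsingleton.elim y 0, map_zero]
  refine ⟨D chi12, fun k => ?_, fun h h12 => ?_⟩
  · rw [← chi12_order, ← map_zsmul, map_eq_zero_iff D hD]
  · obtain ⟨y, rfl⟩ := ((hδ 1).2.2 h).1 (by rw [Hmap_nsmul, Hmap_id]; exact h12)
    obtain ⟨k, hk⟩ := chi12_gen (e y)
    refine ⟨k, ?_⟩
    rw [← map_zsmul, ← hk]
    change _ = δ 1 (e.symm (e y))
    rw [e.symm_apply_apply]

theorem G_H2 (ρ : Representation ℤ GG ℤ) (hρ : ∀ g v, ρ g v = v) :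
    Nonempty (H ρ 2 ≃+ ℤ × ZMod 4) := by
  obtain ⟨i, hi, h12⟩ := G_two ρ hρ
  obtain ⟨c, hc, ht⟩ := G_two_class ρ hρ
  exact alg1 i hi h12 c hc ht

end
end SL2Coh
end Part11

section Part12
set_option linter.unusedSimpArgs false
set_option linter.unusedVariables false
namespace SL2Coh

noncomputable section

abbrev PV := ZMod 4 → ℤ

section kill
variable {V : Type} [AddCommGroup V] [Module ℤ V]

theorem FD_of (m : PV →+ Module.End ℤ V) (hm : m (fun _ => 1) = LinearMap.id) (T : Module.End ℤ V)
    (w : ZMod 4) (hT : ∀ e v, T (m e v) = m (fun x => e (x + w)) (T v)) (e : PV) (n t : ℕ)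
    (hn : (n : ZMod 4) * w = 0)
    (hs : ∀ x : ZMod 4, ∑ i ∈ Finset.range n, e (x + (i : ZMod 4) * w) = t) : FD T n t := by
  refine ⟨fun i => m (fun x => e (x + (i : ZMod 4) * w)), ?_, ?_, ?_⟩
  · intro i v
    rw [hT]
    congr 2
    funext x
    push_cast
    ring_nf
  · simp [hn]
  · intro v
    rw [← LinearMap.sum_apply, ← map_sum]
    have : (∑ i ∈ Finset.range n, fun x : ZMod 4 => e (x + (i : ZMod 4) * w)) =
        t • (fun _ => (1:ℤ)) := by
      funext x
      rw [Finset.sum_apply, hs]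
      simp
    rw [this, map_nsmul, hm]
    rfl

theorem kill3 {G : Type} [Group G] {s u : G} (hM : ModData G s u) (ρ : Representation ℤ G V)
    (m : PV →+ Module.End ℤ V) (hm : m (fun _ => 1) = LinearMap.id) (χ : G → ZMod 4)
    (hT : ∀ g e v, ρ g (m e v) = m (fun x => e (x + χ g)) (ρ g v))
    (hs : χ s = 1 ∨ χ s = 3) (hu : χ u = 2) (n : ℕ) (x : H ρ (n + 2)) : 3 • x = 0 := by
  have hss : χ s + χ s = 2 := by
    rcases hs with h | h <;> rw [h] <;> decide
  refine hM.kill ρ 3 ?_ ?_ ?_ n x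
  · refine FD_of m hm _ (χ s) (hT s) (fun x => if x = 0 then 1 else 0) 4 1 ?_ ?_
    · exact zero_mul _
    · rcases hs with h | h <;> rw [h] <;> decide +kernel
  · refine FD_of m hm _ (χ s + χ s) ?_ (fun x => if x = 0 ∨ x = 1 then 1 else 0) 2 1 ?_ ?_
    · intro e v
      rw [LinearMap.comp_apply, LinearMap.comp_apply, hT, hT]
      simp only [add_assoc]
    · rw [hss]; decide
    · rw [hss]; decide +kernel
  · refine FD_of m hm _ (χ u) (hT u) (fun x => if x = 0 ∨ x = 1 then 1 else 0) 6 3 ?_ ?_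
    · rw [hu]; decide
    · rw [hu]; decide +kernel

end kill

/-- the permutation module on `ZMod 4` -/
def PR : Representation ℤ GG PV where
  toFun g := { toFun := fun f x => f (x + chi g), map_add' := fun _ _ => rfl,
               map_smul' := fun _ _ => rfl }
  map_one' := by
    refine LinearMap.ext fun f => funext fun x => ?_
    change f (x + chi 1) = f x
    rw [hom_one chi chi_mul, add_zero]
  map_mul' g h := by
    refine LinearMap.ext fun f => funext fun x => ?_
    change f (x + chi (g * h)) = f (x + chi g + chi h)
    rw [chi_mul, add_assoc]

theorem PR_apply (g : GG) (f : PV) (x : ZMod 4) : PR g f x = f (x + chi g) := rfl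

def mP : PV →+ Module.End ℤ PV where
  toFun e := { toFun := fun f x => e x * f x,
               map_add' := fun _ _ => funext fun x => mul_add _ _ _
               map_smul' := fun c f => funext fun x => mul_left_comm _ _ _ }
  map_zero' := LinearMap.ext fun f => funext fun x => zero_mul _
  map_add' e e' := LinearMap.ext fun f => funext fun x => add_mul _ _ _

theorem mP_apply (e f : PV) (x : ZMod 4) : mP e f x = e x * f x := rfl

theorem mP_one : mP (fun _ => 1) = LinearMap.id := LinearMap.ext fun f => funext fun x => one_mul _

theorem kill_A (n : ℕ) (x : H (res AA PR) (n + 2)) : 3 • x = 0 :=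
  kill3 modDataA _ mP mP_one (fun g => chi g) (fun g e v => rfl) (Or.inl chi_sA) chi_uA n x
theorem kill_B (n : ℕ) (x : H (res BB PR) (n + 2)) : 3 • x = 0 :=
  kill3 modDataB _ mP mP_one (fun g => chi g) (fun g e v => rfl) (Or.inr chi_sB) chi_uB n x

def mXf (e : PV) (f : XV AA BB PR) : XV AA BB PR :=
  ⟨fun a x => e (x + chi a) * f.1 a x, by
    intro c a
    funext x
    have h1 := congrFun (f.2 c a) x
    change e (x + chi ((c.1.1) * a)) * f.1 _ x = e (x + chi c.1.1 + chi a) * f.1 a (x + chi c.1.1)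
    rw [h1, chi_mul, add_assoc]
    rfl⟩

theorem mXf_apply (e : PV) (f : XV AA BB PR) (a : AA) (x : ZMod 4) :
    (mXf e f).1 a x = e (x + chi a) * f.1 a x := rfl

theorem XV_ext {f g : XV AA BB PR} (h : ∀ a x, f.1 a x = g.1 a x) : f = g :=
  Subtype.ext (funext fun a => funext fun x => h a x)

def mX : PV →+ Module.End ℤ (XV AA BB PR) where
  toFun e := { toFun := mXf e,
               map_add' := fun f g => XV_ext fun a x => mul_add _ _ _
               map_smul' := fun c f => XV_ext fun a x => mul_left_comm _ _ _ }
  map_zero' := LinearMap.ext fun f => XV_ext fun a x => zero_mul _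
  map_add' e e' := LinearMap.ext fun f => XV_ext fun a x => add_mul _ _ _

theorem kill_X (n : ℕ) (x : H (XR AA BB PR) (n + 2)) : 3 • x = 0 := by
  refine kill3 modDataA _ mX ?_ (fun g => chi g) ?_ (Or.inl chi_sA) chi_uA n x
  · exact LinearMap.ext fun f => XV_ext fun a x => one_mul _
  · intro g e f
    refine XV_ext fun a x => ?_
    change e (x + chi (a.1 * g.1)) * f.1 (a * g) x = e (x + chi a + chi g) * f.1 (a * g) x
    rw [chi_mul, add_assoc]

theorem kill_G (n : ℕ) (x : H PR (n + 3)) : 9 • x = 0 := by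
  obtain ⟨i, j, δ, h1, h2, h3, h4⟩ := MV AA BB genG treeG PR
  obtain ⟨z, hz⟩ := (h3 (n+2) (3 • x)).1 (by
    rw [map_nsmul]
    exact Prod.ext (kill_A (n+1) _) (kill_B (n+1) _))
  rw [show (9 : ℕ) = 3 * 3 by norm_num, mul_smul, ← hz, ← map_nsmul, kill_X, map_zero]

end
end SL2Coh
end Part12

section Part13
set_option linter.unusedSimpArgs false
set_option linter.unusedVariables false
namespace SL2Coh

noncomputable section

theorem sumPV (f : PV) : ∑ x, f x = f 0 + f 1 + f 2 + f 3 := Fin.sum_univ_four (M := ℤ) f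

section seq
variable (ρ : Representation ℤ GG ℤ) (hρ : ∀ g v, ρ g v = v)

def sumI : PR.IntertwiningMap ρ where
  toLinearMap := { toFun := fun f => ∑ x, f x
                   map_add' := fun f g => Finset.sum_add_distrib
                   map_smul' := fun c f => (Finset.mul_sum _ _ _).symm }
  isIntertwining' g := by
    refine LinearMap.ext fun f => ?_
    change ∑ x, f (x + chi g) = ρ g (∑ x, f x)
    rw [hρ]
    exact Fintype.sum_equiv (Equiv.addRight (chi g)) _ _ (fun x => rfl)

def constI : ρ.IntertwiningMap PR where
  toLinearMap := { toFun := fun n _ => n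
                   map_add' := fun f g => rfl
                   map_smul' := fun c f => rfl }
  isIntertwining' g := by
    refine LinearMap.ext fun n => ?_
    change (fun _ => ρ g n) = _
    rw [hρ]
    rfl

theorem sumI_apply (f : PV) : sumI ρ hρ f = f 0 + f 1 + f 2 + f 3 := sumPV f

def inclI : (kerRep (sumI ρ hρ)).IntertwiningMap PR where
  toLinearMap := Submodule.subtype _
  isIntertwining' g := rfl

def shiftI : PR.IntertwiningMap (kerRep (sumI ρ hρ)) where
  toLinearMap := LinearMap.codRestrict (LinearMap.ker (sumI ρ hρ).toLinearMap)
    { toFun := fun (f : PV) (x : ZMod 4) => f (x + 1) - f x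
      map_add' := fun f g => funext fun x => add_sub_add_comm _ _ _ _
      map_smul' := fun c f => funext fun x => (mul_sub _ _ _).symm }
    (fun f => by
      rw [LinearMap.mem_ker]
      change ∑ x, (f (x + 1) - f x) = 0
      rw [Finset.sum_sub_distrib, sub_eq_zero]
      exact Fintype.sum_equiv (Equiv.addRight 1) _ _ (fun x => rfl))
  isIntertwining' g := by
    refine LinearMap.ext fun f => Subtype.ext (funext fun x => ?_)
    change f (x + 1 + chi g) - f (x + chi g) = f (x + chi g + 1) - f (x + chi g)
    rw [add_right_comm]

theorem shiftI_apply (f : PV) (x : ZMod 4) : (shiftI ρ hρ f).1 x = f (x + 1) - f x := rfl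

include hρ in
theorem per (n : ℕ) : ∃ F : H ρ (n + 2) →+ H ρ (n + 4), (∀ v, F (4 • v) = 0) ∧
    ∀ y, ∃ v, 81 • y = F v := by
  obtain ⟨δ1, h1⟩ := les (inclI ρ hρ) (sumI ρ hρ) (fun x y h => Subtype.ext h)
    (by
      intro n
      refine ⟨fun x => if x = 0 then n else 0, ?_⟩
      rw [sumI_apply, if_pos rfl, if_neg (by decide), if_neg (by decide), if_neg (by decide)]
      ring)
    (by
      intro f
      exact ⟨fun h => ⟨⟨f, LinearMap.mem_ker.2 h⟩, rfl⟩, by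
        rintro ⟨g, rfl⟩; exact LinearMap.mem_ker.1 g.2⟩)
  obtain ⟨δ2, h2⟩ := les (constI ρ hρ) (shiftI ρ hρ)
    (fun x y h => congrFun h (0 : ZMod 4))
    (by
      rintro ⟨f, hf⟩
      have hf' : f 0 + f 1 + f 2 + f 3 = 0 := (sumPV f).symm.trans (LinearMap.mem_ker.1 hf)
      refine ⟨![0, f 0, f 0 + f 1, f 0 + f 1 + f 2], Subtype.ext (funext fun x => ?_)⟩
      refine (shiftI_apply ρ hρ _ x).trans ?_
      fin_cases x
      · change f 0 - 0 = f 0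
        ring
      · change f 0 + f 1 - f 0 = f 1
        ring
      · change f 0 + f 1 + f 2 - (f 0 + f 1) = f 2
        ring
      · change 0 - (f 0 + f 1 + f 2) = f 3
        linarith)
    (by
      intro f
      constructor
      · intro h
        have h' : ∀ x, f (x + 1) = f x := fun x => by
          have := congrFun (congrArg Subtype.val h) x
          rw [shiftI_apply] at this
          exact sub_eq_zero.1 this
        refine ⟨f 0, funext fun x => ?_⟩
        change f 0 = f x
        have a0 : f 1 = f 0 := h' 0
        have a1 : f 2 = f 1 := h' 1
        have a2 : f 3 = f 2 := h' 2
        fin_cases x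
        · rfl
        · exact a0.symm
        · exact (a1.trans a0).symm
        · exact (a2.trans (a1.trans a0)).symm
      · rintro ⟨n, rfl⟩
        refine Subtype.ext (funext fun x => ?_)
        rw [shiftI_apply]
        exact sub_self _)
  refine ⟨(δ2 (n+3)).toAddMonoidHom.comp (δ1 (n+2)).toAddMonoidHom, ?_, ?_⟩
  · intro v
    change δ2 (n+3) (δ1 (n+2) (4 • v)) = 0
    have h4 : (sumI ρ hρ).comp (constI ρ hρ) = 4 • Representation.IntertwiningMap.id ρ := by
      refine Representation.IntertwiningMap.ext (LinearMap.ext fun m => ?_)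
      change sumI ρ hρ (fun _ => m) = (4:ℕ) • m
      rw [sumI_apply, nsmul_eq_mul]
      push_cast
      ring
    have h5 := congrArg (fun f => Hmap f (n+2) v) h4
    simp only [Hmap_comp, Hmap_nsmul, Hmap_id] at h5
    rw [← h5, ((h1 (n+2)).2.1 _).2 ⟨_, rfl⟩, map_zero]
  · intro y
    obtain ⟨w, hw⟩ := ((h2 (n+3)).2.2 (9 • y)).1 (by rw [map_nsmul]; exact kill_G (n+1) _)
    obtain ⟨v, hv⟩ := ((h1 (n+2)).2.2 (9 • w)).1 (by rw [map_nsmul]; exact kill_G n _)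
    refine ⟨v, ?_⟩
    change _ = δ2 (n+3) (δ1 (n+2) v)
    rw [hv, map_nsmul, hw, ← mul_smul]
    norm_num

end seq

theorem alg2 {M N : Type} [AddCommGroup M] [AddCommGroup N] (hc : Nat.card M = 48) (F : N →+ M)
    (h4 : ∀ v, F (4 • v) = 0) (h81 : ∀ y, ∃ v, 81 • y = F v) (a b : N)
    (hab : ∀ v, ∃ m n : ℤ, v = m • a + n • b) : Nonempty (M ≃+ ZMod 12 × ZMod 4) := by
  have hfin : Finite M := Nat.finite_of_card_ne_zero (by rw [hc]; norm_num)
  have h48 : ∀ x : M, 48 • x = 0 := fun x => by rw [← hc]; exact card_nsmul_eq_zero'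
  let z (v : N) : ZMod 4 →+ M := ZMod.lift 4 ⟨zmultiplesHom M (F v), by
    have := h4 v
    rw [map_nsmul, ← natCast_zsmul] at this
    exact this⟩
  have hz : ∀ v (k : ℤ), z v (k : ZMod 4) = k • F v := by
    intro v k; simp [z]
  let T : AddSubgroup M := (nsmulAddMonoidHom (α := M) 3).ker
  have hT : ∀ x : M, x ∈ T ↔ 3 • x = 0 := fun x => Iff.rfl
  let Φ : ZMod 4 × ZMod 4 × T →+ M :=
    AddMonoidHom.coprod (z a) (AddMonoidHom.coprod (z b) T.subtype)
  have hΦ : ∀ x y t, Φ (x, y, t) = z a x + (z b y + t) := fun x y t => rfl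
  have hs : Function.Surjective Φ := by
    intro y
    obtain ⟨v, hv⟩ := h81 y
    obtain ⟨m, n, rfl⟩ := hab v
    have ht : -(80 • y) ∈ T := by
      rw [hT, smul_neg, ← mul_smul, show 3 * 80 = 5 * 48 by norm_num, mul_smul, h48, smul_zero,
        neg_zero]
    refine ⟨((m : ZMod 4), (n : ZMod 4), ⟨_, ht⟩), ?_⟩
    rw [hΦ, hz, hz, ← add_assoc, ← map_zsmul, ← map_zsmul, ← map_add, ← hv]
    change 81 • y + -(80 • y) = y
    rw [show 81 = 80 + 1 by norm_num, add_smul, one_smul]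
    abel
  let _ : Module (ZMod 3) T := AddCommGroup.zmodModule (n := 3) (fun x => Subtype.ext x.2)
  have hT3 : Nat.card T = 3 ^ Module.finrank (ZMod 3) T := by
    rw [Module.natCard_eq_pow_finrank (K := ZMod 3), Nat.card_zmod]
  have hdvd : Nat.card T ∣ 48 := by rw [← hc]; exact AddSubgroup.card_addSubgroup_dvd_card T
  have hle : 48 ≤ 16 * Nat.card T := by
    have := Nat.card_le_card_of_surjective Φ hs
    rw [Nat.card_prod, Nat.card_prod, hc, Nat.card_zmod] at this
    omega
  have hr : Nat.card T = 3 := by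
    rw [hT3] at *
    generalize Module.finrank (ZMod 3) T = r at *
    rcases r with _ | _ | r
    · norm_num at hle
    · norm_num
    · exfalso
      have : 3 ^ 2 ∣ 48 := (pow_dvd_pow 3 (by omega : 2 ≤ r + 1 + 1)).trans hdvd
      norm_num at this
  have hb : Function.Bijective Φ := by
    rw [Nat.bijective_iff_surjective_and_card]
    refine ⟨hs, ?_⟩
    rw [Nat.card_prod, Nat.card_prod, hc, Nat.card_zmod, hr]
  have hcyc : IsAddCyclic T := isAddCyclic_of_prime_card (p := 3) hr
  let e3 : ZMod 3 ≃+ T := (ZMod.ringEquivCongr hr.symm).toAddEquiv.trans (zmodAddCyclicAddEquiv hcyc)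
  let e12 : ZMod 12 ≃+ ZMod 4 × ZMod 3 :=
    (ZMod.chineseRemainder (m := 4) (n := 3) (by decide)).toAddEquiv
  refine ⟨((AddEquiv.prodCongr e12 (AddEquiv.refl (ZMod 4))).trans
    (AddEquiv.prodAssoc.trans ?_)).symm⟩
  exact (AddEquiv.prodCongr (AddEquiv.refl _) (AddEquiv.prodComm.trans
    (AddEquiv.prodCongr (AddEquiv.refl _) e3))).trans (AddEquiv.ofBijective Φ hb)

theorem gen_of {N : Type} [AddCommGroup N] (p q : ℕ) (e : N ≃+ ZMod p × ZMod q) :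
    ∃ a b : N, ∀ v, ∃ m n : ℤ, v = m • a + n • b := by
  refine ⟨e.symm (1, 0), e.symm (0, 1), fun v => ?_⟩
  obtain ⟨m, hm⟩ := ZMod.intCast_surjective (e v).1
  obtain ⟨n, hn⟩ := ZMod.intCast_surjective (e v).2
  refine ⟨m, n, e.injective ?_⟩
  rw [map_add, map_zsmul, map_zsmul, e.apply_symm_apply, e.apply_symm_apply]
  refine Prod.ext ?_ ?_
  · simp [hm]
  · simp [hn]

theorem G_even (ρ : Representation ℤ GG ℤ) (hρ : ∀ g v, ρ g v = v) (m : ℕ) :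
    Nonempty (H ρ (2 * m + 4) ≃+ ZMod 12 × ZMod 4) := by
  have step : ∀ m, (∃ a b : H ρ (2 * m + 2), ∀ v, ∃ m n : ℤ, v = m • a + n • b) →
      Nonempty (H ρ (2 * m + 4) ≃+ ZMod 12 × ZMod 4) := by
    rintro m ⟨a, b, hab⟩
    obtain ⟨F, h4, h81⟩ := per ρ hρ (2 * m)
    exact alg2 (G_card ρ hρ m) F h4 h81 a b hab
  induction m with
  | zero =>
    obtain ⟨e⟩ := G_H2 ρ hρ
    exact step 0 (gen_of 0 4 e)
  | succ m ih =>
    obtain ⟨e⟩ := ih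
    exact step (m + 1) (gen_of 12 4 e)

end
end SL2Coh
end Part13

open CongruenceSubgroup

/-- The integral cohomology of `Γ₀(3)` and of `SL₂(ℤ[1/3])`:
`Hⁱ(Γ₀(3)) ≅ ℤ` for `i = 0, 1`, `ℤ/6` in positive even degrees and `ℤ/2` in odd
degrees `≥ 3`; and `Hⁱ(SL₂(ℤ[1/3]))` vanishes in odd degrees, is `ℤ ⊕ ℤ/4` in
degree 2, and `ℤ/12 ⊕ ℤ/4` in even degrees `≥ 4`. -/
theorem cohomology_Gamma0_three_and_SL2_Z_inv_three :
    Nonempty ((groupCohomology (Rep.trivial ℤ (Gamma0 3) ℤ) 0) ≃ₗ[ℤ] ℤ) ∧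
    Nonempty ((groupCohomology (Rep.trivial ℤ (Gamma0 3) ℤ) 1) ≃ₗ[ℤ] ℤ) ∧
    (∀ i : ℕ, 2 ≤ i → i % 2 = 0 →
      Nonempty ((groupCohomology (Rep.trivial ℤ (Gamma0 3) ℤ) i) ≃ₗ[ℤ] ZMod 6)) ∧
    (∀ i : ℕ, 3 ≤ i → i % 2 = 1 →
      Nonempty ((groupCohomology (Rep.trivial ℤ (Gamma0 3) ℤ) i) ≃ₗ[ℤ] ZMod 2)) ∧
    (∀ i : ℕ, 1 ≤ i → i % 2 = 1 →
      Subsingleton (groupCohomology (Rep.trivial ℤ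
        (Matrix.SpecialLinearGroup (Fin 2) (Localization.Away (3 : ℤ))) ℤ) i)) ∧
    Nonempty ((groupCohomology (Rep.trivial ℤ
      (Matrix.SpecialLinearGroup (Fin 2) (Localization.Away (3 : ℤ))) ℤ) 2) ≃ₗ[ℤ]
        (ℤ × ZMod 4)) ∧
    (∀ i : ℕ, 4 ≤ i → i % 2 = 0 →
      Nonempty ((groupCohomology (Rep.trivial ℤ
        (Matrix.SpecialLinearGroup (Fin 2) (Localization.Away (3 : ℤ))) ℤ) i) ≃ₗ[ℤ]
          (ZMod 12 × ZMod 4))) := by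
  have hσ : ∀ g v, (Representation.trivial ℤ (Gamma0 3) ℤ) g v = v := fun g v => rfl
  have hρ : ∀ g v, (Representation.trivial ℤ SL2Coh.GG ℤ) g v = v := fun g v => rfl
  refine ⟨?_, SL2Coh.Gamma_H1 _ hσ, ?_, ?_, ?_, ?_, ?_⟩
  · exact ⟨(groupCohomology.H0IsoOfIsTrivial (Rep.trivial ℤ (Gamma0 3) ℤ)).toLinearEquiv⟩
  · intro i hi h
    obtain ⟨m, rfl⟩ : ∃ m, i = 2 * m + 2 := ⟨i / 2 - 1, by omega⟩
    exact SL2Coh.Gamma_Heven _ hσ m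
  · intro i hi h
    obtain ⟨m, rfl⟩ : ∃ m, i = 2 * m + 3 := ⟨i / 2 - 1, by omega⟩
    exact SL2Coh.Gamma_Hodd _ hσ m
  · intro i hi h
    rcases Nat.lt_or_ge i 2 with h2 | h2
    · obtain rfl : i = 1 := by omega
      exact SL2Coh.G_one _ hρ
    · obtain ⟨m, rfl⟩ : ∃ m, i = 2 * m + 3 := ⟨i / 2 - 1, by omega⟩
      exact SL2Coh.G_odd _ hρ m
  · obtain ⟨e⟩ := SL2Coh.G_H2 _ hρ
    exact SL2Coh.toLin e
  · intro i hi h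
    obtain ⟨m, rfl⟩ : ∃ m, i = 2 * m + 4 := ⟨i / 2 - 2, by omega⟩
    obtain ⟨e⟩ := SL2Coh.G_even _ hρ m
    exact SL2Coh.toLin e
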